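/- Let (R,m,k) be a regular local ring and let I be an ideal of height d that is not generated by d elements, such that R/I satisfies Serre's condition S_2. Let x_1,…,x_s be a minimal set of generators of I. Then the natural map K_d(x;R) ⊗_R k → Tor_d^R(R/I, k) is the zero map. -/

import Mathlib

open IsLocalRing

universe u

variable (R : Type u) [CommRing R]

/-- Index type for the degree-`n` part of the Koszul complex on `s` generators:
`n`-element subsets of `Fin s` (i.e. strictly increasing `n`-tuples). -/
abbrev KIdx (s n : ℕ) : Type := {T : Finset (Fin s) // T.card = n}

/-- The degree-`n` part of the Koszul complex `K_•(x₁,…,x_s; R)`: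
the free `R`-module on `KIdx s n`. -/
abbrev KMod (s n : ℕ) : Type u := KIdx s n →₀ R

/-- The Koszul differential `K_{n+1}(x;R) → K_n(x;R)`,
`e_T ↦ ∑_{j ∈ T} (-1)^{#{i ∈ T : i < j}} x_j e_{T∖{j}}`. -/
noncomputable def koszulD {s : ℕ} (x : Fin s → R) (n : ℕ) :
    KMod R s (n + 1) →ₗ[R] KMod R s n :=
  Finsupp.lsum R fun T => LinearMap.toSpanSingleton R (KMod R s n)
    (∑ j ∈ T.1.attach,
      ((-1 : R) ^ (T.1.filter (fun i => i < j.1)).card * x j.1) •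
        Finsupp.single ⟨T.1.erase j.1, by
          simp [Finset.card_erase_of_mem j.2, T.2]⟩ (1 : R))

/-- A projective resolution `⋯ → F 1 → F 0 → M → 0` of an `R`-module `M`. -/
structure ProjRes (M : Type u) [AddCommGroup M] [Module R M] where
  F : ℕ → ModuleCat.{u} R
  d : ∀ n, F (n + 1) →ₗ[R] F n
  ε : F 0 →ₗ[R] M
  projective : ∀ n, Module.Projective R (F n)
  surj : Function.Surjective ε
  exact0 : LinearMap.ker ε = LinearMap.range (d 0)
  exact : ∀ n, LinearMap.ker (d n) = LinearMap.range (d (n + 1))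

/-- A chain map `ψ : K_•(x;R) → F_•` lifting the natural surjection
`R/(x₁,…,x_s) → R/I` (for `(x) ⊆ I`), where `F_•` is a projective resolution of
`R/I`.  The condition `aug` says that on `K_0 = R·e_∅` the augmentations are
compatible: `ε(ψ₀(r·e_∅)) = r mod I`. -/
structure KoszulLift {s : ℕ} (x : Fin s → R) (I : Ideal R)
    (P : ProjRes R (R ⧸ I)) where
  ψ : ∀ n, KMod R s n →ₗ[R] P.F n
  comm : ∀ n, (ψ n).comp (koszulD R x n) = (P.d n).comp (ψ (n + 1))
  aug : ∀ v : KMod R s 0, P.ε (ψ 0 v) = Ideal.Quotient.mk I (v ⟨∅, rfl⟩)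

/-- The natural map `K_i(x;R) ⊗ k → Tor_i^R(R/I, k)` is the zero map: for every
projective resolution `F_•` of `R/I` and every chain map `ψ : K_•(x;R) → F_•`
lifting the natural surjection `R/(x) → R/I`, every element of `ψ_i(K_i)` lies in
`im(d_{i+1}) + m·F_i`.  (As every element of `K_i ⊗ k` is a cycle, the induced
map on `i`-th homology `K_i ⊗ k → H_i(F_• ⊗ k) = Tor_i^R(R/I,k)` is zero exactly
when `ψ_i(K_i) ⊆ im(d_{i+1}) + m·F_i`.) -/
def KoszulTorMapZero [IsLocalRing R] {s : ℕ} (x : Fin s → R) (I : Ideal R)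
    (i : ℕ) : Prop :=
  ∀ (P : ProjRes R (R ⧸ I)) (L : KoszulLift R x I P) (v : KMod R s i),
    L.ψ i v ∈ LinearMap.range (P.d i) ⊔ (maximalIdeal R) • (⊤ : Submodule R (P.F i))

/-- `R` is a regular local ring: a Noetherian local ring whose maximal ideal is
generated by `dim R` elements. -/
def IsRegularLocal [IsLocalRing R] : Prop :=
  IsNoetherianRing R ∧ ∃ (n : ℕ) (x : Fin n → R),
    Ideal.span (Set.range x) = maximalIdeal R ∧ ringKrullDim R = n

/-- The ideal `I` has height `d`: `d` is the minimum of the heights of the primes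
containing `I`, the height of a prime `P` being `dim R_P`. -/
def HeightEq (I : Ideal R) (d : ℕ) : Prop :=
  (∃ (P : Ideal R) (h : P.IsPrime), I ≤ P ∧
      ringKrullDim (@Localization.AtPrime R _ P h) = d) ∧
    ∀ (P : Ideal R) (h : P.IsPrime), I ≤ P →
      (d : WithBot ℕ∞) ≤ ringKrullDim (@Localization.AtPrime R _ P h)

/-- Serre's condition `S_n` for the ring `A`: for every prime `P` of `A`,
`depth A_P ≥ min(n, dim A_P)`, expressed by the existence of regular sequences
in the maximal ideal of `A_P` of every length `j ≤ min(n, dim A_P)`. -/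
def SerreS (A : Type u) [CommRing A] (n : ℕ) : Prop :=
  ∀ (P : Ideal A) (h : P.IsPrime) (j : ℕ), j ≤ n →
    (j : WithBot ℕ∞) ≤ ringKrullDim (@Localization.AtPrime A _ P h) →
      ∃ rs : List (@Localization.AtPrime A _ P h), rs.length = j ∧
        (∀ r ∈ rs, r ∈ maximalIdeal (@Localization.AtPrime A _ P h)) ∧
        RingTheory.Sequence.IsWeaklyRegular (@Localization.AtPrime A _ P h) rs

/-- `x₁, …, x_s` is a minimal set of generators of `I`: the `x_j` generate `I`
and no `x_j` is redundant (over a local ring this says exactly that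
`s = dim_k I/mI`). -/
def MinimalGenerators {s : ℕ} (x : Fin s → R) (I : Ideal R) : Prop :=
  Ideal.span (Set.range x) = I ∧
    ∀ j, x j ∉ Ideal.span (x '' ({j}ᶜ : Set (Fin s)))

namespace KoszulTor

section Operators

variable {R : Type*} [CommRing R] {n : ℕ} {M : Type*} [AddCommGroup M] [Module R M]

/-- The sign `(-1)^{#{i ∈ T : i < j}}`. -/
def sgn (T : Finset (Fin n)) (j : Fin n) : ℤ := (-1) ^ (T.filter (fun i => i < j)).card

/-- Coefficient families indexed by subsets of `Fin n`: the exterior algebra on `n` generators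
with coefficients in `M`. -/
abbrev KV (n : ℕ) (M : Type*) : Type _ := Finset (Fin n) → M

lemma sgn_mul_self (T : Finset (Fin n)) (j : Fin n) : sgn T j * sgn T j = 1 := by
  simp [sgn, ← mul_pow]

lemma sgn_insert (T : Finset (Fin n)) {i : Fin n} (h : i ∉ T) (j : Fin n) :
    sgn (insert i T) j = (if i < j then -1 else 1) * sgn T j := by
  unfold sgn
  rw [Finset.filter_insert]
  split_ifs with hij
  · rw [Finset.card_insert_of_notMem (by simp [h]), pow_succ, mul_comm]
  · simp

lemma sgn_erase (T : Finset (Fin n)) {i : Fin n} (h : i ∈ T) (j : Fin n) :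
    sgn (T.erase i) j = (if i < j then -1 else 1) * sgn T j := by
  have := sgn_insert (T.erase i) (Finset.notMem_erase i T) j
  rw [Finset.insert_erase h] at this
  rw [this]
  split_ifs <;> ring

/-- Exterior multiplication by the `j`-th basis vector. -/
def crea (R : Type*) [CommRing R] {n : ℕ} {M : Type*} [AddCommGroup M] [Module R M] (j : Fin n) :
    KV n M →ₗ[R] KV n M where
  toFun u T := if j ∈ T then sgn T j • u (T.erase j) else 0
  map_add' u v := by ext T; simp only [Pi.add_apply]; split_ifs <;> simp
  map_smul' r u := by
    ext T
    simp only [Pi.smul_apply, RingHom.id_apply]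
    split_ifs
    · rw [smul_comm]
    · simp

/-- Contraction with the `j`-th coordinate function. -/
def anni (R : Type*) [CommRing R] {n : ℕ} {M : Type*} [AddCommGroup M] [Module R M] (j : Fin n) :
    KV n M →ₗ[R] KV n M where
  toFun u T := if j ∈ T then 0 else sgn T j • u (insert j T)
  map_add' u v := by ext T; simp only [Pi.add_apply]; split_ifs <;> simp
  map_smul' r u := by
    ext T
    simp only [Pi.smul_apply, RingHom.id_apply]
    split_ifs
    · simp
    · rw [smul_comm]

lemma crea_apply (j : Fin n) (u : KV n M) (T : Finset (Fin n)) :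
    crea R j u T = if j ∈ T then sgn T j • u (T.erase j) else 0 := rfl

lemma anni_apply (j : Fin n) (u : KV n M) (T : Finset (Fin n)) :
    anni R j u T = if j ∈ T then 0 else sgn T j • u (insert j T) := rfl

lemma crea_self (j : Fin n) (u : KV n M) : crea R j (crea R j u) = 0 := by
  ext T; simp [crea_apply]

lemma anni_self (j : Fin n) (u : KV n M) : anni R j (anni R j u) = 0 := by
  ext T; simp [anni_apply]

lemma crea_crea (i j : Fin n) (u : KV n M) :
    crea R i (crea R j u) = - crea R j (crea R i u) := by
  by_cases hij : i = j
  · subst hij; simp [crea_self]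
  ext T
  simp only [crea_apply, Pi.neg_apply, Finset.mem_erase]
  by_cases hi : i ∈ T <;> by_cases hj : j ∈ T <;> simp only [hi, hj, if_true, if_false, and_true,
    and_false, ne_eq, hij, Ne.symm hij, not_false_eq_true, smul_zero, neg_zero, smul_smul, sgn_erase,
    (Ne.symm hij : ¬ j = i)]
  rw [Finset.erase_right_comm, ← neg_smul]
  congr 1
  rcases lt_or_gt_of_ne hij with h | h <;> simp [h, not_lt_of_gt h] <;> ring

lemma anni_anni (i j : Fin n) (u : KV n M) :
    anni R i (anni R j u) = - anni R j (anni R i u) := by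
  by_cases hij : i = j
  · subst hij; simp [anni_self]
  ext T
  simp only [anni_apply, Pi.neg_apply, Finset.mem_insert]
  by_cases hi : i ∈ T <;> by_cases hj : j ∈ T <;> simp only [hi, hj, if_true, if_false, or_true,
    or_false, hij, smul_zero, neg_zero, smul_smul, sgn_insert, not_false_eq_true,
    (Ne.symm hij : ¬ j = i)]
  rw [Finset.insert_comm, ← neg_smul]
  congr 1
  rcases lt_or_gt_of_ne hij with h | h <;> simp [h, not_lt_of_gt h] <;> ring

lemma anni_crea (i j : Fin n) (u : KV n M) :
    anni R i (crea R j u) = (if i = j then u else 0) - crea R j (anni R i u) := by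
  ext T
  by_cases hij : i = j
  · subst hij
    by_cases hi : i ∈ T <;>
      simp [crea_apply, anni_apply, hi, smul_smul, sgn_insert, sgn_erase, sgn_mul_self]
  · have hji : ¬ j = i := Ne.symm hij
    simp only [anni_apply, crea_apply, Pi.sub_apply, Finset.mem_insert, hij, hji, if_false,
      Finset.mem_erase, Pi.zero_apply, zero_sub]
    by_cases hi : i ∈ T <;> by_cases hj : j ∈ T <;> simp only [hi, hj, if_true, if_false, or_true,
      or_false, smul_zero, neg_zero, smul_smul, not_false_eq_true, hij, hji, ne_eq, and_true,
      and_false, false_or]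
    rw [sgn_insert _ hi, sgn_erase _ hj, Finset.erase_insert_of_ne hij, ← neg_smul]
    congr 1
    rcases lt_or_gt_of_ne hij with h | h <;> simp [h, not_lt_of_gt h] <;> ring

/-- Exterior multiplication by the vector `v`. -/
def wedge (v : Fin n → R) : KV n M →ₗ[R] KV n M := ∑ j, v j • crea R j

/-- The Koszul differential (contraction with `y`). -/
def contr (y : Fin n → R) : KV n M →ₗ[R] KV n M := ∑ j, y j • anni R j

lemma wedge_apply (v : Fin n → R) (u : KV n M) : wedge v u = ∑ j, v j • crea R j u := by
  simp [wedge]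

lemma contr_apply (v : Fin n → R) (u : KV n M) : contr v u = ∑ j, v j • anni R j u := by
  simp [contr]

lemma sum_sum_eq_zero_of_antisymm {ι A : Type*} [Fintype ι] [AddCommGroup A]
    (f : ι → ι → A) (h0 : ∀ i, f i i = 0) (h : ∀ i j, f i j = - f j i) :
    ∑ i, ∑ j, f i j = 0 := by
  classical
  rw [← Fintype.sum_prod_type']
  refine Finset.sum_involution (fun p _ => p.swap) ?_ ?_ ?_ ?_
  · rintro ⟨i, j⟩ _; simp [h i j]
  · rintro ⟨i, j⟩ _ hne heq
    apply hne
    have : i = j := by simpa using (congrArg Prod.snd heq)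
    subst this; exact h0 i
  · simp
  · simp

lemma wedge_self (v : Fin n → R) (u : KV n M) : wedge v (wedge v u) = 0 := by
  simp only [wedge_apply, map_sum, map_smul, Finset.smul_sum]
  refine sum_sum_eq_zero_of_antisymm _ (fun i => ?_) (fun i j => ?_)
  · simp [crea_self]
  · rw [crea_crea, smul_neg, smul_neg, smul_comm]

lemma contr_contr (y : Fin n → R) (u : KV n M) : contr y (contr y u) = 0 := by
  simp only [contr_apply, map_sum, map_smul, Finset.smul_sum]
  refine sum_sum_eq_zero_of_antisymm _ (fun i => ?_) (fun i j => ?_)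
  · simp [anni_self]
  · rw [anni_anni, smul_neg, smul_neg, smul_comm]

lemma contr_wedge (y v : Fin n → R) (u : KV n M) :
    contr y (wedge v u) = (∑ j, v j * y j) • u - wedge v (contr y u) := by
  simp only [wedge_apply, contr_apply, map_sum, map_smul, Finset.smul_sum, anni_crea]
  simp only [smul_sub, Finset.sum_sub_distrib]
  congr 1
  · simp [smul_smul, Finset.sum_smul]
  · rw [Finset.sum_comm]
    exact Finset.sum_congr rfl fun j _ => Finset.sum_congr rfl fun i _ => smul_comm _ _ _

/-- The pairing between coordinate families. -/
def pair (A : KV n R) (u : KV n M) : M := ∑ T, A T • u T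

lemma pair_crea (j : Fin n) (A : KV n R) (u : KV n M) :
    pair (crea R j A) u = pair A (anni R j u) := by
  classical
  simp only [pair, crea_apply, anni_apply, ite_smul, zero_smul, smul_ite, smul_zero]
  have e : ∀ T : Finset (Fin n), (if j ∈ T then 0 else A T • sgn T j • u (insert j T)) =
      if ¬ j ∈ T then A T • sgn T j • u (insert j T) else 0 := fun T => by split_ifs <;> rfl
  simp only [e]
  rw [← Finset.sum_filter, ← Finset.sum_filter]
  refine Finset.sum_nbij' (fun T => T.erase j) (fun T => insert j T) ?_ ?_ ?_ ?_ ?_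
  · simp
  · simp
  · intro T hT; simp only [Finset.mem_filter] at hT; exact Finset.insert_erase hT.2
  · intro T hT; simp only [Finset.mem_filter] at hT; exact Finset.erase_insert hT.2
  · intro T hT
    simp only [Finset.mem_filter] at hT
    rw [sgn_erase _ hT.2, Finset.insert_erase hT.2, smul_assoc, if_neg (lt_irrefl j), one_mul]
    exact smul_comm _ _ _

lemma pair_wedge (y : Fin n → R) (A : KV n R) (u : KV n M) :
    pair (wedge y A) u = pair A (contr y u) := by
  have e1 : ∀ (s : Finset (Fin n)) (f : Fin n → KV n R),
      pair (∑ j ∈ s, f j) u = ∑ j ∈ s, pair (f j) u := by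
    intro s f
    simp only [pair, Finset.sum_apply, Finset.sum_smul]
    exact Finset.sum_comm
  have e2 : ∀ (s : Finset (Fin n)) (f : Fin n → KV n M),
      pair A (∑ j ∈ s, f j) = ∑ j ∈ s, pair A (f j) := by
    intro s f
    simp only [pair, Finset.sum_apply, Finset.smul_sum]
    exact Finset.sum_comm
  rw [wedge_apply, contr_apply, e1, e2]
  refine Finset.sum_congr rfl fun j _ => ?_
  have h1 : pair (y j • crea R j A) u = y j • pair (crea R j A) u := by
    simp [pair, Finset.smul_sum, mul_smul]
  have h2 : pair A (y j • anni R j u) = y j • pair A (anni R j u) := by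
    simp only [pair, Finset.smul_sum, Pi.smul_apply]
    exact Finset.sum_congr rfl fun T _ => smul_comm _ _ _
  rw [h1, h2, pair_crea]

end Operators

section Transfer

variable {R : Type u} [CommRing R] {n s : ℕ} {M N : Type*} [AddCommGroup M] [Module R M]
  [AddCommGroup N] [Module R N]

/-- The unit `e_∅`. -/
def eOne : KV n R := Pi.single ∅ 1

/-- The iterated exterior product `a_{k-1} ∧ ⋯ ∧ a_0`. -/
def wp (a : ℕ → Fin n → R) : ℕ → KV n R
  | 0 => eOne
  | k + 1 => wedge (a k) (wp a k)

lemma contr_map (y : Fin n → R) (f : M →ₗ[R] N) (u : KV n M) :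
    contr y (fun T => f (u T)) = fun T => f (contr y u T) := by
  ext T
  simp only [contr_apply, Finset.sum_apply, Pi.smul_apply, map_sum, map_smul, anni_apply]
  refine Finset.sum_congr rfl fun j _ => ?_
  split_ifs <;> simp

lemma wedge_map (y : Fin n → R) (f : M →ₗ[R] N) (u : KV n M) :
    wedge y (fun T => f (u T)) = fun T => f (wedge y u T) := by
  ext T
  simp only [wedge_apply, Finset.sum_apply, Pi.smul_apply, map_sum, map_smul, crea_apply]
  refine Finset.sum_congr rfl fun j _ => ?_
  split_ifs <;> simp

lemma wedge_empty (v : Fin n → R) (u : KV n M) : wedge v u ∅ = 0 := by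
  simp [wedge_apply, crea_apply]

lemma contr_eOne (y : Fin n → R) : contr y (eOne : KV n R) = 0 := by
  ext T
  simp [contr_apply, anni_apply, eOne, Pi.single_apply, Finset.insert_ne_empty]

/-- The grading involution. -/
def ginv (R : Type*) [CommRing R] {n : ℕ} {M : Type*} [AddCommGroup M] [Module R M] :
    KV n M →ₗ[R] KV n M where
  toFun u T := ((-1 : ℤ) ^ T.card) • u T
  map_add' u v := by ext; simp
  map_smul' r u := by ext T; exact smul_comm _ _ _

lemma ginv_apply (u : KV n M) (T : Finset (Fin n)) :
    ginv R u T = ((-1 : ℤ) ^ T.card) • u T := rfl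

lemma ginv_ginv (u : KV n M) : ginv R (ginv R u) = u := by
  ext T; simp [ginv_apply, smul_smul, ← mul_pow]

lemma wedge_ginv (v : Fin n → R) (u : KV n M) :
    wedge v (ginv R u) = - ginv R (wedge v u) := by
  ext T
  simp only [wedge_apply, Finset.sum_apply, Pi.smul_apply, Pi.neg_apply, ginv_apply, crea_apply,
    Finset.smul_sum, ← Finset.sum_neg_distrib]
  refine Finset.sum_congr rfl fun j _ => ?_
  split_ifs with h
  · rw [← Finset.card_erase_add_one h, pow_succ, mul_neg, mul_one, neg_smul, neg_neg,
      smul_comm (sgn T j), smul_comm (v j)]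
  · simp

lemma contr_ginv (v : Fin n → R) (u : KV n M) :
    contr v (ginv R u) = - ginv R (contr v u) := by
  ext T
  simp only [contr_apply, Finset.sum_apply, Pi.smul_apply, Pi.neg_apply, ginv_apply, anni_apply,
    Finset.smul_sum, ← Finset.sum_neg_distrib]
  refine Finset.sum_congr rfl fun j _ => ?_
  split_ifs with h
  · simp
  · rw [Finset.card_insert_of_notMem h, pow_succ, mul_neg, mul_one, neg_smul, smul_neg, smul_neg,
      smul_comm (sgn T j), smul_comm (v j)]

/-- The bigraded Koszul cycle built from `v_k ⊗ 1 - 1 ⊗ a_k`. -/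
def bicycle (v : ℕ → Fin s → R) (a : ℕ → Fin n → R) : ℕ → KV s (KV n R)
  | 0 => Pi.single ∅ eOne
  | k + 1 => wedge (v k) (bicycle v a k) - ginv R (fun T => wedge (a k) (bicycle v a k T))

lemma bicycle_cycle (x : Fin s → R) (y : Fin n → R) (v : ℕ → Fin s → R) (a : ℕ → Fin n → R)
    (h : ∀ k, ∑ i, v k i * x i = ∑ j, a k j * y j) (k : ℕ) :
    contr x (bicycle v a k) + ginv R (fun T => contr y (bicycle v a k T)) = 0 := by
  induction k with
  | zero =>
    ext T : 1
    have : contr x (Pi.single ∅ (eOne : KV n R) : KV s (KV n R)) = 0 := by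
      ext T
      simp [contr_apply, anni_apply, Pi.single_apply, Finset.insert_ne_empty]
    rw [bicycle, this]
    simp only [ginv_apply, Pi.add_apply, Pi.zero_apply, zero_add]
    by_cases hT : T = ∅
    · subst hT; simp [contr_eOne]
    · simp [Pi.single_apply, hT]
  | succ k ih =>
    set u := bicycle v a k with hu
    have e1 : contr x (fun T => wedge (a k) (u T)) = fun T => wedge (a k) (contr x u T) :=
      contr_map x (wedge (a k)) u
    have e2 : (fun T => contr y (wedge (v k) u T)) = wedge (v k) (fun T => contr y (u T)) :=
      (wedge_map (v k) (contr y) u).symm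
    have e3 : (fun T => contr y (ginv R (fun T => wedge (a k) (u T)) T)) =
        ginv R (fun T => contr y (wedge (a k) (u T))) := by
      ext T : 1
      simp only [ginv_apply, map_zsmul]
    have e4 : (fun T => contr y (wedge (a k) (u T))) =
        (∑ j, a k j * y j) • u - fun T => wedge (a k) (contr y (u T)) := by
      ext T : 1
      rw [contr_wedge]; rfl
    have e5 : (fun T => wedge (a k) (ginv R (fun T => contr y (u T)) T)) =
        ginv R (fun T => wedge (a k) (contr y (u T))) := by
      ext T : 1
      simp only [ginv_apply, map_zsmul]
    have ih' : contr x u = - ginv R (fun T => contr y (u T)) := eq_neg_of_add_eq_zero_left ih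
    have e6 : (fun T => wedge (a k) (contr x u T)) =
        - ginv R (fun T => wedge (a k) (contr y (u T))) := by
      rw [ih', ← e5]; ext T : 1; simp
    have e7 : (fun T => contr y (bicycle v a (k + 1) T)) =
        wedge (v k) (fun T => contr y (u T)) -
          ginv R (fun T => contr y (wedge (a k) (u T))) := by
      rw [← e2, ← e3]; ext T : 1; simp [bicycle, hu]
    rw [e7, bicycle, ← hu, map_sub, map_sub, contr_wedge, contr_ginv, e1, e6, ginv_ginv, e4, ih', h,
      map_neg, wedge_ginv, map_neg, ginv_ginv]
    abel

lemma bicycle_empty_left (v : ℕ → Fin s → R) (a : ℕ → Fin n → R) (k : ℕ) :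
    bicycle v a k ∅ = ((-1 : R) ^ k) • wp a k := by
  induction k with
  | zero => simp [bicycle, wp]
  | succ k ih =>
    rw [bicycle, Pi.sub_apply, wedge_empty, ginv_apply, ih, wp]
    simp [pow_succ]

lemma bicycle_empty_right (v : ℕ → Fin s → R) (a : ℕ → Fin n → R) (k : ℕ) :
    (fun T => bicycle v a k T ∅) = wp v k := by
  induction k with
  | zero =>
    ext T
    by_cases h : T = ∅
    · subst h; simp [bicycle, wp, eOne]
    · simp [bicycle, wp, eOne, Pi.single_apply, h]
  | succ k ih =>
    rw [wp, ← ih]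
    have := wedge_map (v k) (LinearMap.proj (R := R) (φ := fun _ : Finset (Fin n) => R) ∅)
      (bicycle v a k)
    simp only [LinearMap.proj_apply] at this
    rw [this]
    ext T
    simp [bicycle, ginv_apply, wedge_empty]

/-- Restriction of a coefficient family to the degree-`i` part of the Koszul complex. -/
noncomputable def restr (i : ℕ) : KV s R →ₗ[R] KMod R s i where
  toFun g := Finsupp.equivFunOnFinite.symm (fun T => g T.1)
  map_add' f g := by ext; simp
  map_smul' f g := by ext; simp

@[simp] lemma restr_apply (i : ℕ) (g : KV s R) (T : KIdx s i) : restr i g T = g T.1 := rfl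

lemma koszulD_restr (x : Fin s → R) (i : ℕ) (g : KV s R) :
    koszulD R x i (restr (i + 1) g) = restr i (contr x g) := by
  ext T
  have e : restr (i + 1) g = ∑ T' : KIdx s (i + 1), Finsupp.single T' (g T'.1) := by
    ext U; simp [Finsupp.finset_sum_apply, Finsupp.single_apply]
  rw [e, map_sum, Finsupp.finset_sum_apply]
  simp only [koszulD, Finsupp.lsum_single, LinearMap.toSpanSingleton_apply, Finsupp.smul_apply,
    Finsupp.finset_sum_apply, restr_apply, contr_apply, Finset.sum_apply, Pi.smul_apply, anni_apply,
    Finsupp.single_apply, Finset.smul_sum, smul_eq_mul]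
  have e2 : ∀ T' : KIdx s (i + 1), ∑ j ∈ T'.1.attach, g T'.1 *
      ((-1) ^ (T'.1.filter (fun i => i < j.1)).card * x j.1 *
        if (⟨T'.1.erase j.1, by simp [Finset.card_erase_of_mem j.2, T'.2]⟩ : KIdx s i) = T
          then (1 : R) else 0) =
      ∑ j : Fin s, if j ∈ T'.1 ∧ T'.1.erase j = T.1 then x j * (sgn T.1 j • g (insert j T.1))
        else 0 := by
    intro T'
    rw [Finset.sum_attach T'.1 (fun j => g T'.1 *
      ((-1) ^ (T'.1.filter (fun i => i < j)).card * x j * if (T'.1.erase j = T.1)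
          then (1 : R) else 0)) |>.symm.symm.trans ?_ |> fun h => (Finset.sum_congr rfl ?_).trans h]
    · rw [← Finset.sum_filter, ← Finset.sum_filter_add_sum_filter_not T'.1
        (fun j => T'.1.erase j = T.1)]
      rw [Finset.sum_eq_zero (s := T'.1.filter fun j => ¬ T'.1.erase j = T.1), add_zero]
      · refine Finset.sum_congr (by ext j; simp) ?_
        intro j hj
        simp only [Finset.mem_filter, Finset.mem_univ, true_and] at hj
        rw [if_pos hj.2, ← hj.2, sgn_erase _ hj.1, if_neg (lt_irrefl j), one_mul,
          Finset.insert_erase hj.1, sgn, zsmul_eq_mul]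
        push_cast; ring
      · intro j hj
        simp only [Finset.mem_filter] at hj
        simp [hj.2]
    · intro j _
      simp only [Subtype.ext_iff]
  rw [Finset.sum_congr rfl fun T' _ => e2 T', Finset.sum_comm]
  refine Finset.sum_congr rfl fun j _ => ?_
  split_ifs with hj
  · rw [mul_zero]
    refine Finset.sum_eq_zero fun T' _ => if_neg ?_
    rintro ⟨_, h2⟩
    exact Finset.notMem_erase j T'.1 (h2 ▸ hj)
  · rw [Finset.sum_eq_single (⟨insert j T.1, by simp [hj, T.2]⟩ : KIdx s (i + 1))]
    · simp [hj]
    · intro T' _ hne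
      refine if_neg ?_
      rintro ⟨h1, h2⟩
      exact hne (Subtype.ext (by simp [← h2, Finset.insert_erase h1]))
    · simp

variable [IsLocalRing R]

theorem lift_wp_mem {I : Ideal R} {x : Fin s → R} {P : ProjRes R (R ⧸ I)}
    (L : KoszulLift R x I P) {y : Fin n → R} (hy : ∀ j, y j ∈ maximalIdeal R)
    (v : ℕ → Fin s → R) (a : ℕ → Fin n → R)
    (h : ∀ k, ∑ i, v k i * x i = ∑ j, a k j * y j) (d : ℕ)
    (hP : ∃ κ : KV n R, ∀ T, wp a d T - contr y κ T ∈ I) :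
    L.ψ d (restr d (wp v d)) ∈
      LinearMap.range (P.d d) ⊔ (maximalIdeal R) • (⊤ : Submodule R (P.F d)) := by
  set w := bicycle v a d with hw
  let u : KV n (KV s R) := fun U T => w T U
  let wF : ∀ i, KV n (P.F i) := fun i U => L.ψ i (restr i (u U))
  have hcyc : ∀ i U, restr i (contr x (u U)) = (-(-1 : R) ^ i) • restr i (contr y u U) := by
    intro i U
    ext T
    have h1 := congrFun (congrFun (bicycle_cycle x y v a h d) T.1) U
    have h3 := congrFun (contr_map y
      (LinearMap.proj (R := R) (φ := fun _ : Finset (Fin s) => R) T.1) u) U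
    simp only [LinearMap.proj_apply] at h3
    simp only [restr_apply, Finsupp.smul_apply, smul_eq_mul]
    rw [← h3]
    rw [← hw] at h1
    simp only [Pi.add_apply, ginv_apply, Pi.zero_apply, Pi.smul_apply, T.2] at h1
    have h4 : contr x (u U) T.1 = contr x w T.1 U :=
      congrFun (contr_map x (LinearMap.proj (R := R) (φ := fun _ : Finset (Fin n) => R) U) w) T.1
    rw [h4, eq_neg_of_add_eq_zero_left h1]
    simp only [u]
    rw [zsmul_eq_mul]
    push_cast
    ring
  have hd : ∀ i U, P.d i (wF (i + 1) U) = (-(-1 : R) ^ i) • contr y (wF i) U := by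
    intro i U
    have h1 := LinearMap.congr_fun (L.comm i) (restr (i + 1) (u U))
    simp only [LinearMap.comp_apply] at h1
    have h2 := congrFun (contr_map y (L.ψ i ∘ₗ restr i) u) U
    simp only [LinearMap.comp_apply] at h2
    rw [← h1, koszulD_restr, hcyc, map_smul, ← h2]
  have key : ∀ i, ∃ (τ : KV n (P.F i)) (τ' : KV n (P.F (i + 1))),
      ∀ U, wF i U = contr y τ U + P.d i (τ' U) := by
    intro i
    induction i with
    | zero =>
      obtain ⟨κ, hκ⟩ := hP
      let ρ : R →ₗ[R] P.F 0 := L.ψ 0 ∘ₗ Finsupp.lsingle ⟨∅, rfl⟩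
      have hρ : ∀ U, wF 0 U = (-1 : R) ^ d • ρ (wp a d U) := by
        intro U
        rw [← map_smul]
        simp only [wF, ρ, LinearMap.comp_apply]
        congr 1
        ext T
        have hT : T = ⟨∅, rfl⟩ := Subtype.ext (Finset.card_eq_zero.mp T.2)
        subst hT
        have := congrFun (bicycle_empty_left v a d) U
        simp [u, hw, this]
      have hι : ∀ U, ∃ t, P.d 0 t = ρ (wp a d U - contr y κ U) := by
        intro U
        rw [← LinearMap.mem_range, ← P.exact0, LinearMap.mem_ker]
        simp only [ρ, LinearMap.comp_apply]
        rw [L.aug, Ideal.Quotient.eq_zero_iff_mem]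
        simpa using hκ U
      choose t ht using hι
      refine ⟨(-1 : R) ^ d • fun U => ρ (κ U), (-1 : R) ^ d • t, fun U => ?_⟩
      rw [hρ, map_smul, contr_map y ρ κ]
      simp only [Pi.smul_apply, map_smul, ht, ← smul_add]
      simp
    | succ i ih =>
      obtain ⟨τ, τ', hτ⟩ := ih
      have hτ2 : wF i = contr y τ + fun U => P.d i (τ' U) := funext hτ
      have h1 : ∀ U, ∃ t, P.d (i + 1) t = wF (i + 1) U - (-(-1 : R) ^ i) • contr y τ' U := by
        intro U
        rw [← LinearMap.mem_range, ← P.exact, LinearMap.mem_ker, map_sub, hd, hτ2, map_add,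
          contr_contr, zero_add, contr_map y (P.d i) τ', map_smul, sub_self]
      choose t ht using h1
      refine ⟨(-(-1 : R) ^ i) • τ', t, fun U => ?_⟩
      rw [ht, map_smul, Pi.smul_apply]
      abel
  obtain ⟨τ, τ', hτ⟩ := key d
  have h0 : restr d (wp v d) = restr d (u ∅) := by
    rw [← bicycle_empty_right v a d]
  have h1 := hτ ∅
  simp only [wF] at h1
  rw [h0, h1, add_comm (contr y τ ∅)]
  refine Submodule.add_mem_sup ⟨_, rfl⟩ ?_
  rw [contr_apply, Finset.sum_apply]
  exact Submodule.sum_mem _ fun j _ => Submodule.smul_mem_smul (hy j) trivial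

end Transfer

section RegSeq

variable {R : Type*} [CommRing R]

/-- The ideal generated by the first `i` terms of a sequence. -/
def Id (w : ℕ → R) (i : ℕ) : Ideal R := Ideal.span (w '' Set.Iio i)

/-- The first `k` terms of `w` form a weakly regular sequence. -/
def RegSeq (w : ℕ → R) (k : ℕ) : Prop := ∀ i < k, ∀ r, w i * r ∈ Id w i → r ∈ Id w i

lemma Id_zero (w : ℕ → R) : Id w 0 = ⊥ := by simp [Id]

lemma Id_succ (w : ℕ → R) (i : ℕ) : Id w (i + 1) = Id w i ⊔ Ideal.span {w i} := by
  rw [Id, Id, ← Ideal.span_union]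
  congr 1
  rw [← Set.image_singleton, ← Set.image_union]
  congr 1
  ext j; simp [Nat.lt_succ_iff_lt_or_eq]

lemma mem_Id_succ {w : ℕ → R} {i : ℕ} {r : R} :
    r ∈ Id w (i + 1) ↔ ∃ t, r - w i * t ∈ Id w i := by
  rw [Id_succ, sup_comm, Submodule.mem_sup]
  constructor
  · rintro ⟨a, ha, b, hb, rfl⟩
    obtain ⟨t, rfl⟩ := Ideal.mem_span_singleton'.mp ha
    exact ⟨t, by convert hb using 1; ring⟩
  · rintro ⟨t, ht⟩
    exact ⟨w i * t, Ideal.mul_mem_right _ _ (Ideal.mem_span_singleton_self _), _, ht, by ring⟩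

lemma Id_mono (w : ℕ → R) {i j : ℕ} (h : i ≤ j) : Id w i ≤ Id w j :=
  Ideal.span_mono (Set.image_mono (Set.Iio_subset_Iio h))

lemma mem_Id {w : ℕ → R} {i j : ℕ} (h : i < j) : w i ∈ Id w j :=
  Ideal.subset_span ⟨i, h, rfl⟩

lemma Id_le {w : ℕ → R} {k : ℕ} {I : Ideal R} (h : ∀ i < k, w i ∈ I) : Id w k ≤ I :=
  Ideal.span_le.mpr (by rintro _ ⟨i, hi, rfl⟩; exact h i hi)

lemma Id_congr {w w' : ℕ → R} {k : ℕ} (h : ∀ i < k, w i = w' i) : Id w k = Id w' k := by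
  unfold Id
  congr 1
  exact Set.image_congr fun i hi => h i hi

lemma exists_coeff {w : ℕ → R} {k : ℕ} {r : R} (h : r ∈ Id w k) :
    ∃ c : ℕ → R, r = ∑ j ∈ Finset.range k, c j * w j := by
  induction k generalizing r with
  | zero => exact ⟨0, by simpa [Id_zero] using h⟩
  | succ k ih =>
    obtain ⟨t, ht⟩ := mem_Id_succ.mp h
    obtain ⟨c, hc⟩ := ih ht
    refine ⟨Function.update c k t, ?_⟩
    rw [Finset.sum_range_succ, Function.update_self, Finset.sum_congr rfl fun j hj => by
      rw [Function.update_of_ne (Finset.mem_range.mp hj).ne], ← hc]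
    ring

end RegSeq

section Acyclic

variable {R : Type*} [CommRing R] {n : ℕ}

/-- All coefficients of `u` lie in `I`. -/
def In (I : Ideal R) (u : KV n R) : Prop := ∀ T, u T ∈ I

lemma In.add {I : Ideal R} {u v : KV n R} (hu : In I u) (hv : In I v) : In I (u + v) :=
  fun T => I.add_mem (hu T) (hv T)

lemma In.sub {I : Ideal R} {u v : KV n R} (hu : In I u) (hv : In I v) : In I (u - v) :=
  fun T => I.sub_mem (hu T) (hv T)

lemma In.smul {I : Ideal R} {u : KV n R} (hu : In I u) (r : R) : In I (r • u) :=
  fun T => I.mul_mem_left r (hu T)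

lemma In.smul_of_mem {I : Ideal R} {r : R} (hr : r ∈ I) (u : KV n R) : In I (r • u) :=
  fun T => I.mul_mem_right (u T) hr

lemma In.mono {I J : Ideal R} (h : I ≤ J) {u : KV n R} (hu : In I u) : In J u :=
  fun T => h (hu T)

lemma In.wedge {I : Ideal R} {u : KV n R} (hu : In I u) (v : Fin n → R) :
    In I (wedge v u) := by
  intro T
  rw [wedge_apply, Finset.sum_apply]
  refine I.sum_mem fun j _ => I.mul_mem_left _ ?_
  rw [crea_apply]
  split_ifs
  · rw [zsmul_eq_mul]; exact I.mul_mem_left _ (hu _)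
  · exact I.zero_mem

lemma In.contr {I : Ideal R} {u : KV n R} (hu : In I u) (v : Fin n → R) :
    In I (contr v u) := by
  intro T
  rw [contr_apply, Finset.sum_apply]
  refine I.sum_mem fun j _ => I.mul_mem_left _ ?_
  rw [anni_apply]
  split_ifs
  · exact I.zero_mem
  · rw [zsmul_eq_mul]; exact I.mul_mem_left _ (hu _)

lemma contr_crea (y : Fin n → R) (j : Fin n) (u : KV n R) :
    contr y (crea R j u) = y j • u - crea R j (contr y u) := by
  have h : ∀ u : KV n R, crea R j u = wedge (Pi.single j (1 : R)) u := by
    intro u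
    rw [wedge_apply, Finset.sum_eq_single j] <;> simp +contextual [Pi.single_apply]
  rw [h, h, contr_wedge]
  simp [Pi.single_apply]

lemma anni_contr (y : Fin n → R) (j : Fin n) (u : KV n R) :
    anni R j (contr y u) = - contr y (anni R j u) := by
  simp only [contr_apply, map_sum, map_smul, ← Finset.sum_neg_distrib]
  refine Finset.sum_congr rfl fun i _ => ?_
  rw [anni_anni, smul_neg]

/-- Acyclicity of the Koszul complex in positive degrees. -/
def Acyclic (y : Fin n → R) : Prop :=
  ∀ u : KV n R, contr y u = 0 → ∃ (κ : KV n R) (r : R), u = contr y κ + r • eOne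

lemma in_contr_of_mem {y : Fin n → R} {I : Ideal R} (h : ∀ j, y j ∈ I) (u : KV n R) :
    In I (contr y u) := by
  intro T
  rw [contr_apply, Finset.sum_apply]
  exact I.sum_mem fun j _ => I.mul_mem_right _ (h j)

lemma acyclic_of_regSeq {y : ℕ → R} (h : RegSeq y n) : Acyclic (fun j : Fin n => y j) := by
  let D : ℕ → KV n R →ₗ[R] KV n R := fun i => contr (fun j : Fin n => if j.1 < i then y j else 0)
  have hD1 : ∀ (i : Fin n) (u : KV n R), D (i + 1) u = D i u + y i • anni R i u := by
    intro i u
    simp only [D, contr_apply]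
    rw [← Finset.sum_erase_add _ _ (Finset.mem_univ i),
      ← Finset.sum_erase_add _ (fun j : Fin n => (if j.1 < i.1 then y j else 0) • anni R j u)
        (Finset.mem_univ i)]
    simp only [lt_add_iff_pos_right, zero_lt_one, if_true, lt_irrefl, if_false, zero_smul, add_zero]
    congr 1
    refine Finset.sum_congr rfl fun j hj => ?_
    have : j.1 ≠ i.1 := fun h => (Finset.mem_erase.mp hj).1 (Fin.ext h)
    have : j.1 < i.1 + 1 ↔ j.1 < i.1 := by omega
    simp only [this]
  have hcoef : ∀ (i : ℕ), i ≤ n → ∀ r ∈ Id y i, ∃ ρ : KV n R, (∀ j : Fin n, i ≤ j.1 → anni R j ρ = 0)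
      ∧ D i ρ = r • eOne := by
    intro i hi r hr
    obtain ⟨c, hc⟩ := exists_coeff hr
    refine ⟨wedge (fun j : Fin n => if j.1 < i then c j else 0) eOne, ?_, ?_⟩
    · intro j hj
      rw [wedge_apply, map_sum]
      refine Finset.sum_eq_zero fun k _ => ?_
      rw [map_smul, anni_crea]
      by_cases hk : k.1 < i
      · have hjk : j ≠ k := by rintro rfl; omega
        have : anni R j (eOne : KV n R) = 0 := by
          ext T; simp [anni_apply, eOne, Pi.single_apply, Finset.insert_ne_empty]
        simp [hjk, this]
      · simp [hk]
    · simp only [D]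
      rw [contr_wedge, contr_eOne, map_zero, sub_zero, hc]
      congr 1
      rw [Fin.sum_univ_eq_sum_range
        (fun j => (if j < i then c j else 0) * (if j < i then y j else 0)) n]
      rw [← Finset.sum_subset (Finset.range_subset_range.mpr hi)]
      · exact Finset.sum_congr rfl fun j hj => by simp [Finset.mem_range.mp hj]
      · intro j _ hj
        simp [Finset.mem_range.not.mp hj]
  have hemp : ∀ (i : ℕ) (u : KV n R), i ≤ n → D i u ∅ ∈ Id y i := fun i u hi =>
    in_contr_of_mem (fun j => by split_ifs with hj; exacts [mem_Id hj, zero_mem _]) u ∅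
  have key : ∀ (i : ℕ), i ≤ n → ∀ u : KV n R, (∀ j : Fin n, i ≤ j.1 → anni R j u = 0) → D i u = 0 →
      ∃ (κ : KV n R) (r : R), (∀ j : Fin n, i ≤ j.1 → anni R j κ = 0) ∧ u = D i κ + r • eOne := by
    intro i
    induction i with
    | zero =>
      intro _ u hu _
      refine ⟨0, u ∅, by simp, ?_⟩
      ext T
      by_cases hT : T = ∅
      · subst hT; simp [eOne]
      · obtain ⟨j, hj⟩ := Finset.nonempty_of_ne_empty hT
        have h1 := congrFun (hu j (Nat.zero_le _)) (T.erase j)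
        simp only [anni_apply, Finset.notMem_erase, if_false, Finset.insert_erase hj,
          Pi.zero_apply] at h1
        have h2 := congrArg (fun t => sgn (T.erase j) j • t) h1
        simp only [smul_smul, sgn_mul_self, one_smul, smul_zero] at h2
        simp [h2, eOne, Pi.single_apply, hT]
    | succ i ih =>
      intro hi u hu hDu
      have hi' : i < n := hi
      set k : Fin n := ⟨i, hi'⟩ with hk
      set p := anni R k u with hp
      set q := anni R k (crea R k u) with hq
      have huqp : u = q + crea R k p := by
        rw [hq, anni_crea, if_pos rfl]; abel
      have hpa : ∀ j : Fin n, i ≤ j.1 → anni R j p = 0 := by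
        intro j hj
        rcases hj.eq_or_lt with h | h
        · have : j = k := Fin.ext h.symm
          rw [this, hp, anni_self]
        · rw [hp, anni_anni, hu j h, map_zero, neg_zero]
      have hqa : ∀ j : Fin n, i ≤ j.1 → anni R j q = 0 := by
        intro j hj
        rcases hj.eq_or_lt with h | h
        · have : j = k := Fin.ext h.symm
          rw [this, hq, anni_self]
        · have hjk : j ≠ k := by rintro rfl; exact absurd h (lt_irrefl _)
          rw [hq, anni_anni, anni_crea, hu j h, if_neg hjk, map_zero, sub_zero, map_zero, neg_zero]
      have hDk : ∀ v : KV n R, D i (crea R k v) = - crea R k (D i v) := by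
        intro v
        simp only [D]
        rw [contr_crea]
        simp [hk]
      have hak : ∀ v : KV n R, anni R k v = 0 → anni R k (crea R k v) = v := by
        intro v hv
        rw [anni_crea, hv, if_pos rfl, map_zero, sub_zero]
      have hkk : anni R k p = 0 := hpa k le_rfl
      have hqk : anni R k q = 0 := hqa k le_rfl
      have e1 : D i q - crea R k (D i p) + y i • p = 0 := by
        have := hD1 k u
        rw [hDu] at this
        rw [huqp, map_add, hDk, map_add, hqk, hak p hkk, zero_add] at this
        rw [this]; simp [hk]; abel
      have e2 : D i p = 0 := by
        have h1 := congrArg (anni R k) e1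
        have h2 : anni R k (D i p) = 0 := by
          simp only [D]; rw [anni_contr, hkk, map_zero, neg_zero]
        have h3 : anni R k (D i q) = 0 := by
          simp only [D]; rw [anni_contr, hqk, map_zero, neg_zero]
        rw [map_add, map_sub, h3, hak _ h2, map_smul, hkk, map_zero, smul_zero, add_zero,
          zero_sub, neg_eq_zero] at h1
        exact h1
      rw [e2, map_zero, sub_zero] at e1
      obtain ⟨κ1, r1, hκ1, hr1⟩ := ih hi'.le p hpa e2
      have hr1m : r1 ∈ Id y i := by
        apply h i hi'
        have h1 := congrFun e1 ∅
        rw [hr1] at h1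
        simp only [Pi.add_apply, Pi.smul_apply, smul_eq_mul, Pi.zero_apply, eOne, Pi.single_eq_same,
          mul_one, mul_add] at h1
        have h2 := hemp i q hi'.le
        have h3 := (Id y i).mul_mem_left (y i) (hemp i κ1 hi'.le)
        rw [← add_assoc] at h1
        rw [eq_neg_of_add_eq_zero_right h1]
        exact (Id y i).neg_mem ((Id y i).add_mem h2 h3)
      obtain ⟨ρ, hρ, hρ2⟩ := hcoef i hi'.le r1 hr1m
      rw [← hρ2, ← map_add] at hr1
      have hκ1' : ∀ j : Fin n, i ≤ j.1 → anni R j (κ1 + ρ) = 0 := fun j hj => by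
        rw [map_add, hκ1 j hj, hρ j hj, add_zero]
      obtain ⟨κ0, r, hκ0, hr⟩ := ih hi'.le (q + y i • (κ1 + ρ))
        (fun j hj => by rw [map_add, map_smul, hqa j hj, hκ1' j hj, smul_zero, add_zero])
        (by rw [map_add, map_smul, ← hr1, e1])
      refine ⟨κ0 - crea R k (κ1 + ρ), r, ?_, ?_⟩
      · intro j hj
        have hjk : j ≠ k := by rintro rfl; exact absurd hj (Nat.not_succ_le_self _)
        rw [map_sub, hκ0 j (by omega), anni_crea, if_neg hjk, hκ1' j (by omega), map_zero, sub_zero,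
          sub_zero]
      · have h1 : D (i + 1) κ0 = D i κ0 := by
          have := hD1 k κ0
          rw [hκ0 k le_rfl, smul_zero, add_zero] at this
          exact this
        have h2 : D (i + 1) (crea R k (κ1 + ρ)) = - crea R k p + y i • (κ1 + ρ) := by
          have := hD1 k (crea R k (κ1 + ρ))
          rw [hDk, ← hr1, hak _ (hκ1' k le_rfl)] at this
          exact this
        rw [map_sub, h1, h2, huqp]
        rw [← sub_eq_zero] at hr ⊢
        rw [← hr]; abel
  intro u hu
  have e : (fun j : Fin n => if j.1 < n then y j else 0) = fun j : Fin n => y j := by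
    ext j; simp [j.2]
  have hDn : ∀ v, D n v = contr (fun j : Fin n => y j) v := fun v => by simp only [D, e]
  obtain ⟨κ, r, _, h2⟩ := key n le_rfl u (fun j hj => absurd j.2 (not_lt.mpr hj)) (by rw [hDn, hu])
  exact ⟨κ, r, by rw [← hDn]; exact h2⟩

end Acyclic

section SocleLemma

variable {R : Type*} [CommRing R] {n : ℕ}

/-- `u` is supported in degrees at least `m`. -/
def SuppGE (m : ℕ) (u : KV n R) : Prop := ∀ T : Finset (Fin n), T.card < m → u T = 0

lemma SuppGE.contr {m : ℕ} {u : KV n R} (hu : SuppGE m u) (y : Fin n → R) :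
    ∀ T : Finset (Fin n), T.card + 1 < m → contr y u T = 0 := by
  intro T hT
  rw [contr_apply, Finset.sum_apply]
  refine Finset.sum_eq_zero fun j _ => ?_
  rw [Pi.smul_apply, anni_apply]
  split_ifs with h
  · simp
  · rw [hu _ (by rw [Finset.card_insert_of_notMem h]; exact hT)]; simp

lemma SuppGE.wedge {m : ℕ} {u : KV n R} (hu : SuppGE m u) (v : Fin n → R) :
    SuppGE (m + 1) (wedge v u) := by
  intro T hT
  rw [wedge_apply, Finset.sum_apply]
  refine Finset.sum_eq_zero fun j _ => ?_
  rw [Pi.smul_apply, crea_apply]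
  split_ifs with h
  · rw [hu _ (by have := Finset.card_erase_add_one h; omega)]; simp
  · simp

lemma wp_supp (a : ℕ → Fin n → R) (k : ℕ) (T : Finset (Fin n)) (hT : T.card ≠ k) :
    wp a k T = 0 := by
  induction k generalizing T with
  | zero => simp [wp, eOne, Pi.single_apply, Finset.card_ne_zero.mp hT |>.ne_empty]
  | succ k ih =>
    rw [wp, wedge_apply, Finset.sum_apply]
    refine Finset.sum_eq_zero fun j _ => ?_
    rw [Pi.smul_apply, crea_apply]
    split_ifs with h
    · rw [ih _ (by have := Finset.card_erase_add_one h; omega)]; simp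
    · simp

lemma wp_eq_zero (a : ℕ → Fin n → R) {k : ℕ} (hk : n < k) : wp a k = 0 := by
  ext T
  exact wp_supp a k T (by have := card_finset_fin_le T; omega)

/-- The vectors `a i` express `w i` in terms of `y`, for `i < k`. -/
def Expr (y : Fin n → R) (w : ℕ → R) (a : ℕ → Fin n → R) (k : ℕ) : Prop :=
  ∀ i < k, w i = ∑ j, a i j * y j

lemma contr_wp {y : Fin n → R} {w : ℕ → R} {a : ℕ → Fin n → R} {k : ℕ} (h : Expr y w a k) :
    In (Id w k) (contr y (wp a k)) := by
  induction k with
  | zero => rw [wp, contr_eOne]; exact fun T => Submodule.zero_mem _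
  | succ k ih =>
    rw [wp, contr_wedge, ← h k (Nat.lt_succ_self k)]
    exact (In.smul_of_mem (mem_Id (Nat.lt_succ_self k)) _).sub
      (((ih fun i hi => h i (by omega)).mono (Id_mono w (Nat.le_succ k))).wedge _)

lemma trunc {y : Fin n → R} {I : Ideal R} {a : ℕ → Fin n → R} {i m : ℕ} (him : i ≤ m)
    {u κ : KV n R} {r : R} (hu : SuppGE m u) (h : In I (u - contr y κ - r • wp a i)) :
    ∃ κ' : KV n R, SuppGE (m + 1) κ' ∧
      In I (u - contr y κ' - (if i < m then 0 else r) • wp a i) := by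
  classical
  refine ⟨fun T => if T.card < m + 1 then 0 else κ T, fun T hT => by simp [hT], fun T => ?_⟩
  by_cases hT : T.card < m
  · have h1 := SuppGE.contr (m := m + 1) (u := fun T => if T.card < m + 1 then 0 else κ T)
      (fun T hT => by simp [hT]) y T (by omega)
    simp only [Pi.sub_apply, h1, hu T hT, Pi.smul_apply]
    split_ifs with h2
    · simp
    · rw [wp_supp a i T (by omega)]; simp
  · have h1 : contr y (fun T => if T.card < m + 1 then 0 else κ T) T = contr y κ T := by
      rw [contr_apply, contr_apply, Finset.sum_apply, Finset.sum_apply]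
      refine Finset.sum_congr rfl fun j _ => ?_
      rw [Pi.smul_apply, Pi.smul_apply, anni_apply, anni_apply]
      split_ifs with h2 h3
      · rfl
      · exact absurd h3 (by rw [Finset.card_insert_of_notMem h2]; omega)
      · rfl
    have h2 := h T
    simp only [Pi.sub_apply, Pi.smul_apply, h1] at h2 ⊢
    split_ifs with h3
    · rw [wp_supp a i T (by omega)] at h2 ⊢
      simpa using h2
    · exact h2

lemma acyclic_mod {y : Fin n → R} (hy : Acyclic y) {w : ℕ → R} {a : ℕ → Fin n → R} {i : ℕ}
    (hw : RegSeq w i) (ha : Expr y w a i) {m : ℕ} (him : i ≤ m) {u : KV n R} (hu : SuppGE m u)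
    (hDu : In (Id w i) (contr y u)) :
    ∃ (κ : KV n R) (r : R), SuppGE (m + 1) κ ∧ (i < m → r = 0) ∧
      In (Id w i) (u - contr y κ - r • wp a i) := by
  induction i generalizing m u with
  | zero =>
    have h0 : contr y u = 0 := by
      ext T
      have := hDu T
      rwa [Id_zero, Submodule.mem_bot] at this
    obtain ⟨κ, r, h⟩ := hy u h0
    obtain ⟨κ', h1, h2⟩ := trunc (I := Id w 0) (y := y) (a := a) (κ := κ) (r := r) him hu (by
      rw [wp, h]; intro T; simp)
    exact ⟨κ', _, h1, fun hm => by simp [hm], h2⟩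
  | succ i ih =>
    have hw' : RegSeq w i := fun j hj => hw j (by omega)
    have ha' : Expr y w a i := fun j hj => ha j (by omega)
    obtain ⟨m, rfl⟩ : ∃ m', m = m' + 1 := ⟨m - 1, by omega⟩
    have h1 : ∀ T : Finset (Fin n), ∃ t, contr y u T - w i * t ∈ Id w i ∧ (T.card < m → t = 0) := by
      intro T
      by_cases hT : T.card < m
      · refine ⟨0, ?_, fun _ => rfl⟩
        rw [hu.contr y T (by omega)]; simp
      · obtain ⟨t, ht⟩ := mem_Id_succ.mp (hDu T)
        exact ⟨t, ht, fun h => absurd h hT⟩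
    choose t ht ht0 using h1
    have hin : In (Id w i) (contr y u - w i • t) := ht
    have hDt : In (Id w i) (contr y t) := by
      intro T
      apply hw i (Nat.lt_succ_self i)
      have h2 := (hin.contr y).smul (-1 : R) T
      rw [map_sub, contr_contr, map_smul] at h2
      simpa using h2
    obtain ⟨κ1, r1, hκ1, hr1, hI⟩ := ih hw' ha' (by omega : i ≤ m) (u := t) ht0 hDt
    set u' := u - w i • κ1 - r1 • wedge (a i) (wp a i) with hu'
    have hu'supp : SuppGE (m + 1) u' := by
      intro T hT
      have e1 := hu T hT
      have e2 := hκ1 T hT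
      simp only [hu', Pi.sub_apply, Pi.smul_apply, e1, e2]
      by_cases him' : i < m
      · simp [hr1 him']
      · have : wedge (a i) (wp a i) T = 0 := wp_supp a (i + 1) T (by omega)
        simp [this]
    have hDu' : In (Id w i) (contr y u') := by
      have e : contr y u' = (contr y u - w i • t) + w i • (t - contr y κ1 - r1 • wp a i) +
          r1 • wedge (a i) (contr y (wp a i)) := by
        rw [hu', map_sub, map_sub, map_smul, map_smul, contr_wedge, ← ha i (Nat.lt_succ_self i)]
        simp only [smul_sub, smul_smul, mul_comm r1]
        abel
      rw [e]
      exact (hin.add (hI.smul _)).add (((contr_wp ha').wedge _).smul _)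
    obtain ⟨κ2, r2, hκ2, hr2, hI2⟩ := ih hw' ha' (by omega : i ≤ m + 1) hu'supp hDu'
    refine ⟨κ2, r1, hκ2, fun h => hr1 (by omega), ?_⟩
    have e : u - contr y κ2 - r1 • wp a (i + 1) = (u' - contr y κ2 - r2 • wp a i) + w i • κ1 := by
      rw [hr2 (by omega), hu', wp, zero_smul]; abel
    rw [e]
    exact (hI2.mono (Id_mono w (Nat.le_succ i))).add (In.smul_of_mem (mem_Id (Nat.lt_succ_self i)) _)

lemma contr_top {y : Fin n → R} {I : Ideal R} {u : R} (h : ∀ j, y j * u ∈ I) :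
    In I (contr y (Pi.single Finset.univ u)) := by
  intro T
  rw [contr_apply, Finset.sum_apply]
  refine I.sum_mem fun j _ => ?_
  rw [Pi.smul_apply, anni_apply, smul_eq_mul]
  split_ifs with h1
  · simp
  · rw [zsmul_eq_mul, Pi.single_apply]
    split_ifs
    · rw [mul_left_comm]; exact I.mul_mem_left _ (h j)
    · simp

lemma single_top_supp (u : R) : SuppGE n (Pi.single Finset.univ u : KV n R) := by
  intro T hT
  rw [Pi.single_apply, if_neg]
  rintro rfl
  simp at hT

lemma mem_of_forall_mul_mem {y : Fin n → R} (hy : Acyclic y) {w : ℕ → R} {a : ℕ → Fin n → R}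
    {i : ℕ} (hw : RegSeq w i) (ha : Expr y w a i) (hi : i < n) {u : R}
    (h : ∀ j, y j * u ∈ Id w i) : u ∈ Id w i := by
  obtain ⟨κ, r, hκ, hr, hI⟩ := acyclic_mod hy hw ha hi.le (single_top_supp u) (contr_top h)
  have hκ0 : κ = 0 := by
    ext T; exact hκ T (by have := card_finset_fin_le T; omega)
  have := hI Finset.univ
  simpa [hκ0, hr hi] using this

lemma socle_of_forall_mul_mem {y : Fin n → R} (hy : Acyclic y) {w : ℕ → R} {a : ℕ → Fin n → R}
    (hw : RegSeq w n) (ha : Expr y w a n) {u : R}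
    (h : ∀ j, y j * u ∈ Id w n) : ∃ r, u - r * wp a n Finset.univ ∈ Id w n := by
  obtain ⟨κ, r, hκ, hr, hI⟩ := acyclic_mod hy hw ha le_rfl (single_top_supp u) (contr_top h)
  have hκ0 : κ = 0 := by
    ext T; exact hκ T (by have := card_finset_fin_le T; omega)
  have := hI Finset.univ
  exact ⟨r, by simpa [hκ0] using this⟩

/-- The top exterior product is killed by `y` modulo `w`. -/
lemma mul_wp_mem {y : Fin n → R} {w : ℕ → R} {a : ℕ → Fin n → R} (ha : Expr y w a n) (j : Fin n) :
    In (Id w n) (y j • wp a n) := by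
  have h1 : crea R j (wp a n) = 0 := by
    have h : crea R j (wp a n) = wedge (Pi.single j (1 : R)) (wp a n) := by
      rw [wedge_apply, Finset.sum_eq_single j] <;> simp +contextual [Pi.single_apply]
    have := wp_eq_zero (Function.update a n (Pi.single j (1 : R))) (Nat.lt_succ_self n)
    have h2 : ∀ k ≤ n, wp (Function.update a n (Pi.single j (1 : R))) k = wp a k := by
      intro k hk
      induction k with
      | zero => rfl
      | succ k ih => rw [wp, wp, ih (by omega), Function.update_of_ne (by omega)]
    rw [wp, h2 n le_rfl, Function.update_self] at this
    rw [h, this]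
  have h2 := contr_crea y j (wp a n)
  rw [h1, map_zero, eq_comm, sub_eq_zero] at h2
  have h : ∀ u : KV n R, crea R j u = wedge (Pi.single j (1 : R)) u := by
    intro u
    rw [wedge_apply, Finset.sum_eq_single j] <;> simp +contextual [Pi.single_apply]
  rw [h2, h]
  exact (contr_wp ha).wedge _

end SocleLemma

section Assoc

variable {R : Type*} [CommRing R]

/-- Prime avoidance for a coset `x + 𝔞` of an ideal. -/
theorem exists_add_not_mem (S : Finset (Ideal R)) (hS : ∀ P ∈ S, P.IsPrime) (x : R) (𝔞 : Ideal R)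
    (h : ∀ P ∈ S, x ∈ P → ¬ 𝔞 ≤ P) : ∃ u ∈ 𝔞, ∀ P ∈ S, x + u ∉ P := by
  classical
  obtain ⟨M, hM⟩ : ∃ M : Finset (Ideal R), ∀ P, P ∈ M ↔ P ∈ S ∧ ∀ Q ∈ S, P ≤ Q → Q = P :=
    ⟨S.filter (fun P => ∀ Q ∈ S, P ≤ Q → Q = P), fun P => Finset.mem_filter⟩
  obtain ⟨M₁, hM₁⟩ : ∃ M₁ : Finset (Ideal R), ∀ P, P ∈ M₁ ↔ P ∈ M ∧ x ∈ P :=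
    ⟨M.filter (fun P => x ∈ P), fun P => Finset.mem_filter⟩
  obtain ⟨M₂, hM₂⟩ : ∃ M₂ : Finset (Ideal R), ∀ P, P ∈ M₂ ↔ P ∈ M ∧ x ∉ P :=
    ⟨M.filter (fun P => x ∉ P), fun P => Finset.mem_filter⟩
  have hmax : ∀ P ∈ S, ∃ Q ∈ M, P ≤ Q := by
    intro P hP
    obtain ⟨Q, hQ, hmax⟩ := S.exists_le_maximal hP
    exact ⟨Q, (hM Q).2 ⟨hmax.1, fun Q' hQ' h => le_antisymm (hmax.2 hQ' h) h⟩, hQ⟩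
  obtain ⟨𝔟, h𝔟⟩ : ∃ 𝔟 : Ideal R, 𝔟 = 𝔞 * ∏ P ∈ M₂, P := ⟨_, rfl⟩
  have key : ∀ P ∈ M₁, ¬ 𝔟 ≤ P := by
    intro P hP hle
    obtain ⟨hPM, hxP⟩ := (hM₁ P).1 hP
    obtain ⟨hPS, hPm⟩ := (hM P).1 hPM
    have hPp := hS P hPS
    rw [h𝔟] at hle
    rcases (Ideal.IsPrime.mul_le hPp).1 hle with h1 | h1
    · exact h P hPS hxP h1
    · obtain ⟨Q, hQ, hQP⟩ := (Ideal.IsPrime.prod_le hPp).1 h1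
      obtain ⟨hQM, hxQ⟩ := (hM₂ Q).1 hQ
      have := ((hM Q).1 hQM).2 P hPS hQP
      exact hxQ (this ▸ hxP)
  have : ¬ ((𝔟 : Set R) ⊆ ⋃ P ∈ (↑M₁ : Set (Ideal R)), (P : Set R)) := by
    intro hsub
    obtain ⟨P, hP, hle⟩ := (Ideal.subset_union_prime (f := fun P : Ideal R => P) ⊥ ⊥
      (fun P hP _ _ => hS P ((hM P).1 ((hM₁ P).1 hP).1).1)).1 hsub
    exact key P hP hle
  obtain ⟨u, hu, hu'⟩ := Set.not_subset.1 this
  rw [h𝔟] at hu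
  refine ⟨u, Ideal.mul_le_left hu, fun P hP hx => ?_⟩
  obtain ⟨Q, hQ, hPQ⟩ := hmax P hP
  have hxu := hPQ hx
  by_cases hxQ : x ∈ Q
  · apply hu'
    simp only [Set.mem_iUnion]
    exact ⟨Q, (hM₁ Q).2 ⟨hQ, hxQ⟩, (Q.add_mem_iff_right hxQ).1 hxu⟩
  · have huQ : u ∈ Q := by
      have h1 : 𝔞 * ∏ P ∈ M₂, P ≤ Q := by
        refine Ideal.mul_le_right.trans ?_
        exact Ideal.prod_le_inf.trans (Finset.inf_le ((hM₂ Q).2 ⟨hQ, hxQ⟩))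
      exact h1 hu
    exact hxQ ((Q.add_mem_iff_left huQ).1 hxu)

theorem exists_mem_not_mem (S : Set (Ideal R)) (hf : S.Finite) (hS : ∀ P ∈ S, P.IsPrime)
    (𝔞 : Ideal R) (h : ∀ P ∈ S, ¬ 𝔞 ≤ P) : ∃ u ∈ 𝔞, ∀ P ∈ S, u ∉ P := by
  obtain ⟨u, hu, h⟩ := exists_add_not_mem hf.toFinset (by simpa using hS) 0 𝔞
    (by simpa using h)
  exact ⟨u, hu, by simpa using h⟩

/-- `P` is an associated prime of the ideal `I`, i.e. of the module `R ⧸ I`. -/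
def AssI (I P : Ideal R) : Prop := P.IsPrime ∧ ∃ u, ∀ r, r ∈ P ↔ r * u ∈ I

lemma AssI.le {I P : Ideal R} (h : AssI I P) : I ≤ P := by
  obtain ⟨_, u, hu⟩ := h
  exact fun r hr => (hu r).2 (I.mul_mem_right _ hr)

lemma AssI.mem_of_mul_mem {I P : Ideal R} (h : AssI I P) {w : R} (hw : w ∈ P) :
    ∃ r, w * r ∈ I ∧ r ∉ I := by
  obtain ⟨hp, u, hu⟩ := h
  refine ⟨u, (hu w).1 hw, fun h => hp.ne_top ((Ideal.eq_top_iff_one _).2 ((hu 1).2 (by simpa using h)))⟩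

lemma assI_iff [IsNoetherianRing R] {I P : Ideal R} : AssI I P ↔ P ∈ associatedPrimes R (R ⧸ I) := by
  rw [AssociatedPrimes.mem_iff, isAssociatedPrime_iff, AssI]
  refine and_congr_right fun _ => ?_
  constructor
  · rintro ⟨u, hu⟩
    refine ⟨Ideal.Quotient.mk I u, ?_⟩
    ext r
    rw [hu, Submodule.mem_colon_singleton, Submodule.mem_bot, ← Ideal.Quotient.eq_zero_iff_mem,
      map_mul]; rfl
  · rintro ⟨x, rfl⟩
    obtain ⟨u, rfl⟩ := Ideal.Quotient.mk_surjective x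
    refine ⟨u, fun r => ?_⟩
    rw [Submodule.mem_colon_singleton, Submodule.mem_bot, ← Ideal.Quotient.eq_zero_iff_mem,
      map_mul]; rfl

lemma assI_finite [IsNoetherianRing R] (I : Ideal R) : {P | AssI I P}.Finite := by
  simp only [assI_iff]
  exact associatedPrimes.finite R (R ⧸ I)

/-- A non-member `u` of `I` has a multiple `t * u` whose annihilator modulo `I` is prime. -/
lemma exists_assI_mul [IsNoetherianRing R] {I : Ideal R} {u : R} (hu : u ∉ I) :
    ∃ (P : Ideal R) (t : R), P.IsPrime ∧ (∀ r, r ∈ P ↔ r * (t * u) ∈ I) ∧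
      ∀ r, r * u ∈ I → r ∈ P := by
  let x : Submodule.span R {Ideal.Quotient.mk I u} :=
    ⟨Ideal.Quotient.mk I u, Submodule.mem_span_singleton_self _⟩
  have hx : x ≠ 0 := by
    intro h
    exact hu (Ideal.Quotient.eq_zero_iff_mem.1 (congrArg Subtype.val h))
  obtain ⟨P, hP, hle⟩ := exists_le_isAssociatedPrime_of_isNoetherianRing R x hx
  rw [isAssociatedPrime_iff] at hP
  obtain ⟨hp, ⟨z, hz⟩, rfl⟩ := hP
  obtain ⟨t, rfl⟩ := Submodule.mem_span_singleton.1 hz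
  refine ⟨_, t, hp, fun r => ?_, fun r hr => hle ?_⟩
  · rw [Submodule.mem_colon_singleton, Submodule.mem_bot, ← Ideal.Quotient.eq_zero_iff_mem,
      map_mul, map_mul, Subtype.ext_iff]; rfl
  · rw [Submodule.mem_colon_singleton, Submodule.mem_bot, Subtype.ext_iff]
    rw [← Ideal.Quotient.eq_zero_iff_mem, map_mul] at hr
    exact hr

lemma exists_assI [IsNoetherianRing R] {I : Ideal R} {u : R} (hu : u ∉ I) :
    ∃ P, AssI I P ∧ ∀ r, r * u ∈ I → r ∈ P := by
  obtain ⟨P, t, h1, h2, h3⟩ := exists_assI_mul hu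
  exact ⟨P, ⟨h1, _, h2⟩, h3⟩

/-- Elements outside all associated primes are nonzerodivisors. -/
lemma mem_of_mul_mem_of_forall_assI [IsNoetherianRing R] {I : Ideal R} {w : R}
    (hw : ∀ P, AssI I P → w ∉ P) {r : R} (h : w * r ∈ I) : r ∈ I := by
  by_contra hr
  obtain ⟨P, hP, h'⟩ := exists_assI hr
  exact hw P hP (h' w h)

lemma AssI.of_minimalPrimes [IsNoetherianRing R] {I P : Ideal R} {v : R}
    (hP : P ∈ (I.colon {v}).minimalPrimes) : AssI I P := by
  have h1 : P ∈ associatedPrimes R (R ⧸ I.colon {v}) := by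
    apply Module.associatedPrimes.minimalPrimes_annihilator_subset_associatedPrimes
    rwa [Ideal.annihilator_quotient]
  rw [← assI_iff] at h1
  obtain ⟨hp, u, hu⟩ := h1
  refine ⟨hp, u * v, fun r => ?_⟩
  rw [hu, Submodule.mem_colon_singleton, smul_eq_mul, mul_assoc]

lemma AssI.of_mem_minimalPrimes [IsNoetherianRing R] {I P : Ideal R}
    (hP : P ∈ I.minimalPrimes) : AssI I P := by
  apply AssI.of_minimalPrimes (v := 1)
  convert hP using 2
  ext; simp [Submodule.mem_colon_singleton]

/-- Any prime containing the annihilator of `v` modulo `I` contains an associated prime of `I`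
containing that annihilator. -/
lemma exists_assI_le [IsNoetherianRing R] {I P : Ideal R} [P.IsPrime] {v : R}
    (h : ∀ r, r * v ∈ I → r ∈ P) : ∃ Q, AssI I Q ∧ Q ≤ P ∧ ∀ r, r * v ∈ I → r ∈ Q := by
  obtain ⟨Q, hQ, hQP⟩ := Ideal.exists_minimalPrimes_le (I := I.colon {v}) (J := P)
    (fun r hr => h r (by simpa [Submodule.mem_colon_singleton] using hr))
  exact ⟨Q, .of_minimalPrimes hQ, hQP, fun r hr => hQ.1.2 (by simpa [Submodule.mem_colon_singleton] using hr)⟩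

theorem chain_step [IsNoetherianRing R] {I P₀ P : Ideal R} [P.IsPrime] (h₀ : AssI I P₀)
    (hle : P₀ ≤ P) {w : R} (hwP : w ∈ P) (hw : ∀ r, w * r ∈ I → r ∈ I) :
    ∃ P₁, AssI (I ⊔ Ideal.span {w}) P₁ ∧ P₀ < P₁ ∧ P₁ ≤ P := by
  obtain ⟨hp₀, u, hu⟩ := h₀
  let N : Ideal R := I.colon (P₀ : Set R)
  have hN : ∀ v, v ∈ N ↔ ∀ r ∈ P₀, v * r ∈ I := fun v => Submodule.mem_colon
  have huN : u ∈ N := (hN u).2 fun r hr => by rw [mul_comm]; exact (hu r).1 hr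
  suffices h : ∃ v ∈ N, ∀ r, r * v ∈ I ⊔ Ideal.span {w} → r ∈ P by
    obtain ⟨v, hv, h⟩ := h
    obtain ⟨Q, hQ, hQP, hQ'⟩ := exists_assI_le h
    have hsub : P₀ ≤ Q := fun r hr => hQ' r
      (Ideal.mem_sup_left (by rw [mul_comm]; exact (hN v).1 hv r hr))
    refine ⟨Q, hQ, lt_of_le_of_ne hsub ?_, hQP⟩
    rintro rfl
    have hwQ : w ∈ P₀ := hQ.le (Ideal.mem_sup_right (Ideal.mem_span_singleton_self w))
    have : u ∈ I := hw u ((hu w).1 hwQ)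
    exact hp₀.ne_top ((Ideal.eq_top_iff_one _).2 ((hu 1).2 (by simpa using this)))
  by_contra! hcon
  have hcon' : ∀ v ∈ N, ∃ s, s ∉ P ∧ s * v ∈ I ⊔ Ideal.span {w} := fun v hv => by
    obtain ⟨r, hr, h⟩ := hcon v hv; exact ⟨r, h, hr⟩
  obtain ⟨G, hG⟩ := (isNoetherian_def.1 ‹IsNoetherianRing R›) N
  choose s hs hs' using fun v : G => hcon' v (hG ▸ Ideal.subset_span v.2)
  let σ := ∏ v, s v
  have hσ : σ ∉ P := by
    intro h
    obtain ⟨v, _, hv⟩ := (Ideal.IsPrime.prod_mem_iff).1 h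
    exact hs v hv
  have hσN : ∀ v ∈ N, σ * v ∈ I ⊔ Ideal.span {w} := by
    intro v hv
    rw [← hG] at hv
    induction hv using Submodule.span_induction with
    | mem x hx =>
      obtain ⟨c, hc⟩ := Finset.dvd_prod_of_mem s (Finset.mem_univ ⟨x, hx⟩)
      have : σ * x = c * (s ⟨x, hx⟩ * x) := by rw [show σ = s ⟨x, hx⟩ * c from hc]; ring
      rw [this]
      exact Ideal.mul_mem_left _ _ (hs' ⟨x, hx⟩)
    | zero => simp
    | add x y _ _ h1 h2 => rw [mul_add]; exact add_mem h1 h2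
    | smul a x _ h => rw [smul_eq_mul, mul_left_comm]; exact Ideal.mul_mem_left _ _ h
  have hIN : I ≤ N := fun v hv => (hN v).2 fun r _ => I.mul_mem_right _ hv
  have hσN' : ∀ v ∈ N, ∃ t ∈ N, σ * v - w * t ∈ I := by
    intro v hv
    obtain ⟨i, hi, z, hz, hiz⟩ := Submodule.mem_sup.1 (hσN v hv)
    obtain ⟨t, rfl⟩ := Ideal.mem_span_singleton'.1 hz
    refine ⟨t, (hN t).2 fun r hr => hw _ ?_, by rw [← hiz]; convert hi using 1; ring⟩
    have : w * (t * r) = σ * (v * r) - i * r := by rw [← mul_assoc σ, ← hiz]; ring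
    rw [this]
    exact sub_mem (I.mul_mem_left _ ((hN v).1 hv r hr)) (I.mul_mem_right _ hi)
  let N' : Submodule R (R ⧸ I) := Submodule.map (Submodule.mkQ I) N
  have hN' : ∀ v, Submodule.Quotient.mk v ∈ N' ↔ v ∈ N := by
    intro v
    constructor
    · rintro ⟨v', hv', h⟩
      have : v' - v ∈ I := (Submodule.Quotient.eq I).1 h
      have := sub_mem hv' (hIN this)
      simpa using this
    · exact fun hv => ⟨v, hv, rfl⟩
  let f : Module.End R N' := σ • LinearMap.id
  obtain ⟨p, hpm, -, hpc, hpa⟩ :=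
    LinearMap.exists_monic_and_coeff_mem_pow_and_aeval_eq_zero_of_range_le_smul R f
      (Ideal.span {w}) (by
        rintro _ ⟨⟨z, hz⟩, rfl⟩
        obtain ⟨v, rfl⟩ := Submodule.Quotient.mk_surjective _ z
        obtain ⟨t, ht, hvt⟩ := hσN' v ((hN' v).1 hz)
        have : f ⟨Submodule.Quotient.mk v, hz⟩ = w • ⟨Submodule.Quotient.mk t, (hN' t).2 ht⟩ := by
          apply Subtype.ext
          exact (Submodule.Quotient.eq I).2 hvt
        rw [this]
        exact Submodule.smul_mem_smul (Ideal.mem_span_singleton_self w) trivial)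
  have hf : ∀ (q : Polynomial R) (z : N'), Polynomial.aeval f q z = q.eval σ • z := by
    intro q z
    induction q using Polynomial.induction_on' with
    | add a b ha hb => simp [ha, hb, add_smul]
    | monomial k a =>
      have : ∀ k : ℕ, (f ^ k) z = σ ^ k • z := by
        intro k
        induction k with
        | zero => simp
        | succ k ih => rw [pow_succ', Module.End.mul_apply, ih]; simp [f, pow_succ, mul_smul]
      simp [Polynomial.aeval_monomial, this, mul_smul, smul_comm a]
  have h0 : p.eval σ • (⟨Submodule.Quotient.mk u, (hN' u).2 huN⟩ : N') = 0 := by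
    rw [← hf, hpa]; rfl
  have h1 : p.eval σ * u ∈ I := by
    have := congrArg Subtype.val h0
    exact (Submodule.Quotient.mk_eq_zero I).1 this
  have h2 : p.eval σ ∈ P := hle ((hu _).2 h1)
  apply hσ
  have : p.eval σ - σ ^ p.natDegree ∈ P := by
    rw [Polynomial.eval_eq_sum_range, Finset.sum_range_succ, hpm.coeff_natDegree, one_mul,
      add_sub_cancel_right]
    refine Ideal.sum_mem _ fun i hi => P.mul_mem_right _ ?_
    have hi' := Finset.mem_range.1 hi
    have h3 : Ideal.span {w} ^ (p.natDegree - i) ≤ P :=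
      (Ideal.pow_le_self (by omega)).trans (by simpa [Ideal.span_singleton_le_iff_mem] using hwP)
    exact h3 (hpc i)
  have h3 : σ ^ p.natDegree ∈ P := by simpa using sub_mem h2 this
  exact Ideal.IsPrime.mem_of_pow_mem ‹_› _ h3

end Assoc

section RegularLocal

lemma maximalIdeal_quotient_span {R : Type*} [CommRing R] [IsLocalRing R] {I : Ideal R} [IsLocalRing (R ⧸ I)] {ι : Type*} (y : ι → R)
    (h : Ideal.span (Set.range y) ⊔ I = maximalIdeal R) :
    Ideal.span (Set.range fun j => Ideal.Quotient.mk I (y j)) = maximalIdeal (R ⧸ I) := by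
  have h1 : (maximalIdeal R).map (Ideal.Quotient.mk I) = maximalIdeal (R ⧸ I) := by
    have := IsLocalRing.map_maximalIdeal_of_surjective (Ideal.Quotient.mk I) Ideal.Quotient.mk_surjective
    exact this
  rw [← h1, ← h, Ideal.map_sup, Ideal.map_span, Ideal.map_quotient_self, sup_bot_eq, ← Set.range_comp]
  rfl

lemma add_le_of_natCast_add {a : WithBot ℕ∞} {n k : ℕ} (h : ((n + k : ℕ) : WithBot ℕ∞) ≤ a + k) :
    (n : WithBot ℕ∞) ≤ a := by
  induction a with
  | bot => simp at h
  | coe a =>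
    induction a with
    | top => exact le_top
    | coe a =>
      norm_cast at h ⊢
      have h2 : ((n + k : ℕ) : ℕ∞) ≤ ((a + k : ℕ) : ℕ∞) := by exact_mod_cast h
      have := (Nat.cast_le (α := ℕ∞)).1 h2
      omega

theorem isDomain_of_span_eq_maximalIdeal (n : ℕ) : ∀ (R : Type u) [CommRing R] [IsLocalRing R]
    [IsNoetherianRing R] (y : Fin n → R), Ideal.span (Set.range y) = maximalIdeal R →
    (n : WithBot ℕ∞) ≤ ringKrullDim R → IsDomain R := by
  induction n with
  | zero =>
    intro R _ _ _ y hy _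
    have : maximalIdeal R = ⊥ := by rw [← hy]; simp
    exact ((IsLocalRing.isField_iff_maximalIdeal_eq).2 this).isDomain
  | succ n ih =>
    intro R _ _ _ y hy hn
    have hspan : Ideal.span {y 0} ⊔ Ideal.span (Set.range fun j : Fin n => y j.succ) = maximalIdeal R := by
      rw [← hy, ← Ideal.span_union]
      congr 1
      ext z
      simp [Fin.exists_fin_succ, eq_comm]
    have hmin : ∀ P ∈ minimalPrimes R, P ≠ maximalIdeal R := by
      intro P hP h
      have hp : P.IsPrime := hP.1.1
      have h0 := Ideal.height_eq_zero_iff.2 hP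
      rw [h] at h0
      have h1 := IsLocalRing.maximalIdeal_height_eq_ringKrullDim (R := R)
      rw [h0] at h1
      rw [← h1] at hn
      have : ((n + 1 : ℕ) : WithBot ℕ∞) ≤ ((0 : ℕ) : WithBot ℕ∞) := by simpa using hn
      have := (Nat.cast_le (α := WithBot ℕ∞)).1 this
      omega
    have hfin : (minimalPrimes R).Finite := minimalPrimes.finite_of_isNoetherianRing R
    obtain ⟨u, hu, hx⟩ := exists_add_not_mem hfin.toFinset (fun P hP => ((hfin.mem_toFinset).1 hP).1.1)
      (y 0) (Ideal.span (Set.range fun j : Fin n => y j.succ)) (by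
        intro P hP h0 hle
        have hP' := (hfin.mem_toFinset).1 hP
        apply hmin P hP'
        have : maximalIdeal R ≤ P := by
          rw [← hspan, sup_le_iff]
          exact ⟨by simpa [Ideal.span_singleton_le_iff_mem] using h0, hle⟩
        exact ((maximalIdeal.isMaximal R).eq_of_le hP'.1.1.ne_top this).symm)
    set x := y 0 + u with hxdef
    have hspan' : Ideal.span (Set.range fun j : Fin n => y j.succ) ⊔ Ideal.span {x} = maximalIdeal R := by
      rw [← hspan]
      apply le_antisymm
      · refine sup_le le_sup_right ?_
        rw [Ideal.span_singleton_le_iff_mem, hxdef]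
        exact add_mem (Ideal.mem_sup_left (Ideal.mem_span_singleton_self _)) (Ideal.mem_sup_right hu)
      · refine sup_le ?_ le_sup_left
        rw [Ideal.span_singleton_le_iff_mem]
        have : y 0 = x - u := by rw [hxdef]; ring
        rw [this]
        exact sub_mem (Ideal.mem_sup_right (Ideal.mem_span_singleton_self _)) (Ideal.mem_sup_left hu)
    have hxm : x ∈ maximalIdeal R := by
      rw [← hspan']; exact Ideal.mem_sup_right (Ideal.mem_span_singleton_self _)
    have hne : Ideal.span {x} ≠ ⊤ := fun h =>
      (maximalIdeal.isMaximal R).ne_top (top_le_iff.1 (h ▸ (Ideal.span_singleton_le_iff_mem _).2 hxm))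
    have : Nontrivial (R ⧸ Ideal.span {x}) := Ideal.Quotient.nontrivial_iff.2 hne
    have : IsLocalRing (R ⧸ Ideal.span {x}) :=
      .of_surjective' (Ideal.Quotient.mk _) Ideal.Quotient.mk_surjective
    have hdim : (n : WithBot ℕ∞) ≤ ringKrullDim (R ⧸ Ideal.span {x}) := by
      have h := ringKrullDim_le_ringKrullDim_add_card (R := R) (S := {x}) (by simpa using hxm)
      rw [Finset.coe_singleton, Finset.card_singleton] at h
      exact add_le_of_natCast_add (k := 1) (hn.trans (by exact_mod_cast h))
    have hdom := ih (R ⧸ Ideal.span {x}) _ (maximalIdeal_quotient_span _ hspan') hdim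
    have hprime : (Ideal.span {x}).IsPrime := (Ideal.Quotient.isDomain_iff_prime _).1 hdom
    obtain ⟨q, hq, hqx⟩ := Ideal.exists_minimalPrimes_le (I := ⊥) (J := Ideal.span {x}) bot_le
    have hxq : x ∉ q := hx q ((hfin.mem_toFinset).2 hq)
    have hqp : q.IsPrime := hq.1.1
    have hq0 : q = ⊥ := by
      refine Submodule.eq_bot_of_le_smul_of_le_jacobson_bot (Ideal.span {x}) q (IsNoetherian.noetherian q) ?_
        (((Ideal.span_singleton_le_iff_mem _).2 hxm).trans (IsLocalRing.maximalIdeal_le_jacobson _))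
      intro r hr
      obtain ⟨t, rfl⟩ := Ideal.mem_span_singleton'.1 (hqx hr)
      have ht : t ∈ q := (hqp.mem_or_mem hr).resolve_right hxq
      rw [mul_comm]
      exact Submodule.smul_mem_smul (Ideal.mem_span_singleton_self x) ht
    rw [hq0] at hqp
    exact IsDomain.of_bot_isPrime R

variable {R : Type u} [CommRing R] [IsLocalRing R] [IsNoetherianRing R]

lemma range_fin_eq (y : ℕ → R) (n : ℕ) : Ideal.span (Set.range fun j : Fin n => y j) = Id y n := by
  rw [Id]; congr 1
  ext z; constructor
  · rintro ⟨j, rfl⟩; exact ⟨j, j.2, rfl⟩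
  · rintro ⟨j, hj, rfl⟩; exact ⟨⟨j, hj⟩, rfl⟩

lemma Id_eq_span_finset (w : ℕ → R) (i : ℕ) [DecidableEq R] : Id w i = Ideal.span (((Finset.range i).image w : Finset R) : Set R) := by
  rw [Id]; congr 1; ext; simp

lemma height_le_of_minimalPrimes_Id {w : ℕ → R} {i : ℕ} {P : Ideal R} (h : P ∈ (Id w i).minimalPrimes) :
    P.height ≤ i := by
  classical
  rw [Id_eq_span_finset] at h
  refine (Ideal.height_le_card_of_mem_minimalPrimes_span_finset h).trans ?_
  exact_mod_cast Finset.card_image_le.trans (by simp)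

lemma ringKrullDim_le_quotient_Id {w : ℕ → R} {i : ℕ} (h : ∀ j < i, w j ∈ maximalIdeal R) :
    ringKrullDim R ≤ ringKrullDim (R ⧸ Id w i) + i := by
  classical
  have := ringKrullDim_le_ringKrullDim_add_card (R := R) (S := (Finset.range i).image w)
    (by intro z hz; simp at hz; obtain ⟨j, hj, rfl⟩ := hz; exact h j hj)
  rw [← Id_eq_span_finset] at this
  refine this.trans ?_
  gcongr
  exact_mod_cast Finset.card_image_le.trans (by simp)

lemma isPrime_Id_of_Id_eq_maximalIdeal {y : ℕ → R} {n : ℕ} (hy : Id y n = maximalIdeal R)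
    (hn : (n : WithBot ℕ∞) ≤ ringKrullDim R) {i : ℕ} (hi : i ≤ n) : (Id y i).IsPrime := by
  have hym : ∀ j < n, y j ∈ maximalIdeal R := fun j hj => hy ▸ Ideal.subset_span ⟨j, hj, rfl⟩
  have hne : Id y i ≠ ⊤ := fun h => (maximalIdeal.isMaximal R).ne_top
    (top_le_iff.1 (h ▸ hy ▸ Id_mono y hi))
  have : Nontrivial (R ⧸ Id y i) := Ideal.Quotient.nontrivial_iff.2 hne
  have : IsLocalRing (R ⧸ Id y i) :=
    .of_surjective' (Ideal.Quotient.mk _) Ideal.Quotient.mk_surjective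
  have hs : Ideal.span (Set.range fun j : Fin (n - i) => y (i + j)) ⊔ Id y i = maximalIdeal R := by
    rw [← hy, Id, Id, ← Ideal.span_union]
    congr 1
    ext z
    simp only [Set.mem_union, Set.mem_range, Set.mem_image, Set.mem_Iio]
    constructor
    · rintro (⟨j, rfl⟩ | ⟨j, hj, rfl⟩)
      · exact ⟨_, by omega, rfl⟩
      · exact ⟨j, by omega, rfl⟩
    · rintro ⟨j, hj, rfl⟩
      by_cases h : j < i
      · exact .inr ⟨j, h, rfl⟩
      · exact .inl ⟨⟨j - i, by omega⟩, by simp only; congr 1; omega⟩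
  have hd := hn.trans (ringKrullDim_le_quotient_Id fun j hj => hym j (hj.trans_le hi))
  rw [show n = (n - i) + i by omega] at hd
  have := isDomain_of_span_eq_maximalIdeal (n - i) (R ⧸ Id y i) _ (maximalIdeal_quotient_span _ hs)
    (add_le_of_natCast_add hd)
  exact (Ideal.Quotient.isDomain_iff_prime _).1 this

/-- A system of `dim R` generators of the maximal ideal is a regular sequence. -/
theorem regSeq_of_Id_eq_maximalIdeal {y : ℕ → R} {n : ℕ} (hy : Id y n = maximalIdeal R)
    (hn : (n : WithBot ℕ∞) ≤ ringKrullDim R) : RegSeq y n := by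
  intro i hi r hr
  refine ((isPrime_Id_of_Id_eq_maximalIdeal hy hn hi.le).mem_or_mem hr).resolve_left fun hyi => ?_
  classical
  set F := ((Finset.range n).erase i).image y with hF
  have hle : Id y i ≤ Ideal.span (F : Set R) := Ideal.span_mono (by
    rintro _ ⟨j, hj, rfl⟩
    rw [Set.mem_Iio] at hj
    simp only [hF, Finset.coe_image]
    exact ⟨j, by simp; omega, rfl⟩)
  have heq : Ideal.span (F : Set R) = maximalIdeal R := by
    rw [← hy]
    apply le_antisymm
    · exact Ideal.span_mono (by simp only [hF, Finset.coe_image]; exact Set.image_mono (by intro j; simp; exact fun h _ => h))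
    · rw [Id, Ideal.span_le]
      rintro _ ⟨j, hj, rfl⟩
      by_cases h : j = i
      · subst h; exact hle hyi
      · refine Ideal.subset_span ?_
        simp only [hF, Finset.coe_image]
        exact ⟨j, by simpa [h] using hj, rfl⟩
  have hmin : maximalIdeal R ∈ (Ideal.span (F : Set R)).minimalPrimes := by
    rw [heq, Ideal.minimalPrimes_eq_subsingleton_self]; rfl
  have h1 := Ideal.height_le_card_of_mem_minimalPrimes_span_finset hmin
  have h2 : F.card ≤ n - 1 := Finset.card_image_le.trans (by simp [Finset.card_erase_of_mem, hi])
  rw [← IsLocalRing.maximalIdeal_height_eq_ringKrullDim] at hn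
  have h3 : ((n : ℕ) : ℕ∞) ≤ (maximalIdeal R).height := by exact_mod_cast hn
  have h4 : ((n : ℕ) : ℕ∞) ≤ ((n - 1 : ℕ) : ℕ∞) := h3.trans (h1.trans (by exact_mod_cast h2))
  have := (Nat.cast_le (α := ℕ∞)).1 h4
  omega

end RegularLocal

section CM

variable {R : Type u} [CommRing R] [IsLocalRing R]

/-- The first `n` terms of `y` generate the maximal ideal and `n = dim R`. -/
structure RegPar (y : ℕ → R) (n : ℕ) : Prop where
  span : Id y n = maximalIdeal R
  dim : ringKrullDim R = n

lemma exists_expr {y : ℕ → R} {n : ℕ} (h : Id y n = maximalIdeal R) (w : ℕ → R) :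
    ∃ a : ℕ → Fin n → R, ∀ i, w i ∈ maximalIdeal R → w i = ∑ j, a i j * y j := by
  have : ∀ i, ∃ c : Fin n → R, w i ∈ maximalIdeal R → w i = ∑ j, c j * y j := by
    intro i
    by_cases hi : w i ∈ maximalIdeal R
    · rw [← h] at hi
      obtain ⟨c, hc⟩ := exists_coeff hi
      exact ⟨fun j => c j, fun _ => by rw [hc, Finset.sum_range]⟩
    · exact ⟨0, fun h => absurd h hi⟩
  choose a ha using this
  exact ⟨a, ha⟩

lemma RegSeq.mono {w : ℕ → R} {i k : ℕ} (h : RegSeq w k) (hi : i ≤ k) : RegSeq w i :=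
  fun j hj => h j (hj.trans_le hi)

lemma RegSeq.congr {w w' : ℕ → R} {k : ℕ} (h : RegSeq w k) (hw : ∀ i < k, w i = w' i) :
    RegSeq w' k := by
  intro i hi r hr
  rw [← hw i hi, ← Id_congr fun j hj => hw j (hj.trans hi)] at hr
  rw [← Id_congr fun j hj => hw j (hj.trans hi)]
  exact h i hi r hr

/-- Step-by-step extension of a regular sequence inside an ideal. -/
lemma exists_extend (Q : Ideal R) {k : ℕ}
    (hQ : ∀ i < k, ∀ w : ℕ → R, RegSeq w i → (∀ j < i, w j ∈ Q) →
      ∃ q ∈ Q, ∀ r, q * r ∈ Id w i → r ∈ Id w i)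
    {w : ℕ → R} {i : ℕ} (hw : RegSeq w i) (hwQ : ∀ j < i, w j ∈ Q) (hik : i ≤ k) :
    ∃ w' : ℕ → R, (∀ j < i, w' j = w j) ∧ RegSeq w' k ∧ ∀ j < k, w' j ∈ Q := by
  induction k, hik using Nat.le_induction with
  | base => exact ⟨w, fun _ _ => rfl, hw, hwQ⟩
  | succ k hik ih =>
    obtain ⟨w', h1, h2, h3⟩ := ih fun i hi => hQ i (hi.trans (Nat.lt_succ_self k))
    obtain ⟨q, hq, hq'⟩ := hQ k (Nat.lt_succ_self k) w' h2 h3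
    have hne : ∀ j < k, Function.update w' k q j = w' j := fun j hj =>
      Function.update_of_ne hj.ne _ _
    refine ⟨Function.update w' k q, fun j hj => ?_, ?_, fun j hj => ?_⟩
    · rw [hne j (by omega), h1 j hj]
    · intro j hj r hr
      rw [Id_congr fun l hl => hne l (by omega)] at hr ⊢
      rcases Nat.lt_succ_iff_lt_or_eq.1 hj with hj' | rfl
      · rw [hne j hj'] at hr; exact h2 j hj' r hr
      · rw [Function.update_self] at hr; exact hq' r hr
    · rcases Nat.lt_succ_iff_lt_or_eq.1 hj with hj' | rfl
      · rw [hne j hj']; exact h3 j hj'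
      · rwa [Function.update_self]

variable [IsNoetherianRing R]

lemma chain_regSeq {w : ℕ → R} {h k : ℕ} (hw : RegSeq w k) (hhk : h ≤ k) {P₀ P : Ideal R}
    [hP : P.IsPrime] (h₀ : AssI (Id w h) P₀) (hle : P₀ ≤ P) (hwP : ∀ j < k, w j ∈ P) :
    ∃ P₁, AssI (Id w k) P₁ ∧ P₀ ≤ P₁ ∧ P₁ ≤ P ∧ P₀.height + (k - h : ℕ) ≤ P₁.height ∧
      (h < k → P₀ < P₁) := by
  induction k, hhk using Nat.le_induction with
  | base => exact ⟨P₀, h₀, le_rfl, hle, by simp, fun h => absurd h (lt_irrefl _)⟩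
  | succ k hhk ih =>
    obtain ⟨P₁, h1, h2, h3, h4, h5⟩ := ih (hw.mono (Nat.le_succ k)) fun j hj => hwP j (by omega)
    obtain ⟨P₂, g1, g2, g3⟩ := chain_step h1 h3 (hwP k (Nat.lt_succ_self k)) (hw k (Nat.lt_succ_self k))
    rw [← Id_succ] at g1
    have := h1.1
    have := g1.1
    refine ⟨P₂, g1, h2.trans g2.le, g3, ?_, fun _ => h2.trans_lt g2⟩
    have := Ideal.height_add_one_le_of_lt_of_isPrime g2
    rw [show k + 1 - h = (k - h) + 1 by omega]
    push_cast
    rw [← add_assoc]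
    exact (add_le_add_left h4 1).trans this

variable {y : ℕ → R} {n : ℕ}

lemma RegPar.mem (hy : RegPar y n) {j : ℕ} (hj : j < n) : y j ∈ maximalIdeal R :=
  hy.span ▸ mem_Id hj

lemma RegPar.isDomain (hy : RegPar y n) : IsDomain R :=
  isDomain_of_span_eq_maximalIdeal n R (fun j : Fin n => y j) (by rw [range_fin_eq, hy.span])
    hy.dim.ge

lemma RegPar.regSeq (hy : RegPar y n) : RegSeq y n :=
  regSeq_of_Id_eq_maximalIdeal hy.span hy.dim.ge

lemma RegPar.height (hy : RegPar y n) : (maximalIdeal R).height = n := by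
  have := IsLocalRing.maximalIdeal_height_eq_ringKrullDim (R := R)
  rw [hy.dim] at this
  exact_mod_cast this

lemma RegPar.not_assI_maximalIdeal (hy : RegPar y n) {w : ℕ → R} {i : ℕ} (hw : RegSeq w i)
    (hwm : ∀ j < i, w j ∈ maximalIdeal R) (hi : i < n) : ¬ AssI (Id w i) (maximalIdeal R) := by
  rintro ⟨hp, u, hu⟩
  obtain ⟨a, ha⟩ := exists_expr hy.span w
  have : u ∈ Id w i := mem_of_forall_mul_mem (acyclic_of_regSeq hy.regSeq) hw
    (a := a) (fun j hj => ha j (hwm j hj)) hi (fun j => (hu _).1 (hy.mem j.2))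
  exact hp.ne_top ((Ideal.eq_top_iff_one _).2 ((hu 1).2 (by simpa using this)))

lemma RegPar.extend_max (hy : RegPar y n) {w : ℕ → R} {i : ℕ} (hw : RegSeq w i)
    (hwm : ∀ j < i, w j ∈ maximalIdeal R) (hi : i ≤ n) :
    ∃ w' : ℕ → R, (∀ j < i, w' j = w j) ∧ RegSeq w' n ∧ ∀ j < n, w' j ∈ maximalIdeal R := by
  refine exists_extend _ (fun i hi w hw hwm => ?_) hw hwm hi
  obtain ⟨q, hq, hq'⟩ := exists_mem_not_mem {P | AssI (Id w i) P} (assI_finite _) (fun P hP => hP.1)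
    (maximalIdeal R) (fun P hP hle => by
      have := (maximalIdeal.isMaximal R).eq_of_le hP.1.ne_top hle
      exact hy.not_assI_maximalIdeal hw hwm hi (this ▸ hP))
  exact ⟨q, hq, fun r hr => mem_of_mul_mem_of_forall_assI hq' hr⟩

lemma RegPar.assI_bot (hy : RegPar y n) (w : ℕ → R) : AssI (Id w 0) (⊥ : Ideal R) := by
  have := hy.isDomain
  exact ⟨Ideal.isPrime_bot, 1, by simp [Id_zero]⟩

lemma RegPar.le_height (hy : RegPar y n) {w : ℕ → R} {i : ℕ} (hw : RegSeq w i) {P : Ideal R}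
    [P.IsPrime] (hwP : ∀ j < i, w j ∈ P) : (i : ℕ∞) ≤ P.height := by
  obtain ⟨P₁, h1, -, h2, h3, -⟩ := chain_regSeq hw (Nat.zero_le i) (hy.assI_bot w) bot_le hwP
  have : (i : ℕ∞) ≤ P₁.height := le_trans (by simp) h3
  exact this.trans (Ideal.height_mono h2)

lemma RegPar.height_le (hy : RegPar y n) {P : Ideal R} (hP : P.IsPrime) : P.height ≤ n :=
  hy.height ▸ Ideal.height_mono (le_maximalIdeal hP.ne_top)

/-- Unmixedness: associated primes of an ideal generated by a regular sequence of length `i`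
have height `i`. -/
theorem RegPar.assI_height (hy : RegPar y n) {w : ℕ → R} {i : ℕ} (hw : RegSeq w i)
    (hwm : ∀ j < i, w j ∈ maximalIdeal R) {P : Ideal R} (hP : AssI (Id w i) P) : P.height = i := by
  have := hP.1
  have hlow := hy.le_height hw (P := P) fun j hj => hP.le (mem_Id hj)
  refine le_antisymm ?_ hlow
  have hin : i ≤ n := by exact_mod_cast hlow.trans (hy.height_le hP.1)
  obtain ⟨w', h1, h2, h3⟩ := hy.extend_max hw hwm hin
  rw [← Id_congr h1] at hP
  obtain ⟨P₁, g1, -, -, g3, -⟩ := chain_regSeq h2 hin hP (le_maximalIdeal hP.1.ne_top) h3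
  have g4 := g3.trans (hy.height_le g1.1)
  have hf : P.height ≠ ⊤ := ne_top_of_le_ne_top (ENat.coe_ne_top n) (hy.height_le hP.1)
  obtain ⟨c, hc⟩ := ENat.ne_top_iff_exists.1 hf
  rw [← hc] at g4 ⊢
  norm_cast at g4 ⊢
  omega

/-- Any regular sequence inside a prime `Q` extends inside `Q` to length the height of `Q`. -/
theorem RegPar.extend (hy : RegPar y n) {Q : Ideal R} (hQ : Q ≠ ⊤) {k : ℕ} (hk : (k : ℕ∞) ≤ Q.height)
    {w : ℕ → R} {i : ℕ} (hw : RegSeq w i) (hwQ : ∀ j < i, w j ∈ Q) (hi : i ≤ k) :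
    ∃ w' : ℕ → R, (∀ j < i, w' j = w j) ∧ RegSeq w' k ∧ ∀ j < k, w' j ∈ Q := by
  refine exists_extend _ (fun i hi w hw hwQ => ?_) hw hwQ hi
  obtain ⟨q, hq, hq'⟩ := exists_mem_not_mem {P | AssI (Id w i) P} (assI_finite _) (fun P hP => hP.1)
    Q (fun P hP hle => by
      have h1 := Ideal.height_mono hle
      rw [hy.assI_height hw (fun j hj => le_maximalIdeal hQ (hwQ j hj)) hP] at h1
      have := hk.trans h1
      norm_cast at this
      omega)
  exact ⟨q, hq, fun r hr => mem_of_mul_mem_of_forall_assI hq' hr⟩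

lemma RegPar.exists_height (hy : RegPar y n) {P : Ideal R} (hP : P.IsPrime) :
    ∃ h : ℕ, P.height = h := by
  have hf : P.height ≠ ⊤ := ne_top_of_le_ne_top (ENat.coe_ne_top n) (hy.height_le hP)
  obtain ⟨c, hc⟩ := ENat.ne_top_iff_exists.1 hf
  exact ⟨c, hc.symm⟩

lemma RegPar.eq_of_le_of_height (hy : RegPar y n) {P Q : Ideal R} (hP : P.IsPrime) (hQ : Q.IsPrime)
    (hle : P ≤ Q) (h : Q.height ≤ P.height) : P = Q := by
  by_contra hne
  have hlt := Ideal.height_add_one_le_of_lt_of_isPrime (lt_of_le_of_ne hle hne)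
  obtain ⟨a, ha⟩ := hy.exists_height hP
  obtain ⟨b, hb⟩ := hy.exists_height hQ
  rw [ha, hb] at hlt
  rw [ha, hb] at h
  have h1 : a + 1 ≤ b := by exact_mod_cast hlt
  have h2 : b ≤ a := by exact_mod_cast h
  omega

/-- A prime of height `h` is associated to any length-`h` regular sequence inside it. -/
theorem RegPar.assI_of_height (hy : RegPar y n) {P : Ideal R} (hP : P.IsPrime) {w : ℕ → R} {h : ℕ}
    (hw : RegSeq w h) (hwP : ∀ j < h, w j ∈ P) (hh : P.height = h) : AssI (Id w h) P := by
  obtain ⟨Q, hQ, hQP⟩ := Ideal.exists_minimalPrimes_le (Id_le hwP)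
  have hQ' := AssI.of_mem_minimalPrimes hQ
  have h1 := hy.assI_height hw (fun j hj => le_maximalIdeal hP.ne_top (hwP j hj)) hQ'
  rwa [← hy.eq_of_le_of_height hQ'.1 hP hQP (by rw [h1, hh])]

/-- Catenarity: the heights of adjacent primes differ by one. -/
theorem RegPar.height_of_adjacent (hy : RegPar y n) {P₀ P : Ideal R} (hP₀ : P₀.IsPrime)
    (hP : P.IsPrime) (hlt : P₀ < P) (hadj : ∀ Q : Ideal R, Q.IsPrime → P₀ < Q → Q ≤ P → Q = P) :
    P.height = P₀.height + 1 := by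
  obtain ⟨h, hh⟩ := hy.exists_height hP₀
  obtain ⟨k, hk⟩ := hy.exists_height hP
  obtain ⟨w, -, hw, hwP₀⟩ := hy.extend hP₀.ne_top hh.ge (w := fun _ => 0) (i := 0)
    (fun _ h => absurd h (by omega)) (fun _ h => absurd h (by omega)) (Nat.zero_le h)
  have hlt' := Ideal.height_add_one_le_of_lt_of_isPrime hlt
  have hhk : h + 1 ≤ k := by rw [hh, hk] at hlt'; exact_mod_cast hlt'
  obtain ⟨w', h1, h2, h3⟩ := hy.extend hP.ne_top hk.ge hw (fun j hj => hlt.le (hwP₀ j hj)) (by omega)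
  have hA : AssI (Id w' h) P₀ := by
    rw [Id_congr h1]; exact hy.assI_of_height hP₀ hw hwP₀ hh
  have hwm : ∀ j < k, w' j ∈ maximalIdeal R := fun j hj => le_maximalIdeal hP.ne_top (h3 j hj)
  obtain ⟨P₁, g1, g2, g3, -, g5⟩ := chain_regSeq (h2.mono hhk) (Nat.le_succ h) hA hlt.le
    fun j hj => h3 j (by omega)
  have := hadj P₁ g1.1 (g5 (Nat.lt_succ_self h)) g3
  rw [← this, hy.assI_height (h2.mono hhk) (fun j hj => hwm j (by omega)) g1, hh]
  simp

/-- There is no prime strictly between `P` and a minimal prime of `P ⊔ (v)`. -/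
lemma eq_of_mem_minimalPrimes_sup_span {P Q Q' : Ideal R} (hP : P.IsPrime) {v : R}
    (hQ : Q ∈ (P ⊔ Ideal.span {v}).minimalPrimes) (hQ' : Q'.IsPrime) (h1 : P < Q') (h2 : Q' ≤ Q) :
    Q' = Q := by
  by_contra hne
  have hQp : Q.IsPrime := hQ.1.1
  have hk := Ideal.map_height_le_one_of_mem_minimalPrimes hQ
  set f := Ideal.Quotient.mk P with hf
  have hker : RingHom.ker f = P := Ideal.mk_ker
  have hfs : Function.Surjective f := Ideal.Quotient.mk_surjective
  have hpr : ∀ K : Ideal R, K.IsPrime → P ≤ K → (K.map f).IsPrime := fun K hK hle =>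
    Ideal.map_isPrime_of_surjective hfs (by rwa [hker])
  have hlt : ∀ K K' : Ideal R, P ≤ K → P ≤ K' → K < K' → K.map f < K'.map f := by
    intro K K' g1 g2 g3
    refine lt_of_le_of_ne (Ideal.map_mono g3.le) fun he => g3.ne ?_
    have e1 : (K.map f).comap f = K := by
      rw [Ideal.comap_map_of_surjective f hfs, ← RingHom.ker_eq_comap_bot, hker, sup_eq_left.2 g1]
    have e2 : (K'.map f).comap f = K' := by
      rw [Ideal.comap_map_of_surjective f hfs, ← RingHom.ker_eq_comap_bot, hker, sup_eq_left.2 g2]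
    rw [← e1, ← e2, he]
  haveI := hpr P hP le_rfl
  haveI := hpr Q' hQ' h1.le
  haveI := hpr Q hQp (h1.le.trans h2)
  have a1 := Ideal.height_add_one_le_of_lt_of_isPrime (hlt P Q' le_rfl h1.le h1)
  have a2 := Ideal.height_add_one_le_of_lt_of_isPrime
    (hlt Q' Q h1.le (h1.le.trans h2) (lt_of_le_of_ne h2 hne))
  have : ((P.map f).height + 1) + 1 ≤ 1 := by
    calc _ ≤ (Q'.map f).height + 1 := by gcongr
      _ ≤ (Q.map f).height := a2
      _ ≤ 1 := hk
  have h3 : (1 : ℕ∞) + 1 ≤ 1 := le_trans (by gcongr; simp) this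
  exact absurd h3 (by decide)

/-- The height of a minimal prime of `P ⊔ (v)`, for `P` prime and `v ∉ P`. -/
lemma RegPar.height_of_mem_minimalPrimes (hy : RegPar y n) {P Q : Ideal R} (hP : P.IsPrime) {v : R}
    (hv : v ∉ P) (hQ : Q ∈ (P ⊔ Ideal.span {v}).minimalPrimes) : Q.height = P.height + 1 := by
  have hvQ : v ∈ Q := hQ.1.2 (Ideal.mem_sup_right (Ideal.mem_span_singleton_self v))
  refine hy.height_of_adjacent hP hQ.1.1 (lt_of_le_of_ne (le_sup_left.trans hQ.1.2) ?_)
    fun Q' hQ' h1 h2 => eq_of_mem_minimalPrimes_sup_span hP hQ hQ' h1 h2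
  rintro rfl
  exact hv hvQ

lemma RegPar.le_height_add (hy : RegPar y n) {v : ℕ → R} (j : ℕ) {N : ℕ} : ∀ {P : Ideal R}, P.IsPrime →
    (∀ i < j, v i ∈ maximalIdeal R) → maximalIdeal R ^ N ≤ P ⊔ Id v j → (n : ℕ∞) ≤ P.height + j := by
  induction j with
  | zero =>
    intro P hP _ h
    rw [Id_zero, sup_bot_eq] at h
    have : P = maximalIdeal R := le_antisymm (le_maximalIdeal hP.ne_top) (hP.le_of_pow_le h)
    simp [this, hy.height]
  | succ j ih =>
    intro P hP hv h
    obtain ⟨Q, hQ, hQm⟩ := Ideal.exists_minimalPrimes_le (I := P ⊔ Ideal.span {v j})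
      (J := maximalIdeal R) (sup_le (le_maximalIdeal hP.ne_top)
        ((Ideal.span_singleton_le_iff_mem _).2 (hv j (by omega))))
    have := ih hQ.1.1 (fun i hi => hv i (by omega)) (h.trans (by
      rw [Id_succ]
      exact sup_le (le_trans le_sup_left (le_trans hQ.1.2 le_sup_left))
        (sup_le le_sup_right (le_trans le_sup_right (le_trans hQ.1.2 le_sup_left)))))
    refine this.trans ?_
    have hh : Q.height ≤ P.height + 1 := by
      by_cases hvP : v j ∈ P
      · have : P ∈ (P ⊔ Ideal.span {v j}).minimalPrimes := by
          rw [sup_eq_left.2 ((Ideal.span_singleton_le_iff_mem _).2 hvP)]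
          haveI := hP
          simp [Ideal.minimalPrimes_eq_subsingleton_self]
        have hle : Q ≤ P := by
          have h1 : P ≤ Q := le_trans le_sup_left hQ.1.2
          exact hQ.2 this.1 h1
        exact (Ideal.height_mono hle).trans (by simp)
      · exact (hy.height_of_mem_minimalPrimes hP hvP hQ).le
    calc Q.height + j ≤ P.height + 1 + j := by gcongr
      _ = P.height + ((j + 1 : ℕ) : ℕ∞) := by push_cast; ring

/-- Every `m`-primary sequence of `dim R` elements is a regular sequence. -/
theorem RegPar.regSeq_of_pow_le (hy : RegPar y n) {w : ℕ → R} (hwm : ∀ j < n, w j ∈ maximalIdeal R)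
    {N : ℕ} (hN : maximalIdeal R ^ N ≤ Id w n) : RegSeq w n := by
  suffices h : ∀ k ≤ n, RegSeq w k from h n le_rfl
  intro k
  induction k with
  | zero => exact fun _ i hi => absurd hi (by omega)
  | succ k ih =>
    intro hk
    have hw := ih (by omega)
    intro i hi r hr
    rcases Nat.lt_succ_iff_lt_or_eq.1 hi with hi' | rfl
    · exact hw i hi' r hr
    refine mem_of_mul_mem_of_forall_assI (fun P hP hwP => ?_) hr
    have hwm' : ∀ j < i, w j ∈ maximalIdeal R := fun j hj => hwm j (by omega)
    have hPp := hP.1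
    have hd := hy.le_height_add (v := fun l => w (i + 1 + l)) (n - (i + 1)) hPp
      (fun l hl => hwm _ (by omega)) (N := N) (hN.trans (Id_le fun j hj => ?_))
    · rw [hy.assI_height hw hwm' hP] at hd
      have : n ≤ i + (n - (i + 1)) := by exact_mod_cast hd
      omega
    · rcases lt_trichotomy j i with h | rfl | h
      · exact Ideal.mem_sup_left (hP.le (mem_Id h))
      · exact Ideal.mem_sup_left hwP
      · have := mem_Id (w := fun l => w (i + 1 + l)) (show j - (i + 1) < n - (i + 1) by omega)
        rw [show i + 1 + (j - (i + 1)) = j by omega] at this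
        exact Ideal.mem_sup_right this

end CM

section
variable {R : Type*} [CommRing R] {l : ℕ}

/-- `b` kills the Koszul homology of `y` on `R ⧸ I` in degrees at least `h`. -/
def Kills (y : Fin l → R) (I : Ideal R) (h : ℕ) (b : R) : Prop :=
  ∀ A : KV l R, SuppGE h A → In I (contr y A) → ∃ κ, In I (b • A - contr y κ)

lemma SuppGE.smul {m : ℕ} {u : KV l R} (hu : SuppGE m u) (r : R) : SuppGE m (r • u) :=
  fun T hT => by simp [hu T hT]

lemma exists_trunc {y : Fin l → R} {I : Ideal R} {m : ℕ} (hm : 0 < m) {u κ : KV l R}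
    (hu : SuppGE m u) (h : In I (u - contr y κ)) :
    ∃ κ' : KV l R, SuppGE (m + 1) κ' ∧ In I (u - contr y κ') := by
  obtain ⟨κ', h1, h2⟩ := trunc (a := 0) (i := 0) (r := 0) (Nat.zero_le m) hu
    (κ := κ) (I := I) (y := y) (by simpa using h)
  exact ⟨κ', h1, by simpa using h2⟩

lemma Acyclic.exists_supp {y : Fin l → R} (hy : Acyclic y) {m : ℕ} (hm : 0 < m) {u : KV l R}
    (hu : SuppGE m u) (h : contr y u = 0) : ∃ κ, SuppGE (m + 1) κ ∧ u = contr y κ := by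
  obtain ⟨κ, r, h1, h2, h3⟩ := acyclic_mod hy (w := 0) (a := 0) (i := 0)
    (fun i hi => absurd hi (Nat.not_lt_zero i)) (fun i hi => absurd hi (Nat.not_lt_zero i))
    (Nat.zero_le m) hu (by rw [h]; exact fun T => Submodule.zero_mem _)
  refine ⟨κ, h1, ?_⟩
  rw [h2 hm, zero_smul, sub_zero] at h3
  ext T
  have := h3 T
  rw [Id_zero, Submodule.mem_bot] at this
  simpa [sub_eq_zero] using this

lemma kills_of_gt (y : Fin l → R) (I : Ideal R) {h : ℕ} (hl : l < h) (b : R) : Kills y I h b := by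
  intro A hA _
  refine ⟨0, fun T => ?_⟩
  have := hA T (by have := card_finset_fin_le T; omega)
  simp [this]

/-- Filter `R ⧸ I` by cyclic modules `R ⧸ P` with `P` prime. -/
lemma kills_of_prime [IsNoetherianRing R] {ι : Type*} (y : ι → Fin l → R) {𝔭 : Ideal R}
    (h𝔭 : 𝔭 ∈ minimalPrimes R) {h : ℕ} (h0 : 0 < h)
    (hk : ∃ b ∉ 𝔭, ∀ q, Kills (y q) 𝔭 h b) (I : Ideal R) :
    ∃ b ∉ 𝔭, ∀ q, Kills (y q) I h b := by
  have h𝔭' : 𝔭.IsPrime := h𝔭.1.1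
  induction I using WellFoundedGT.induction with
  | ind I ih =>
  by_cases hI : I = ⊤
  · subst hI
    exact ⟨1, h𝔭'.one_notMem, fun q A _ _ => ⟨0, fun T => Submodule.mem_top⟩⟩
  obtain ⟨P, ⟨hP, t, ht⟩, -⟩ := exists_assI (I := I) (u := 1) (by rwa [← Ideal.eq_top_iff_one])
  obtain ⟨b, hb, hbk⟩ := ih (I ⊔ Ideal.span {t}) (by
    refine lt_of_le_of_ne le_sup_left fun h => hP.ne_top ?_
    rw [Ideal.eq_top_iff_one, ht, one_mul, h]
    exact Ideal.mem_sup_right (Ideal.mem_span_singleton_self t))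
  have hc : ∃ c ∉ 𝔭, ∀ q, Kills (y q) P h c := by
    by_cases hPp : P ≤ 𝔭
    · have : P = 𝔭 := le_antisymm hPp (h𝔭.2 ⟨hP, bot_le⟩ hPp)
      subst this; exact hk
    · obtain ⟨c, hc, hc'⟩ := SetLike.not_le_iff_exists.mp hPp
      exact ⟨c, hc', fun q A _ _ => ⟨0, by simpa using In.smul_of_mem hc A⟩⟩
  obtain ⟨c, hc, hck⟩ := hc
  refine ⟨c * b, fun h => (h𝔭'.mem_or_mem h).elim hc hb, fun q A hA hDA => ?_⟩
  obtain ⟨κ, hκ⟩ := hbk q A hA (hDA.mono le_sup_left)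
  obtain ⟨κ, hκs, hκ⟩ := exists_trunc h0 (hA.smul b) hκ
  have hE : ∀ T, ∃ e, (b • A - contr (y q) κ) T - t * e ∈ I := by
    intro T
    obtain ⟨i, hi, j, hj, hij⟩ := Submodule.mem_sup.mp (hκ T)
    obtain ⟨e, rfl⟩ := Ideal.mem_span_singleton'.mp hj
    exact ⟨e, by rw [← hij]; convert hi using 1; ring⟩
  choose e he using hE
  classical
  let E : KV l R := fun T => if T.card < h then 0 else e T
  have hEs : SuppGE h E := fun T hT => by simp [E, hT]
  have hEI : In I (b • A - contr (y q) κ - t • E) := by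
    intro T
    by_cases hT : T.card < h
    · have h1 := hA T hT
      have h2 := hκs.contr (y q) T (by omega)
      simp [E, hT, h1, h2]
    · have := he T
      simpa [E, hT] using this
  have hDE : In P (contr (y q) E) := by
    intro T
    rw [ht]
    have h1 := (hEI.contr (y q)) T
    have h2 := (hDA.smul b) T
    have := I.sub_mem h2 h1
    simp only [map_sub, map_smul, contr_contr, sub_zero] at this
    convert this using 1
    simp [mul_comm]
  obtain ⟨κ', hκ'⟩ := hck q E hEs hDE
  refine ⟨c • κ + t • κ', fun T => ?_⟩
  have h1 := (ht _).mp (hκ' T)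
  have h2 := (hEI.smul c) T
  convert I.add_mem h1 h2 using 1
  simp only [map_add, map_smul, Pi.sub_apply, Pi.add_apply, Pi.smul_apply, smul_eq_mul]
  ring

/-- Uniform annihilation of the higher Koszul homology of a quotient by a minimal prime which is
the annihilator of an element. -/
lemma exists_kills_prime [IsNoetherianRing R] {ι : Type*} (y : ι → Fin l → R)
    (hy : ∀ q, Acyclic (y q)) {𝔭 : Ideal R} (h𝔭 : 𝔭 ∈ minimalPrimes R) {u : R}
    (hu : ∀ r, r ∈ 𝔭 ↔ r * u = 0) {h : ℕ} (h0 : 0 < h) :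
    ∃ b ∉ 𝔭, ∀ q, Kills (y q) 𝔭 h b := by
  have h𝔭' : 𝔭.IsPrime := h𝔭.1.1
  obtain ⟨k, hk⟩ : ∃ k, l + 1 ≤ h + k := ⟨l + 1, by omega⟩
  induction k generalizing h with
  | zero => exact ⟨1, h𝔭'.one_notMem, fun q => kills_of_gt _ _ (by omega) _⟩
  | succ k ih =>
    obtain ⟨b, hb, hbk⟩ := kills_of_prime y h𝔭 (Nat.succ_pos h)
      (ih (Nat.succ_pos h) (by omega)) (Ideal.span {u})
    refine ⟨b, hb, fun q A hA hDA => ?_⟩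
    obtain ⟨A₁, hA₁, hA₁'⟩ := (hy q).exists_supp h0 (hA.smul u) (by
      ext T
      have := (hu _).mp (hDA T)
      simpa [mul_comm] using this)
    obtain ⟨κ, hκ⟩ := hbk q A₁ hA₁ (by
      rw [← hA₁']; exact In.smul_of_mem (Ideal.mem_span_singleton_self u) A)
    choose e he using fun T => Ideal.mem_span_singleton'.mp (hκ T)
    refine ⟨e, fun T => ?_⟩
    have h1 : b • A₁ - contr (y q) κ = u • e := by
      ext T; simp [← he T, mul_comm]
    have h2 : b • u • A = u • contr (y q) e := by
      rw [hA₁', ← map_smul, ← map_smul, ← h1, map_sub, contr_contr, sub_zero]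
    rw [hu]
    have h3 := congrFun h2 T
    simp only [Pi.smul_apply, smul_eq_mul] at h3
    simp only [Pi.sub_apply, Pi.smul_apply, smul_eq_mul]
    linear_combination h3

lemma wedge_eOne_singleton (s : Fin l → R) (i : Fin l) : wedge s (eOne : KV l R) {i} = s i := by
  rw [wedge_apply, Finset.sum_apply, Finset.sum_eq_single i]
  · rw [Pi.smul_apply, crea_apply]
    simp [eOne, sgn, Finset.filter_singleton]
  · intro j _ hj
    rw [Pi.smul_apply, crea_apply]
    simp [hj]
  · simp

lemma contr_wedge_eOne (y s : Fin l → R) :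
    contr y (wedge s (eOne : KV l R)) = (∑ j, s j * y j) • eOne := by
  rw [contr_wedge, contr_eOne, map_zero, sub_zero]

lemma suppGE_wedge_eOne (s : Fin l → R) : SuppGE 1 (wedge s (eOne : KV l R)) :=
  SuppGE.wedge (m := 0) (fun T hT => absurd hT (Nat.not_lt_zero _)) s

lemma In.smul_eOne {I : Ideal R} {r : R} (hr : r ∈ I) : In I (r • (eOne : KV l R)) :=
  In.smul_of_mem hr _

end
section
variable {R : Type*} [CommRing R]

lemma exists_coeff_fin {w : ℕ → R} {k : ℕ} {r : R} (h : r ∈ Id w k) :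
    ∃ c : Fin k → R, r = ∑ j, c j * w j := by
  obtain ⟨c, hc⟩ := exists_coeff h
  exact ⟨fun j => c j, by rw [hc, Finset.sum_range]⟩

lemma Kills.colon {w : ℕ → R} {i : ℕ} {𝔭 : Ideal R} {b : R}
    (hb : Kills (fun j : Fin (i + 1) => w j) 𝔭 1 b) {r : R} (hr : w i * r ∈ 𝔭 ⊔ Id w i) :
    b * r ∈ 𝔭 ⊔ Id w i := by
  obtain ⟨p, hp, q, hq, hpq⟩ := Submodule.mem_sup.mp hr
  obtain ⟨c, hc⟩ := exists_coeff_fin hq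
  obtain ⟨κ, hκ⟩ := hb (wedge (Fin.snoc (fun j => - c j) r : Fin (i + 1) → R) eOne)
    (suppGE_wedge_eOne _) (by
      rw [contr_wedge_eOne]
      refine In.smul_eOne ?_
      rw [Fin.sum_univ_castSucc]
      simp only [Fin.snoc_castSucc, Fin.snoc_last, Fin.val_castSucc, Fin.val_last]
      convert hp using 1
      simp only [neg_mul, Finset.sum_neg_distrib, ← hc]
      linear_combination -hpq)
  have h1 := hκ {Fin.last i}
  have h2 : contr (fun j : Fin (i + 1) => w j) κ {Fin.last i} ∈ Id w i := by
    rw [contr_apply, Finset.sum_apply]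
    refine Ideal.sum_mem _ fun j _ => ?_
    rw [Pi.smul_apply, anni_apply]
    split_ifs with hj
    · simp
    · refine Ideal.mul_mem_right _ _ (mem_Id ?_)
      have : j ≠ Fin.last i := by simpa using hj
      exact Fin.val_lt_last this
  simp only [Pi.sub_apply, Pi.smul_apply, wedge_eOne_singleton, Fin.snoc_last, smul_eq_mul] at h1
  have := (𝔭 ⊔ Id w i).add_mem (Ideal.mem_sup_left h1) (Ideal.mem_sup_right h2)
  simpa using this

lemma Kills.mul_mem {w : ℕ → R} {k : ℕ} {u b : R}
    (hb : Kills (fun j : Fin k => w j) (Ideal.span {u}) 1 b) {r : R} (hr : r * u ∈ Id w k) :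
    ∃ s ∈ Id w k, (b * r - s) * u = 0 := by
  obtain ⟨c, hc⟩ := exists_coeff_fin hr
  obtain ⟨κ, hκ⟩ := hb (wedge c eOne) (suppGE_wedge_eOne _) (by
    rw [contr_wedge_eOne, ← hc]
    exact In.smul_eOne (Ideal.mul_mem_left _ _ (Ideal.mem_span_singleton_self u)))
  choose e he using fun T => Ideal.mem_span_singleton'.mp (hκ T)
  have h1 : b • wedge c eOne - contr (fun j : Fin k => w j) κ = u • e := by
    ext T; simp [← he T, mul_comm]
  have h2 := congrArg (contr fun j : Fin k => w j) h1
  rw [map_sub, map_smul, contr_contr, contr_wedge_eOne, ← hc, map_smul, sub_zero] at h2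
  refine ⟨contr (fun j : Fin k => w j) e ∅, in_contr_of_mem (fun j => mem_Id j.2) e ∅, ?_⟩
  have h3 := congrFun h2 ∅
  simp only [Pi.smul_apply, smul_eq_mul, eOne, Pi.single_eq_same, mul_one] at h3
  linear_combination h3

lemma Id_map {S : Type*} [CommRing S] (f : R →+* S) (w : ℕ → R) (k : ℕ) :
    (Id w k).map f = Id (fun i => f (w i)) k := by
  rw [Id, Id, Ideal.map_span, ← Set.image_comp]; rfl

lemma mem_Id_mk {J : Ideal R} {w : ℕ → R} {k : ℕ} {r : R} :
    Ideal.Quotient.mk J r ∈ Id (fun i => Ideal.Quotient.mk J (w i)) k ↔ r ∈ J ⊔ Id w k := by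
  rw [← Id_map, ← Ideal.mem_comap,
    Ideal.comap_map_of_surjective' _ Ideal.Quotient.mk_surjective, Ideal.mk_ker, sup_comm]

variable [IsNoetherianRing R]

/-- Uniform colon killers modulo an associated prime, for a family of regular sequences. -/
lemma exists_uniform_colon {ι : Type*} {J 𝔭 : Ideal R} (h𝔭 : 𝔭 ∈ J.minimalPrimes) {u : R}
    (hu : ∀ r, r ∈ 𝔭 ↔ r * u ∈ J) {δ : ℕ} (z : ι → ℕ → R)
    (hz : ∀ q, ∀ i < δ, ∀ r, z q i * r ∈ J ⊔ Id (z q) i → r ∈ J ⊔ Id (z q) i) :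
    (∃ a ∉ 𝔭, ∀ q, ∀ i < δ, ∀ r, z q i * r ∈ 𝔭 ⊔ Id (z q) i → a * r ∈ 𝔭 ⊔ Id (z q) i) ∧
    ∃ b ∉ 𝔭, ∀ q, ∀ r, r * u ∈ J ⊔ Id (z q) δ → b * r ∈ 𝔭 ⊔ Id (z q) δ := by
  let f := Ideal.Quotient.mk J
  have hJ : J ≤ 𝔭 := h𝔭.1.2
  have h𝔭' : 𝔭.IsPrime := h𝔭.1.1
  let 𝔮 : Ideal (R ⧸ J) := 𝔭.map f
  have hmem : ∀ r, f r ∈ 𝔮 ↔ r ∈ 𝔭 := by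
    intro r
    rw [← Ideal.mem_comap, Ideal.comap_map_of_surjective' _ Ideal.Quotient.mk_surjective,
      Ideal.mk_ker, sup_eq_left.mpr hJ]
  have h𝔮 : 𝔮 ∈ minimalPrimes (R ⧸ J) := by
    refine ⟨⟨Ideal.map_isPrime_of_surjective Ideal.Quotient.mk_surjective (by rwa [Ideal.mk_ker]),
      bot_le⟩, ?_⟩
    rintro Q ⟨hQ, -⟩ hQ𝔮
    have h1 : Q.comap f ≤ 𝔭 := fun r hr => (hmem r).mp (hQ𝔮 hr)
    have h2 : J ≤ Q.comap f := fun r hr => by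
      rw [Ideal.mem_comap, Ideal.Quotient.eq_zero_iff_mem.mpr hr]; exact Q.zero_mem
    have := h𝔭.2 ⟨hQ.comap f, h2⟩ h1
    exact Ideal.map_le_iff_le_comap.mpr this
  have hu' : ∀ r, r ∈ 𝔮 ↔ r * f u = 0 := by
    intro r
    obtain ⟨r, rfl⟩ := Ideal.Quotient.mk_surjective r
    rw [hmem, hu, ← map_mul, Ideal.Quotient.eq_zero_iff_mem]
  have hreg : ∀ q, RegSeq (fun i => f (z q i)) δ := by
    intro q i hi r hr
    obtain ⟨r, rfl⟩ := Ideal.Quotient.mk_surjective r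
    rw [← map_mul] at hr
    exact mem_Id_mk.mpr (hz q i hi r (mem_Id_mk.mp hr))
  constructor
  · have key : ∀ i : Fin δ, ∃ a ∉ 𝔮, ∀ q, Kills (fun j : Fin (i.1 + 1) => f (z q j)) 𝔮 1 a :=
      fun i => exists_kills_prime _ (fun q => acyclic_of_regSeq (fun j hj => hreg q j (by omega)))
        h𝔮 hu' Nat.one_pos
    choose a ha hak using key
    have h𝔮p : 𝔮.IsPrime := h𝔮.1.1
    choose a' ha' using fun i => Ideal.Quotient.mk_surjective (a i)
    refine ⟨∏ i, a' i, ?_, fun q i hi r hr => ?_⟩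
    · rw [Ideal.IsPrime.prod_mem_iff]
      rintro ⟨i, -, hi⟩
      exact ha i (by rw [← ha' i]; exact (hmem _).mpr hi)
    · have h1 : f (z q i) * f r ∈ 𝔮 ⊔ Id (fun i => f (z q i)) i := by
        rw [← Id_map, ← Ideal.map_sup, ← map_mul]
        exact Ideal.mem_map_of_mem f hr
      have h2 := (hak ⟨i, hi⟩ q).colon h1
      rw [← ha' ⟨i, hi⟩, ← map_mul, ← Id_map, ← Ideal.map_sup, ← Ideal.mem_comap,
        Ideal.comap_map_of_surjective' _ Ideal.Quotient.mk_surjective, Ideal.mk_ker,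
        sup_eq_left.mpr (hJ.trans le_sup_left)] at h2
      rw [← Finset.prod_erase_mul _ _ (Finset.mem_univ (⟨i, hi⟩ : Fin δ)), mul_assoc]
      exact Ideal.mul_mem_left _ _ h2
  · obtain ⟨b, hb, hbk⟩ := kills_of_prime (fun q (j : Fin δ) => f (z q j)) h𝔮 Nat.one_pos
      (exists_kills_prime _ (fun q => acyclic_of_regSeq (hreg q)) h𝔮 hu' Nat.one_pos)
      (Ideal.span {f u})
    obtain ⟨b, rfl⟩ := Ideal.Quotient.mk_surjective b
    refine ⟨b, fun h => hb ((hmem b).mpr h), fun q r hr => ?_⟩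
    obtain ⟨s, hs, hs'⟩ := Kills.mul_mem (w := fun i => f (z q i)) (k := δ) (r := f r) (u := f u)
      (hbk q) (by rw [← map_mul]; exact mem_Id_mk.mpr hr)
    obtain ⟨s, rfl⟩ := Ideal.Quotient.mk_surjective s
    have h1 := mem_Id_mk.mp hs
    have h2 : b * r - s ∈ 𝔭 := by
      rw [← hmem, hu']; simpa using hs'
    have h3 : s ∈ 𝔭 ⊔ Id (z q) δ := (sup_le_sup_right hJ (Id (z q) δ)) h1
    rw [show b * r = (b * r - s) + s by ring]
    exact Ideal.add_mem _ (Ideal.mem_sup_left h2) h3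
end

section
variable {R : Type*} [CommRing R] [IsLocalRing R] {V : Type*} [AddCommGroup V] [Module R V]

lemma length_quotient_eq_add_one {N : Submodule R V} {t : V} (ht : t ∉ N)
    (hm : ∀ r ∈ maximalIdeal R, r • t ∈ N) :
    Module.length R (V ⧸ N) = Module.length R (V ⧸ (N ⊔ R ∙ t)) + 1 := by
  let f : (R ⧸ maximalIdeal R) →ₗ[R] (V ⧸ N) :=
    Submodule.liftQ (maximalIdeal R) (LinearMap.toSpanSingleton R (V ⧸ N) (N.mkQ t)) (by
      intro r hr
      rw [LinearMap.mem_ker, LinearMap.toSpanSingleton_apply, ← map_smul, Submodule.mkQ_apply,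
        Submodule.Quotient.mk_eq_zero]
      exact hm r hr)
  let g : (V ⧸ N) →ₗ[R] (V ⧸ (N ⊔ R ∙ t)) := Submodule.factor le_sup_left
  have hfm : ∀ r : R, f (Submodule.Quotient.mk r) = N.mkQ (r • t) := by
    intro r
    rw [map_smul]
    rfl
  have hf : Function.Injective f := by
    rw [← LinearMap.ker_eq_bot, LinearMap.ker_eq_bot']
    intro x hx
    obtain ⟨r, rfl⟩ := Submodule.Quotient.mk_surjective _ x
    rw [hfm, Submodule.mkQ_apply, Submodule.Quotient.mk_eq_zero] at hx
    rw [Submodule.Quotient.mk_eq_zero]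
    by_contra hr
    have hu : IsUnit r := by simpa using hr
    obtain ⟨s, hs⟩ := hu.exists_left_inv
    exact ht (by simpa [smul_smul, hs] using N.smul_mem s hx)
  have hg : Function.Surjective g := Submodule.factor_surjective _
  have hfg : Function.Exact f g := by
    intro x
    obtain ⟨v, rfl⟩ := N.mkQ_surjective x
    have : g (N.mkQ v) = (N ⊔ R ∙ t).mkQ v := rfl
    rw [this, Submodule.mkQ_apply, Submodule.Quotient.mk_eq_zero]
    constructor
    · intro h
      obtain ⟨a, ha, b, hb, rfl⟩ := Submodule.mem_sup.mp h
      obtain ⟨r, rfl⟩ := Submodule.mem_span_singleton.mp hb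
      refine ⟨Submodule.Quotient.mk r, ?_⟩
      have h0 : N.mkQ a = 0 := by rwa [Submodule.mkQ_apply, Submodule.Quotient.mk_eq_zero]
      rw [hfm, map_add, h0, zero_add]
    · rintro ⟨y, hy⟩
      obtain ⟨r, rfl⟩ := Submodule.Quotient.mk_surjective _ y
      rw [hfm] at hy
      have : r • t - v ∈ N := by
        rw [← Submodule.Quotient.mk_eq_zero, Submodule.Quotient.mk_sub]
        exact sub_eq_zero.mpr hy
      have h2 := Submodule.sub_mem (N ⊔ R ∙ t)
        (Submodule.mem_sup_right (Submodule.smul_mem _ r (Submodule.mem_span_singleton_self t)))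
        (Submodule.mem_sup_left this)
      simpa using h2
  rw [Module.length_eq_add_of_exact f g hf hg hfg, add_comm]
  congr 1
  rw [Module.length_eq_one_iff]
  exact isSimpleModule_iff_isCoatom.mpr (maximalIdeal.isMaximal R).out

lemma length_quotient_mono {N N' : Submodule R V} (h : N ≤ N') :
    Module.length R (V ⧸ N') ≤ Module.length R (V ⧸ N) :=
  Module.length_le_of_surjective (Submodule.factor h) (Submodule.factor_surjective h)

/-- Between two distinct submodules there is an element killed by the maximal ideal modulo the
smaller one, provided a power of the maximal ideal kills the quotient. -/
lemma exists_socle {N N' : Submodule R V} (h : ¬ N' ≤ N) {k : ℕ}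
    (hk : ∀ r ∈ maximalIdeal R ^ k, ∀ v ∈ N', r • v ∈ N) :
    ∃ t ∈ N', t ∉ N ∧ ∀ r ∈ maximalIdeal R, r • t ∈ N := by
  induction k with
  | zero =>
    exact absurd (fun v hv => by simpa using hk 1 (by simp) v hv) h
  | succ k ih =>
    by_cases hk' : ∀ r ∈ maximalIdeal R ^ k, ∀ v ∈ N', r • v ∈ N
    · exact ih hk'
    · push Not at hk'
      obtain ⟨r, hr, v, hv, hrv⟩ := hk'
      refine ⟨r • v, N'.smul_mem r hv, hrv, fun s hs => ?_⟩
      rw [smul_smul]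
      exact hk _ (by rw [pow_succ']; exact Ideal.mul_mem_mul hs hr) v hv

lemma length_quotient_ne_top [IsNoetherian R V] {k : ℕ} (N : Submodule R V)
    (hk : ∀ r ∈ maximalIdeal R ^ k, ∀ v : V, r • v ∈ N) : Module.length R (V ⧸ N) ≠ ⊤ := by
  induction N using WellFoundedGT.induction with
  | ind N ih =>
  by_cases hN : N = ⊤
  · subst hN
    rw [Module.length_eq_zero]; simp
  obtain ⟨t, -, ht, htm⟩ := exists_socle (N' := ⊤) (fun h => hN (top_le_iff.mp h))
    (fun r hr v _ => hk r hr v)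
  rw [length_quotient_eq_add_one ht htm]
  have := ih (N ⊔ R ∙ t) (by
      refine lt_of_le_of_ne le_sup_left fun h => ht ?_
      rw [h]; exact Submodule.mem_sup_right (Submodule.mem_span_singleton_self t))
    (fun r hr v => Submodule.mem_sup_left (hk r hr v))
  exact WithTop.add_ne_top.mpr ⟨this, ENat.one_ne_top⟩

end
section
variable {R : Type*} [CommRing R] [IsLocalRing R] [IsNoetherianRing R] {ι : Type*} [Fintype ι]

/-- The submodule of vectors with entries in `K`. -/
def piIdeal (ι : Type*) (K : Ideal R) : Submodule R (ι → R) := Submodule.pi Set.univ fun _ => K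

lemma mem_piIdeal {K : Ideal R} {u : ι → R} : u ∈ piIdeal ι K ↔ ∀ t, u t ∈ K := by
  simp [piIdeal]

/-- The orthogonal of a submodule for the dot product with values in `R ⧸ K`. -/
def perp (K : Ideal R) (N : Submodule R (ι → R)) : Submodule R (ι → R) where
  carrier := {A | ∀ u ∈ N, A ⬝ᵥ u ∈ K}
  add_mem' ha hb u hu := by rw [add_dotProduct]; exact K.add_mem (ha u hu) (hb u hu)
  zero_mem' u _ := by simp
  smul_mem' r A hA u hu := by rw [smul_dotProduct]; exact K.mul_mem_left r (hA u hu)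

lemma mem_perp {K : Ideal R} {N : Submodule R (ι → R)} {A : ι → R} :
    A ∈ perp K N ↔ ∀ u ∈ N, A ⬝ᵥ u ∈ K := Iff.rfl

lemma perp_anti {K : Ideal R} {N N' : Submodule R (ι → R)} (h : N ≤ N') : perp K N' ≤ perp K N :=
  fun _ hA u hu => hA u (h hu)

lemma perp_top {K : Ideal R} : perp K (⊤ : Submodule R (ι → R)) = piIdeal ι K := by
  classical
  ext A
  rw [mem_perp, mem_piIdeal]
  refine ⟨fun h t => by simpa using h (Pi.single t 1) trivial, fun h u _ => ?_⟩
  exact K.sum_mem fun t _ => K.mul_mem_right _ (h t)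

lemma perp_piIdeal {K : Ideal R} : perp K (piIdeal ι K) = ⊤ := by
  refine top_le_iff.mp fun A _ u hu => ?_
  exact K.sum_mem fun t _ => K.mul_mem_left _ (mem_piIdeal.mp hu t)

variable {K : Ideal R} {k : ℕ} {e : R} (hk : maximalIdeal R ^ k ≤ K)
  (he : ∀ v, (∀ r ∈ maximalIdeal R, r * v ∈ K) → ∃ r, v - r * e ∈ K)
  (hme : ∀ r ∈ maximalIdeal R, r * e ∈ K)

include he hme in
lemma length_perp_le {N : Submodule R (ι → R)} {t : ι → R}
    (htm : ∀ r ∈ maximalIdeal R, r • t ∈ N) :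
    Module.length R ((ι → R) ⧸ perp K (N ⊔ R ∙ t)) ≤
      Module.length R ((ι → R) ⧸ perp K N) + 1 := by
  have hmem : ∀ A, A ∈ perp K (N ⊔ R ∙ t) ↔ A ∈ perp K N ∧ A ⬝ᵥ t ∈ K := by
    intro A
    constructor
    · exact fun h => ⟨perp_anti le_sup_left h,
        h t (Submodule.mem_sup_right (Submodule.mem_span_singleton_self t))⟩
    · rintro ⟨h1, h2⟩ u hu
      obtain ⟨a, ha, b, hb, rfl⟩ := Submodule.mem_sup.mp hu
      obtain ⟨r, rfl⟩ := Submodule.mem_span_singleton.mp hb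
      rw [dotProduct_add, dotProduct_smul]
      exact K.add_mem (h1 a ha) (K.mul_mem_left r h2)
  have hval : ∀ A ∈ perp K N, ∃ r, A ⬝ᵥ t - r * e ∈ K := by
    intro A hA
    refine he _ fun r hr => ?_
    have := hA _ (htm r hr)
    rwa [dotProduct_smul] at this
  by_cases h : perp K N ≤ perp K (N ⊔ R ∙ t)
  · exact (length_quotient_mono h).trans le_self_add
  obtain ⟨A₀, hA₀, hA₀'⟩ := SetLike.not_le_iff_exists.mp h
  obtain ⟨r₀, hr₀⟩ := hval A₀ hA₀
  have hA₀K : A₀ ⬝ᵥ t ∉ K := fun h => hA₀' ((hmem _).mpr ⟨hA₀, h⟩)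
  have hr₀u : IsUnit r₀ := by
    by_contra hn
    exact hA₀K (by simpa using K.add_mem hr₀ (hme r₀ hn))
  obtain ⟨s₀, hs₀⟩ := hr₀u.exists_left_inv
  have hsup : perp K (N ⊔ R ∙ t) ⊔ R ∙ A₀ = perp K N := by
    refine le_antisymm (sup_le (perp_anti le_sup_left) ?_) fun A hA => ?_
    · rwa [Submodule.span_singleton_le_iff_mem]
    · obtain ⟨r, hr⟩ := hval A hA
      have h1 : A - (r * s₀) • A₀ ∈ perp K (N ⊔ R ∙ t) := by
        rw [hmem]
        refine ⟨Submodule.sub_mem _ hA (Submodule.smul_mem _ _ hA₀), ?_⟩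
        rw [sub_dotProduct, smul_dotProduct, smul_eq_mul]
        have := K.sub_mem hr (K.mul_mem_left (r * s₀) hr₀)
        convert this using 1
        linear_combination -(r * e) * hs₀
      rw [show A = (A - (r * s₀) • A₀) + (r * s₀) • A₀ by simp]
      exact Submodule.add_mem _ (Submodule.mem_sup_left h1)
        (Submodule.mem_sup_right (Submodule.smul_mem _ _ (Submodule.mem_span_singleton_self _)))
  rw [length_quotient_eq_add_one hA₀', hsup]
  intro r hr
  rw [hmem]
  refine ⟨Submodule.smul_mem _ _ hA₀, ?_⟩
  rw [smul_dotProduct, smul_eq_mul]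
  have := K.add_mem (K.mul_mem_left r hr₀) (K.mul_mem_left r₀ (hme r hr))
  convert this using 1; ring

include hk he hme in
lemma length_perp_add_le {N N' : Submodule R (ι → R)} (hK : piIdeal ι K ≤ N) (h : N ≤ N') :
    Module.length R ((ι → R) ⧸ perp K N') + Module.length R ((ι → R) ⧸ N') ≤
      Module.length R ((ι → R) ⧸ perp K N) + Module.length R ((ι → R) ⧸ N) := by
  induction N using WellFoundedGT.induction with
  | ind N ih =>
  by_cases hN : N' ≤ N
  · rw [le_antisymm h hN]
  obtain ⟨t, htN', ht, htm⟩ := exists_socle (k := k) hN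
    (fun r hr v _ => hK (mem_piIdeal.mpr fun i => K.mul_mem_right _ (hk hr)))
  refine (ih (N ⊔ R ∙ t) ?_ (hK.trans le_sup_left) (sup_le h ?_)).trans ?_
  · refine lt_of_le_of_ne le_sup_left fun h => ht ?_
    rw [h]; exact Submodule.mem_sup_right (Submodule.mem_span_singleton_self t)
  · rwa [Submodule.span_singleton_le_iff_mem]
  · rw [length_quotient_eq_add_one ht htm]
    calc _ ≤ _ := add_le_add_left (length_perp_le he hme htm) _
      _ = _ := by ring

include hk he hme in
/-- Self-injectivity of an Artinian local ring with simple socle, in the form of a perfect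
pairing on finite free modules. -/
theorem exists_mem_perp {N : Submodule R (ι → R)} (hK : piIdeal ι K ≤ N) {ζ : ι → R}
    (hζ : ζ ∉ N) : ∃ A, (∀ u ∈ N, A ⬝ᵥ u ∈ K) ∧ A ⬝ᵥ ζ ∉ K := by
  by_contra hcon
  push Not at hcon
  have hperp : perp K (N ⊔ R ∙ ζ) = perp K N := by
    refine le_antisymm (perp_anti le_sup_left) fun A hA u hu => ?_
    obtain ⟨a, ha, b, hb, rfl⟩ := Submodule.mem_sup.mp hu
    obtain ⟨r, rfl⟩ := Submodule.mem_span_singleton.mp hb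
    rw [dotProduct_add, dotProduct_smul]
    exact K.add_mem (hA a ha) (K.mul_mem_left r (hcon A hA))
  have hpow : ∀ {M : Submodule R (ι → R)}, piIdeal ι K ≤ M →
      ∀ r ∈ maximalIdeal R ^ k, ∀ v : ι → R, r • v ∈ M := fun hM r hr v =>
    hM (mem_piIdeal.mpr fun i => K.mul_mem_right _ (hk hr))
  have h1 := length_perp_add_le hk he hme le_rfl hK
  have h2 := length_perp_add_le hk he hme (hK.trans le_sup_left) (le_top : N ⊔ R ∙ ζ ≤ ⊤)
  rw [perp_piIdeal] at h1
  rw [perp_top, hperp, add_comm (Module.length R (_ ⧸ piIdeal ι K))] at h2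
  have h3 := h1.trans h2
  have hfin := length_quotient_ne_top (k := k) (perp K N) (hpow (by
    rw [← perp_top]; exact perp_anti le_top))
  have h4 := (ENat.add_le_add_iff_left hfin).mp h3
  obtain ⟨t, htN', ht, htm⟩ := exists_socle (N := N) (N' := N ⊔ R ∙ ζ) (k := k) (fun h => hζ
    (h (Submodule.mem_sup_right (Submodule.mem_span_singleton_self ζ))))
    (fun r hr v _ => hpow hK r hr v)
  rw [length_quotient_eq_add_one ht htm] at h4
  have h5 : Module.length R ((ι → R) ⧸ (N ⊔ R ∙ ζ)) ≤ Module.length R ((ι → R) ⧸ (N ⊔ R ∙ t)) :=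
    length_quotient_mono (sup_le le_sup_left (by rwa [Submodule.span_singleton_le_iff_mem]))
  have hfin' := length_quotient_ne_top (k := k) (N ⊔ R ∙ t) (hpow (hK.trans le_sup_left))
  have h6 := h4.trans h5
  generalize Module.length R ((ι → R) ⧸ (N ⊔ R ∙ t)) = L at *
  lift L to ℕ using hfin'
  norm_cast at h6
  omega

include hk he hme in
/-- The double annihilator property. -/
theorem mem_of_double_ann {𝔞 : Ideal R} (hK : K ≤ 𝔞) {v : R}
    (h : ∀ r, (∀ a ∈ 𝔞, r * a ∈ K) → r * v ∈ K) : v ∈ 𝔞 := by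
  by_contra hv
  obtain ⟨A, hA, hA'⟩ := exists_mem_perp (ι := Unit) hk he hme (N := piIdeal Unit 𝔞)
    (ζ := fun _ => v) (fun u hu => mem_piIdeal.mpr fun t => hK (mem_piIdeal.mp hu t))
    (fun h => hv (mem_piIdeal.mp h ()))
  refine hA' ?_
  have := h (A ()) (fun a ha => by
    simpa [dotProduct] using hA (fun _ => a) (mem_piIdeal.mpr fun _ => ha))
  simpa [dotProduct] using this
end

section
variable {R : Type u} [CommRing R] [IsLocalRing R] [IsNoetherianRing R] {n : ℕ} {y : ℕ → R}

lemma RegPar.regular_of_ne (hy : RegPar y n) {w : ℕ → R} (hwm : ∀ j < n, w j ∈ maximalIdeal R)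
    {N : ℕ} (hN : maximalIdeal R ^ N ≤ Id w n) {j : ℕ} (hj : j < n) {r : R}
    (hr : w j * r ∈ Ideal.span (w '' {i | i < n ∧ i ≠ j})) :
    r ∈ Ideal.span (w '' {i | i < n ∧ i ≠ j}) := by
  let σ := Equiv.swap j (n - 1)
  have hσ : ∀ i < n, σ i < n := by
    intro i hi
    simp only [σ, Equiv.swap_apply_def]
    split_ifs <;> omega
  have h1 : Id (w ∘ σ) n = Id w n := by
    refine le_antisymm (Id_le fun i hi => mem_Id (hσ i hi)) (Id_le fun i hi => ?_)
    have := mem_Id (w := w ∘ σ) (hσ i hi)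
    simpa [σ] using this
  have h2 : Id (w ∘ σ) (n - 1) = Ideal.span (w '' {i | i < n ∧ i ≠ j}) := by
    refine le_antisymm (Id_le fun i hi => Ideal.subset_span ⟨σ i, ⟨hσ i (by omega), ?_⟩, rfl⟩)
      (Ideal.span_le.mpr ?_)
    · intro h
      have h' : i = n - 1 := by
        have := congrArg σ h
        simpa [σ] using this
      omega
    · rintro _ ⟨i, ⟨hi, hij⟩, rfl⟩
      have h3 : σ i < n - 1 := by
        have := hσ i hi
        refine lt_of_le_of_ne (by omega) fun h => hij ?_
        have := congrArg σ h
        simpa [σ] using this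
      have := mem_Id (w := w ∘ σ) h3
      simpa [σ] using this
  have h3 := hy.regSeq_of_pow_le (w := w ∘ σ) (fun i hi => hwm _ (hσ i hi)) (h1 ▸ hN) (n - 1)
    (by omega) r
  rw [h2] at h3
  exact h3 (by simpa [σ] using hr)

lemma exists_notMem_sup_pow {V : Type*} [AddCommGroup V] [Module R V] [Module.Finite R V]
    {N : Submodule R V} {ζ : V} (hζ : ζ ∉ N) :
    ∃ k, ζ ∉ N ⊔ maximalIdeal R ^ k • (⊤ : Submodule R V) := by
  by_contra hcon
  push Not at hcon
  have h := Ideal.iInf_pow_smul_eq_bot_of_isLocalRing (M := V ⧸ N) (maximalIdeal R)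
    (maximalIdeal.isMaximal R).ne_top
  have h1 : N.mkQ ζ ∈ (⨅ i : ℕ, maximalIdeal R ^ i • ⊤ : Submodule R (V ⧸ N)) := by
    rw [Submodule.mem_iInf]
    intro i
    obtain ⟨a, ha, b, hb, hab⟩ := Submodule.mem_sup.mp (hcon i)
    have : N.mkQ ζ = N.mkQ b := by
      rw [← hab, map_add, Submodule.mkQ_apply N a, (Submodule.Quotient.mk_eq_zero N).mpr ha,
        zero_add]
    rw [this]
    have := Submodule.mem_map_of_mem (f := N.mkQ) hb
    rw [Submodule.map_smul''] at this
    exact Submodule.smul_mono le_rfl le_top this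
  rw [h, Submodule.mem_bot, Submodule.mkQ_apply, Submodule.Quotient.mk_eq_zero] at h1
  exact hζ h1

lemma exists_artinRees {M : Type*} [AddCommGroup M] [Module R M] [Module.Finite R M]
    (φ : R →ₗ[R] M) (I : Ideal R) (N₀ : ℕ) :
    ∃ T₀, ∀ T ≥ T₀, ∀ r, φ r ∈ I ^ T • (⊤ : Submodule R M) → ∃ r' ∈ I ^ N₀, φ r = φ r' := by
  obtain ⟨k, hk⟩ := Ideal.exists_pow_inf_eq_pow_smul I (LinearMap.range φ)
  refine ⟨k + N₀, fun T hT r hr => ?_⟩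
  have h1 : φ r ∈ I ^ T • (⊤ : Submodule R M) ⊓ LinearMap.range φ := ⟨hr, r, rfl⟩
  rw [hk T (by omega)] at h1
  have h2 : φ r ∈ I ^ N₀ • LinearMap.range φ :=
    (Submodule.smul_mono (Ideal.pow_le_pow_right (by omega)) inf_le_right) h1
  rw [LinearMap.range_eq_map, ← Submodule.map_smul''] at h2
  obtain ⟨r', hr', h⟩ := h2
  exact ⟨r', by simpa using hr', h.symm⟩

/-- Artin–Rees for colon ideals. -/
lemma exists_colon_le {J 𝔭 I : Ideal R} (hI : ∀ r, r ∈ I ↔ ∀ p ∈ 𝔭, r * p ∈ J) (N₀ : ℕ) :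
    ∃ T₀, ∀ T ≥ T₀, ∀ r, (∀ p ∈ 𝔭, r * p ∈ J ⊔ maximalIdeal R ^ T) →
      r ∈ I ⊔ maximalIdeal R ^ N₀ := by
  obtain ⟨m, q, hq⟩ := (Submodule.fg_iff_exists_fin_generating_family).mp
    (IsNoetherian.noetherian 𝔭)
  let φ : R →ₗ[R] (Fin m → R ⧸ J) :=
    LinearMap.pi fun l => J.mkQ ∘ₗ LinearMap.mulRight R (q l)
  have hφ : ∀ r l, φ r l = Ideal.Quotient.mk J (r * q l) := fun r l => rfl
  obtain ⟨T₀, hT₀⟩ := exists_artinRees φ (maximalIdeal R) N₀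
  refine ⟨T₀, fun T hT r hr => ?_⟩
  obtain ⟨r', hr', h⟩ := hT₀ T hT r (by
    have h1 : ∀ l, φ r l ∈ (maximalIdeal R ^ T • ⊤ : Submodule R (R ⧸ J)) := by
      intro l
      rw [hφ]
      obtain ⟨a, ha, b, hb, hab⟩ := Submodule.mem_sup.mp
        (hr (q l) (by rw [← hq]; exact Submodule.subset_span ⟨l, rfl⟩))
      rw [← hab, map_add, Ideal.Quotient.eq_zero_iff_mem.mpr ha, zero_add]
      have := Submodule.smul_mem_smul hb (Submodule.mem_top (x := (1 : R ⧸ J)))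
      rwa [Algebra.smul_def, mul_one] at this
    rw [← Finset.univ_sum_single (φ r)]
    refine Submodule.sum_mem _ fun l _ => ?_
    have h2 := Submodule.mem_map_of_mem (f := LinearMap.single R (fun _ : Fin m => R ⧸ J) l) (h1 l)
    rw [Submodule.map_smul''] at h2
    exact Submodule.smul_mono le_rfl le_top h2)
  refine Submodule.mem_sup.mpr ⟨r - r', ?_, r', hr', by ring⟩
  rw [hI]
  intro p hp
  rw [← hq] at hp
  induction hp using Submodule.span_induction with
  | mem p hp =>
    obtain ⟨l, rfl⟩ := hp
    rw [← Ideal.Quotient.eq_zero_iff_mem, ← hφ, map_sub, h, sub_self]; rfl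
  | zero => simp
  | add p p' _ _ h1 h2 => rw [mul_add]; exact J.add_mem h1 h2
  | smul c p _ h1 => rw [smul_eq_mul, mul_left_comm]; exact J.mul_mem_left _ h1
end

section
variable {R : Type*} [CommRing R] {n : ℕ}

lemma pair_eq (A u : KV n R) : pair A u = A ⬝ᵥ u := rfl

lemma In.pair_left {K : Ideal R} {A : KV n R} (hA : In K A) (u : KV n R) : pair A u ∈ K :=
  K.sum_mem fun T _ => K.mul_mem_right _ (hA T)

lemma In.pair_right {K : Ideal R} {u : KV n R} (hu : In K u) (A : KV n R) : pair A u ∈ K :=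
  K.sum_mem fun T _ => K.mul_mem_left _ (hu T)

lemma Id_add (w : ℕ → R) (d i : ℕ) : Id w (d + i) = Id w d ⊔ Id (fun j => w (d + j)) i := by
  induction i with
  | zero => simp [Id_zero]
  | succ i ih => rw [← add_assoc, Id_succ, Id_succ, ih, sup_assoc]

lemma exists_pow_le_of_pow_mem [IsNoetherianRing R] {w : ℕ → R} {m L : Ideal R} {N : ℕ}
    (hN : m ^ N ≤ Id w n) (h : ∀ j < n, ∃ t, w j ^ t ∈ L) : ∃ N', m ^ N' ≤ L := by
  have h1 : Id w n ≤ L.radical := Id_le fun j hj => h j hj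
  obtain ⟨k, hk⟩ := Ideal.exists_pow_le_of_le_radical_of_fg h1 (IsNoetherian.noetherian _)
  exact ⟨N * k, by rw [pow_mul]; exact (Ideal.pow_right_mono hN k).trans hk⟩

/-- Successive division of a cocycle along a regular sequence. -/
lemma exists_descent {Y : Fin n → R} {J : Ideal R} {z : ℕ → R} {δ : ℕ}
    (hz : ∀ i < δ, ∀ r, z i * r ∈ J ⊔ Id z i → r ∈ J ⊔ Id z i) {A₁ : KV n R}
    (hA : In (J ⊔ Id z δ) (wedge Y A₁)) :
    ∃ A : ℕ → KV n R, A δ = A₁ ∧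
      ∀ i < δ, In (J ⊔ Id z i) (wedge Y (A (i + 1)) - z i • A i) := by
  suffices h : ∀ k ≤ δ, ∃ A : ℕ → KV n R, A δ = A₁ ∧
      (∀ i, δ - k ≤ i → i < δ → In (J ⊔ Id z i) (wedge Y (A (i + 1)) - z i • A i)) ∧
      In (J ⊔ Id z (δ - k)) (wedge Y (A (δ - k))) by
    obtain ⟨A, h1, h2, -⟩ := h δ le_rfl
    exact ⟨A, h1, fun i hi => h2 i (by omega) hi⟩
  intro k hk
  induction k with
  | zero => exact ⟨fun _ => A₁, rfl, fun i h1 h2 => absurd h1 (by omega), hA⟩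
  | succ k ih =>
    obtain ⟨A, h1, h2, h3⟩ := ih (by omega)
    obtain ⟨i, hi⟩ : ∃ i, δ - k = i + 1 := ⟨δ - k - 1, by omega⟩
    have hi' : δ - (k + 1) = i := by omega
    rw [hi] at h2 h3
    rw [hi']
    have hex : ∀ T, ∃ t, wedge Y (A (i + 1)) T - z i * t ∈ J ⊔ Id z i := by
      intro T
      have := h3 T
      rw [Id_succ, ← sup_assoc] at this
      obtain ⟨a, ha, b, hb, hab⟩ := Submodule.mem_sup.mp this
      obtain ⟨t, rfl⟩ := Ideal.mem_span_singleton'.mp hb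
      exact ⟨t, by rw [← hab]; convert ha using 1; ring⟩
    choose v hv using hex
    have hv' : In (J ⊔ Id z i) (wedge Y (A (i + 1)) - z i • v) := hv
    refine ⟨Function.update A i v, ?_, fun j hj hjδ => ?_, ?_⟩
    · rw [Function.update_of_ne (by omega), h1]
    · rcases hj.eq_or_lt with rfl | hj'
      · rw [Function.update_self, Function.update_of_ne (by omega)]
        exact hv'
      · rw [Function.update_of_ne (by omega), Function.update_of_ne (by omega)]
        exact h2 j (by omega) hjδ
    · rw [Function.update_self]
      intro T
      refine hz i (by omega) _ ?_
      have := (hv'.wedge Y) T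
      rw [map_sub, wedge_self, map_smul] at this
      simpa using this

lemma pair_wedge_sub_mem {Y b : Fin n → R} {L : Ideal R} {z : R} {A A' u : KV n R}
    (hb : z = ∑ j, b j * Y j) (h1 : In L (wedge Y A' - z • A)) (h2 : In L (contr Y u))
    (hz : ∀ r, z * r ∈ L → r ∈ L) : pair A (wedge b u) - pair A' u ∈ L := by
  refine hz _ ?_
  have e1 := h1.pair_left (wedge b u)
  have e2 := (h2.wedge b).pair_right A'
  have e3 : pair (wedge Y A') (wedge b u) = z * pair A' u - pair A' (wedge b (contr Y u)) := by
    rw [pair_wedge, contr_wedge, ← hb, pair_eq, pair_eq, pair_eq, dotProduct_sub,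
      dotProduct_smul, smul_eq_mul]
  rw [pair_eq, sub_dotProduct, smul_dotProduct, ← pair_eq, ← pair_eq, e3, smul_eq_mul] at e1
  have := L.neg_mem (L.add_mem e1 e2)
  convert this using 1
  ring

lemma wp_congr {a b : ℕ → Fin n → R} {k : ℕ} (h : ∀ i < k, a i = b i) : wp a k = wp b k := by
  induction k with
  | zero => rfl
  | succ k ih => rw [wp, wp, ih fun i hi => h i (by omega), h k (by omega)]

end
section
variable {R : Type u} [CommRing R] [IsLocalRing R] [IsNoetherianRing R] {n : ℕ} {y : ℕ → R}

/-- If the canonical element of `R ⧸ 𝔭` vanishes, then this is witnessed by a ladder of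
relations, starting with a coefficient family in `𝔭` and ending with a unit coefficient. -/
theorem exists_ladder (hy : RegPar y n) {w : ℕ → R} (hwm : ∀ j < n, w j ∈ maximalIdeal R)
    {N : ℕ} (hN : maximalIdeal R ^ N ≤ Id w n) {d δ : ℕ} (hd : d + δ = n)
    {a : ℕ → Fin n → R} (ha : Expr (fun j : Fin n => y j) w a d) {𝔭 I : Ideal R}
    (hJ : Id w d ≤ 𝔭) (hI : ∀ r, r ∈ I ↔ ∀ p ∈ 𝔭, r * p ∈ Id w d)
    (hfail : ∀ κ, ¬ In I (wp a d - contr (fun j : Fin n => y j) κ)) :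
    ∃ T, 0 < T ∧ ∃ A : ℕ → KV n R, In 𝔭 (A δ) ∧ (∃ T₀, A 0 T₀ ∉ maximalIdeal R) ∧
      ∀ i < δ, In (Id w d ⊔ Id (fun j => w (d + j) ^ T) i)
        (wedge (fun j : Fin n => y j) (A (i + 1)) - w (d + i) ^ T • A i) := by
  classical
  set Y : Fin n → R := fun j => y j with hY
  set ζ := wp a d with hζdef
  let M : Submodule R (KV n R) := LinearMap.range (contr Y : KV n R →ₗ[R] KV n R) ⊔
    piIdeal (Finset (Fin n)) I
  have hζ : ζ ∉ M := by
    intro h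
    obtain ⟨_, ⟨κ, rfl⟩, v, hv, hκv⟩ := Submodule.mem_sup.mp h
    refine hfail κ ?_
    rw [← hκv, add_sub_cancel_left]
    exact mem_piIdeal.mp hv
  obtain ⟨N₀, hN₀⟩ := exists_notMem_sup_pow hζ
  obtain ⟨T₀, hT₀⟩ := exists_colon_le hI N₀
  let T := T₀ + 1
  refine ⟨T, Nat.succ_pos _, ?_⟩
  set z : ℕ → R := fun j => w (d + j) ^ T with hz
  let wT : ℕ → R := fun j => if j < d then w j else w j ^ T
  have hwT1 : Id wT d = Id w d := Id_congr fun i hi => by simp [wT, hi]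
  have hwT2 : (fun j => wT (d + j)) = z := by ext j; simp [wT, z]
  have hwTm : ∀ j < n, wT j ∈ maximalIdeal R := by
    intro j hj
    simp only [wT]
    split_ifs
    · exact hwm j hj
    · exact Ideal.pow_mem_of_mem _ (hwm j hj) _ (Nat.succ_pos _)
  obtain ⟨N', hN'⟩ := exists_pow_le_of_pow_mem (L := Id wT n) hN (fun j hj => by
    by_cases h : j < d
    · exact ⟨1, by have := mem_Id (w := wT) hj; simpa [wT, h] using this⟩
    · exact ⟨T, by have := mem_Id (w := wT) hj; simpa [wT, h] using this⟩)
  have hregT := hy.regSeq_of_pow_le hwTm hN'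
  have hsplit : ∀ i, Id wT (d + i) = Id w d ⊔ Id z i := fun i => by rw [Id_add, hwT1, hwT2]
  set K := Id wT n with hK
  have hKsplit : K = Id w d ⊔ Id z δ := by rw [hK, ← hd, hsplit]
  have hreg : ∀ i < δ, ∀ r, z i * r ∈ Id w d ⊔ Id z i → r ∈ Id w d ⊔ Id z i := by
    intro i hi r
    rw [← hsplit]
    have := hregT (d + i) (by omega) r
    rwa [show wT (d + i) = z i from congrFun hwT2 i] at this
  have hKm : K ≤ Id w d ⊔ maximalIdeal R ^ T := by
    rw [hKsplit]
    refine sup_le_sup_left (Id_le fun i hi => ?_) _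
    exact Ideal.pow_mem_pow (hwm _ (by omega)) T
  -- the socle of `R ⧸ K`
  obtain ⟨c, hc⟩ := exists_expr hy.span wT
  have hcE : Expr Y wT c n := fun i hi => hc i (hwTm i hi)
  have hYa : Acyclic Y := acyclic_of_regSeq hy.regSeq
  have he : ∀ v, (∀ r ∈ maximalIdeal R, r * v ∈ K) →
      ∃ r, v - r * wp c n Finset.univ ∈ K := fun v hv =>
    socle_of_forall_mul_mem hYa hregT hcE fun j => hv _ (hy.mem j.2)
  have hmem : ∀ {v : R}, (∀ j : Fin n, y j * v ∈ K) → ∀ r ∈ maximalIdeal R, r * v ∈ K := by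
    intro v hv r hr
    rw [← hy.span] at hr
    obtain ⟨s, rfl⟩ := exists_coeff_fin hr
    rw [Finset.sum_mul]
    refine K.sum_mem fun j _ => ?_
    rw [mul_assoc]
    exact K.mul_mem_left _ (hv j)
  have hme : ∀ r ∈ maximalIdeal R, r * wp c n Finset.univ ∈ K :=
    hmem fun j => mul_wp_mem hcE j Finset.univ
  -- a functional detecting the canonical element
  obtain ⟨I', hI'⟩ : ∃ I' : Ideal R, ∀ r, r ∈ I' ↔ ∀ p ∈ 𝔭, r * p ∈ K := by
    refine ⟨K.colon (𝔭 : Set R), fun r => ?_⟩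
    simp [Submodule.mem_colon]
  have hI'le : I' ≤ I ⊔ maximalIdeal R ^ N₀ := fun r hr =>
    hT₀ T (Nat.le_succ _) r fun p hp => hKm ((hI' r).mp hr p hp)
  have hKI' : K ≤ I' := fun r hr => (hI' r).mpr fun p _ => K.mul_mem_right _ hr
  obtain ⟨A₁, hA₁, hA₁ζ⟩ := exists_mem_perp (ι := Finset (Fin n)) hN' he hme
    (N := LinearMap.range (contr Y : KV n R →ₗ[R] KV n R) ⊔ piIdeal _ I') (ζ := ζ)
    (le_sup_of_le_right fun u hu => mem_piIdeal.mpr fun t => hKI' (mem_piIdeal.mp hu t)) (by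
      intro h
      obtain ⟨u, hu, v, hv, huv⟩ := Submodule.mem_sup.mp h
      refine hN₀ ?_
      rw [← huv]
      refine Submodule.add_mem _ (Submodule.mem_sup_left (Submodule.mem_sup_left hu)) ?_
      choose i hi j hj hij using fun t => Submodule.mem_sup.mp (hI'le (mem_piIdeal.mp hv t))
      rw [show v = i + j from funext fun t => (hij t).symm]
      refine Submodule.add_mem _ (Submodule.mem_sup_left (Submodule.mem_sup_right
        (mem_piIdeal.mpr hi))) (Submodule.mem_sup_right ?_)
      rw [← Finset.univ_sum_single j]
      refine Submodule.sum_mem _ fun t _ => ?_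
      rw [show Pi.single t (j t) = j t • Pi.single t (1 : R) by
        rw [← Pi.single_smul, smul_eq_mul, mul_one]]
      exact Submodule.smul_mem_smul (hj t) trivial)
  have hA₁p : ∀ t, A₁ t ∈ 𝔭 ⊔ K := by
    intro t
    refine mem_of_double_ann hN' he hme le_sup_right fun r hr => ?_
    have h1 := hA₁ (Pi.single t r) (Submodule.mem_sup_right (mem_piIdeal.mpr fun s => by
      rw [Pi.single_apply]
      split_ifs
      · exact (hI' r).mpr fun p hp => hr p (Submodule.mem_sup_left hp)
      · exact I'.zero_mem))
    simpa [mul_comm] using h1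
  have hWA₁ : In K (wedge Y A₁) := by
    intro t
    have h1 := hA₁ (contr Y (Pi.single t 1)) (Submodule.mem_sup_left ⟨_, rfl⟩)
    rw [← pair_eq, ← pair_wedge, pair_eq] at h1
    simpa using h1
  choose p hp q hq hpq using fun t => Submodule.mem_sup.mp (hA₁p t)
  have hApq : A₁ = p + q := funext fun t => (hpq t).symm
  have hqK : In K q := hq
  have hWp : In K (wedge Y p) := by
    rw [show p = A₁ - q by rw [hApq]; simp, map_sub]
    exact hWA₁.sub (hqK.wedge Y)
  have hpζ : pair p ζ ∉ K := by
    intro h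
    refine hA₁ζ ?_
    rw [hApq, add_dotProduct]
    exact K.add_mem h (hqK.pair_left ζ)
  rw [hKsplit] at hWp
  obtain ⟨A, hAδ, hA⟩ := exists_descent hreg hWp
  refine ⟨A, by rw [hAδ]; exact hp, ?_, hA⟩
  let wr : ℕ → R := fun j => if j < d then w j else z (n - 1 - j)
  let b : ℕ → Fin n → R := fun j => if j < d then a j else c (d + (n - 1 - j))
  have hwr : ∀ k < δ, wr (d + k) = z (δ - 1 - k) := by
    intro k hk
    simp only [wr]
    rw [if_neg (by omega)]
    congr 1
    omega
  have hwTz : ∀ i, wT (d + i) = z i := fun i => congrFun hwT2 i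
  have hbE : Expr Y wr b n := by
    intro i hi
    by_cases h : i < d
    · simp only [wr, b, if_pos h]
      exact ha i h
    · simp only [wr, b, if_neg h]
      rw [← hwTz]
      exact hcE _ (by omega)
  have hζb : ζ = wp b d := wp_congr fun i hi => by simp [b, hi]
  have hmemT : ∀ {j i}, j < n → j ≠ i → wT j ∈ Ideal.span (wT '' {j | j < n ∧ j ≠ i}) :=
    fun h1 h2 => Ideal.subset_span ⟨_, ⟨h1, h2⟩, rfl⟩
  have hLK : ∀ i, Ideal.span (wT '' {j | j < n ∧ j ≠ i}) ≤ K := by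
    intro i
    refine Ideal.span_le.mpr ?_
    rintro _ ⟨j, hj, rfl⟩
    exact mem_Id hj.1
  have hwd : ∀ {i}, d ≤ i → Id w d ≤ Ideal.span (wT '' {j | j < n ∧ j ≠ i}) := by
    intro i hi
    rw [← hwT1]
    exact Id_le fun j hj => hmemT (by omega) (by omega)
  have claim : ∀ k ≤ δ, pair (A (δ - k)) (wp b (d + k)) ∉ K := by
    intro k hk
    induction k with
    | zero => simpa [hAδ, ← hζb] using hpζ
    | succ k ih =>
      intro h
      refine ih (by omega) ?_
      obtain ⟨i, hi⟩ : ∃ i, δ - k = i + 1 := ⟨δ - k - 1, by omega⟩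
      rw [show δ - (k + 1) = i by omega] at h
      rw [hi]
      have hik : δ - 1 - k = i := by omega
      have hz1 : z i = ∑ j, b (d + k) j * Y j := by
        rw [← hik, ← hwr k (by omega)]
        exact hbE _ (by omega)
      have := pair_wedge_sub_mem (L := Ideal.span (wT '' {j | j < n ∧ j ≠ d + i})) hz1
        ((hA i (by omega)).mono (sup_le (hwd (by omega)) (Id_le fun j hj => by
          rw [← hwTz]
          exact hmemT (by omega) (by omega))))
        ((contr_wp (k := d + k) fun j hj => hbE j (by omega)).mono (Id_le fun j hj => by
          by_cases hjd : j < d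
          · have : wr j = wT j := by simp [wr, wT, hjd]
            rw [this]
            exact hmemT (by omega) (by omega)
          · obtain ⟨l, rfl⟩ : ∃ l, j = d + l := ⟨j - d, by omega⟩
            rw [hwr l (by omega), ← hwTz]
            exact hmemT (by omega) (by omega)))
        (fun r hr => hy.regular_of_ne hwTm hN' (j := d + i) (by omega) (by rwa [hwTz]))
      rw [← add_assoc, wp] at h
      have h2 := K.sub_mem h (hLK _ this)
      rwa [sub_sub_cancel] at h2
  have hfin := claim δ le_rfl
  rw [Nat.sub_self, hd] at hfin
  by_contra hcon
  push Not at hcon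
  refine hfin (K.sum_mem fun t _ => ?_)
  refine hmem (fun j => ?_) _ (hcon t)
  have hwrK : Id wr n ≤ K := Id_le fun j hj => by
    by_cases hjd : j < d
    · have : wr j = wT j := by simp [wr, wT, hjd]
      rw [this]
      exact mem_Id hj
    · obtain ⟨l, rfl⟩ : ∃ l, j = d + l := ⟨j - d, by omega⟩
      rw [hwr l (by omega), ← hwTz]
      exact mem_Id (by omega)
  exact hwrK (mul_wp_mem hbE j t)
end

section
variable {R : Type u} [CommRing R] [IsLocalRing R] [IsNoetherianRing R] {n : ℕ} {y : ℕ → R}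

lemma RegPar.exists_pow_seq (hy : RegPar y n) {w : ℕ → R}
    (hwm : ∀ j < n, w j ∈ maximalIdeal R)
    {N : ℕ} (hN : maximalIdeal R ^ N ≤ Id w n) {d δ : ℕ} (hd : d + δ = n) {T : ℕ} (hT : 0 < T) :
    ∃ wT : ℕ → R, RegSeq wT n ∧ (∀ j < n, wT j ∈ maximalIdeal R) ∧
      (∃ N', maximalIdeal R ^ N' ≤ Id wT n) ∧ (∀ i, wT (d + i) = w (d + i) ^ T) ∧
      ∀ i, Id wT (d + i) = Id w d ⊔ Id (fun j => w (d + j) ^ T) i := by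
  let wT : ℕ → R := fun j => if j < d then w j else w j ^ T
  have hwT1 : Id wT d = Id w d := Id_congr fun i hi => by simp [wT, hi]
  have hwT2 : (fun j => wT (d + j)) = fun j => w (d + j) ^ T := by ext j; simp [wT]
  have hwTm : ∀ j < n, wT j ∈ maximalIdeal R := by
    intro j hj
    simp only [wT]
    split_ifs
    · exact hwm j hj
    · exact Ideal.pow_mem_of_mem _ (hwm j hj) _ hT
  obtain ⟨N', hN'⟩ := exists_pow_le_of_pow_mem (L := Id wT n) hN (fun j hj => by
    by_cases h : j < d
    · exact ⟨1, by have := mem_Id (w := wT) hj; simpa [wT, h] using this⟩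
    · exact ⟨T, by have := mem_Id (w := wT) hj; simpa [wT, h] using this⟩)
  exact ⟨wT, hy.regSeq_of_pow_le hwTm hN', hwTm, ⟨N', hN'⟩, fun i => congrFun hwT2 i,
    fun i => by rw [Id_add, hwT1, hwT2]⟩

lemma RegPar.regular_pow (hy : RegPar y n) {w : ℕ → R} (hwm : ∀ j < n, w j ∈ maximalIdeal R)
    {N : ℕ} (hN : maximalIdeal R ^ N ≤ Id w n) {d δ : ℕ} (hd : d + δ = n) {T : ℕ} (hT : 0 < T)
    (i : ℕ) (hi : i < δ) (r : R)
    (hr : w (d + i) ^ T * r ∈ Id w d ⊔ Id (fun j => w (d + j) ^ T) i) :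
    r ∈ Id w d ⊔ Id (fun j => w (d + j) ^ T) i := by
  obtain ⟨wT, h1, -, -, h2, h3⟩ := hy.exists_pow_seq hwm hN hd hT
  rw [← h3] at hr ⊢
  exact h1 (d + i) (by omega) r (by rwa [h2])

lemma RegPar.exists_socle_gen (hy : RegPar y n) {w : ℕ → R} (hw : RegSeq w n)
    (hwm : ∀ j < n, w j ∈ maximalIdeal R) :
    ∃ e, (∀ v, (∀ r ∈ maximalIdeal R, r * v ∈ Id w n) → ∃ r, v - r * e ∈ Id w n) ∧
      ∀ r ∈ maximalIdeal R, r * e ∈ Id w n := by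
  obtain ⟨c, hc⟩ := exists_expr hy.span w
  have hcE : Expr (fun j : Fin n => y j) w c n := fun i hi => hc i (hwm i hi)
  refine ⟨wp c n Finset.univ, fun v hv => socle_of_forall_mul_mem (acyclic_of_regSeq hy.regSeq) hw
    hcE fun j => hv _ (hy.mem j.2), fun r hr => ?_⟩
  rw [← hy.span] at hr
  obtain ⟨s, rfl⟩ := exists_coeff_fin hr
  rw [Finset.sum_mul]
  refine Ideal.sum_mem _ fun j _ => ?_
  rw [mul_assoc]
  exact Ideal.mul_mem_left _ _ (mul_wp_mem hcE j Finset.univ)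

lemma RegPar.exists_pow_le (hy : RegPar y n) {w : ℕ → R} (hw : RegSeq w n)
    (hwm : ∀ j < n, w j ∈ maximalIdeal R) : ∃ N, maximalIdeal R ^ N ≤ Id w n := by
  refine Ideal.exists_pow_le_of_le_radical_of_fg ?_ (IsNoetherian.noetherian _)
  rw [← Ideal.sInf_minimalPrimes]
  refine le_sInf fun P hP => ?_
  have hP' := AssI.of_mem_minimalPrimes hP
  refine (hy.eq_of_le_of_height hP'.1 (maximalIdeal.isMaximal R).isPrime
    (le_maximalIdeal hP'.1.ne_top) ?_).ge
  rw [hy.assI_height hw hwm hP']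
  exact hy.height_le (maximalIdeal.isMaximal R).isPrime

lemma RegPar.mem_minimalPrimes (hy : RegPar y n) {w : ℕ → R} {d : ℕ} (hw : RegSeq w d)
    (hwm : ∀ j < d, w j ∈ maximalIdeal R) {P : Ideal R} (hP : AssI (Id w d) P) :
    P ∈ (Id w d).minimalPrimes := by
  haveI := hP.1
  obtain ⟨Q, hQ, hQP⟩ := Ideal.exists_minimalPrimes_le hP.le
  have hQ' := AssI.of_mem_minimalPrimes hQ
  rwa [← hy.eq_of_le_of_height hQ'.1 hP.1 hQP
    (by rw [hy.assI_height hw hwm hQ', hy.assI_height hw hwm hP])]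

lemma ringHom_wedge {S : Type*} [CommRing S] (φ : R →+* S) (v : Fin n → R) (u : KV n R)
    (T : Finset (Fin n)) : φ (wedge v u T) = wedge (fun j => φ (v j)) (fun T => φ (u T)) T := by
  simp only [wedge_apply, Finset.sum_apply, Pi.smul_apply, smul_eq_mul, map_sum, map_mul,
    crea_apply]
  refine Finset.sum_congr rfl fun j _ => ?_
  split_ifs <;> simp

lemma wedge_mem {v : Fin n → R} {I : Ideal R} (hv : ∀ j, v j ∈ I) (u : KV n R) :
    In I (wedge v u) := by
  intro T
  rw [wedge_apply, Finset.sum_apply]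
  exact I.sum_mem fun j _ => I.mul_mem_right _ (hv j)

lemma mem_sup_Id_pow {p : ℕ} [Fact p.Prime] {𝔭 : Ideal R} [𝔭.IsPrime] (hp : (p : R) ∈ 𝔭) (e : ℕ) :
    ∃ f : R →+* R ⧸ 𝔭, (∀ r, f r = Ideal.Quotient.mk 𝔭 (r ^ p ^ e)) ∧
      ∀ (z : ℕ → R) (i : ℕ) (r s : R), r ∈ 𝔭 ⊔ Id z i → f r = Ideal.Quotient.mk 𝔭 s →
        s ∈ 𝔭 ⊔ Id (fun j => z j ^ p ^ e) i := by
  have hpz : (p : R ⧸ 𝔭) = 0 := by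
    rw [← map_natCast (Ideal.Quotient.mk 𝔭)]
    exact Ideal.Quotient.eq_zero_iff_mem.mpr hp
  haveI : CharP (R ⧸ 𝔭) p := (CharP.charP_iff_prime_eq_zero Fact.out).mpr hpz
  let f : R →+* R ⧸ 𝔭 := (iterateFrobenius (R ⧸ 𝔭) p e).comp (Ideal.Quotient.mk 𝔭)
  have hf : ∀ r, f r = Ideal.Quotient.mk 𝔭 (r ^ p ^ e) := fun r => by
    simp [f, iterateFrobenius_def]
  refine ⟨f, hf, fun z i r s hr hs => ?_⟩
  have h1 : f r ∈ (𝔭 ⊔ Id (fun j => z j ^ p ^ e) i).map (Ideal.Quotient.mk 𝔭) := by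
    have : 𝔭 ⊔ Id z i ≤ ((𝔭 ⊔ Id (fun j => z j ^ p ^ e) i).map (Ideal.Quotient.mk 𝔭)).comap f := by
      refine sup_le (fun x hx => ?_) (Id_le fun j hj => ?_)
      · rw [Ideal.mem_comap, hf]
        exact Ideal.mem_map_of_mem _ (Ideal.mem_sup_left
          (Ideal.pow_mem_of_mem _ hx _ (pow_pos (Nat.Prime.pos Fact.out) _)))
      · rw [Ideal.mem_comap, hf]
        exact Ideal.mem_map_of_mem _ (Ideal.mem_sup_right (mem_Id (w := fun j => z j ^ p ^ e) hj))
    exact this hr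
  rw [hs, ← Ideal.mem_comap, Ideal.comap_map_of_surjective' _ Ideal.Quotient.mk_surjective,
    Ideal.mk_ker, sup_eq_left.mpr le_sup_left] at h1
  exact h1

/-- In residue characteristic `p`, a ladder as in `exists_ladder` cannot exist. -/
theorem false_of_ladder {p : ℕ} [Fact p.Prime] {J 𝔭 : Ideal R} (h𝔭 : 𝔭 ∈ J.minimalPrimes) {u : R}
    (hu : ∀ r, r ∈ 𝔭 ↔ r * u ∈ J) (hp : (p : R) ∈ 𝔭) {Y : Fin n → R}
    (hY : ∀ j, Y j ∈ maximalIdeal R) {δ : ℕ} {z : ℕ → R}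
    (hz : ∀ q > 0, ∀ i < δ, ∀ r, z i ^ q * r ∈ J ⊔ Id (fun j => z j ^ q) i →
      r ∈ J ⊔ Id (fun j => z j ^ q) i)
    {A : ℕ → KV n R} (hδ : In 𝔭 (A δ)) {T₀ : Finset (Fin n)} (h0 : A 0 T₀ ∉ maximalIdeal R)
    (hA : ∀ i < δ, In (𝔭 ⊔ Id z i) (wedge Y (A (i + 1)) - z i • A i)) : False := by
  haveI h𝔭p : 𝔭.IsPrime := h𝔭.1.1
  have hppos : ∀ e, 0 < p ^ e := fun e => pow_pos (Nat.Prime.pos Fact.out) _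
  obtain ⟨⟨a, ha𝔭, ha⟩, -⟩ := exists_uniform_colon h𝔭 hu (δ := δ)
    (fun (e : ℕ) j => z j ^ p ^ e) fun e => hz _ (hppos e)
  refine ha𝔭 (h𝔭p.mem_of_pow_mem δ ?_)
  -- by Krull's intersection theorem it is enough to work modulo powers of the maximal ideal
  by_contra hcon
  obtain ⟨k, hk⟩ := exists_notMem_sup_pow (N := 𝔭) hcon
  refine hk ?_
  obtain ⟨f, hf, hfid⟩ := mem_sup_Id_pow hp k
  set q := p ^ k with hq
  have hkq : k ≤ q := (Nat.lt_pow_self (Nat.Prime.one_lt Fact.out)).le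
  set Yq : Fin n → R := fun j => Y j ^ q
  set zq : ℕ → R := fun j => z j ^ q
  set Aq : ℕ → KV n R := fun i T => A i T ^ q
  have hAq : ∀ i < δ, In (𝔭 ⊔ Id zq i) (wedge Yq (Aq (i + 1)) - zq i • Aq i) := by
    intro i hi T
    refine hfid z i _ _ (hA i hi T) ?_
    simp only [Pi.sub_apply, Pi.smul_apply, smul_eq_mul, map_sub, map_mul]
    rw [ringHom_wedge, ringHom_wedge]
    simp only [hf]
    rfl
  have claim : ∀ m ≤ δ, ∃ B : KV n R, In (𝔭 ⊔ Id zq (δ - m)) (a ^ m • Aq (δ - m) - wedge Yq B) := by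
    intro m hm
    induction m with
    | zero =>
      refine ⟨0, fun T => Ideal.mem_sup_left ?_⟩
      simp only [map_zero, pow_zero, one_smul, Nat.sub_zero, sub_zero]
      exact Ideal.pow_mem_of_mem _ (hδ T) _ (hppos k)
    | succ m ih =>
      obtain ⟨B, hB⟩ := ih (by omega)
      obtain ⟨i, hi⟩ : ∃ i, δ - m = i + 1 := ⟨δ - m - 1, by omega⟩
      have hi' : δ - (m + 1) = i := by omega
      rw [hi] at hB
      rw [hi']
      have hex : ∀ T, ∃ t, (a ^ m • Aq (i + 1) - wedge Yq B) T - zq i * t ∈ 𝔭 ⊔ Id zq i := by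
        intro T
        have := hB T
        rw [Id_succ, ← sup_assoc] at this
        obtain ⟨x, hx, b, hb, hab⟩ := Submodule.mem_sup.mp this
        obtain ⟨t, rfl⟩ := Ideal.mem_span_singleton'.mp hb
        exact ⟨t, by rw [← hab]; convert hx using 1; ring⟩
      choose C hC using hex
      have hC' : In (𝔭 ⊔ Id zq i) (a ^ m • Aq (i + 1) - wedge Yq B - zq i • C) := hC
      refine ⟨a • C, fun T => ?_⟩
      have h1 := (hC'.wedge Yq) T
      have h2 := ((hAq i (by omega)).smul (a ^ m)) T
      have h3 : zq i * ((a ^ m • Aq i - wedge Yq C) T) ∈ 𝔭 ⊔ Id zq i := by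
        have := Ideal.sub_mem _ h1 h2
        convert this using 1
        simp only [map_sub, map_smul, wedge_self, Pi.sub_apply, Pi.smul_apply, smul_eq_mul,
          Pi.zero_apply]
        ring
      have h4 := ha k i (by omega) _ h3
      convert h4 using 1
      simp only [map_smul, Pi.sub_apply, Pi.smul_apply, smul_eq_mul]
      ring
  obtain ⟨B, hB⟩ := claim δ le_rfl
  have h1 := hB T₀
  rw [Nat.sub_self, Id_zero, sup_bot_eq] at h1
  have hYm : ∀ j, Yq j ∈ maximalIdeal R ^ k := fun j =>
    Ideal.pow_le_pow_right hkq (Ideal.pow_mem_pow (hY j) q)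
  have h2 : a ^ δ * A 0 T₀ ^ q ∈ 𝔭 ⊔ maximalIdeal R ^ k := by
    have h3 : (a ^ δ • Aq 0 - wedge Yq B) T₀ ∈ 𝔭 ⊔ maximalIdeal R ^ k := Ideal.mem_sup_left h1
    have h4 : wedge Yq B T₀ ∈ 𝔭 ⊔ maximalIdeal R ^ k := Ideal.mem_sup_right (wedge_mem hYm B T₀)
    have := Ideal.add_mem _ h3 h4
    simpa [Aq] using this
  have hunit : IsUnit (A 0 T₀ ^ q) := (by simpa using h0 : IsUnit (A 0 T₀)).pow q
  rw [smul_eq_mul, Ideal.mul_top]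
  exact (Ideal.mul_unit_mem_iff_mem _ hunit).mp h2

end

section
variable {R : Type u} [CommRing R] [IsLocalRing R] [IsNoetherianRing R] {n : ℕ} {y : ℕ → R}

lemma exists_notMem_ideal_sup_pow {I : Ideal R} {v : R} (hv : v ∉ I) :
    ∃ k, v ∉ I ⊔ maximalIdeal R ^ k := by
  obtain ⟨k, hk⟩ := exists_notMem_sup_pow hv
  exact ⟨k, by rwa [smul_eq_mul, Ideal.mul_top] at hk⟩

/-- Linkage: an unmixed ideal containing `J` properly contains `J : 𝔭` for an associated prime
`𝔭` of `I ⧸ J`. -/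
theorem RegPar.colon_le (hy : RegPar y n) {w : ℕ → R} {d : ℕ} (hw : RegSeq w d)
    (hwm : ∀ j < d, w j ∈ maximalIdeal R) {I : Ideal R} (hI : ∀ P, AssI I P → P.height = d)
    (hJI : Id w d ≤ I) {u : R} (huI : u ∈ I) {𝔭 : Ideal R} (h𝔭 : 𝔭.IsPrime)
    (hu : ∀ r, r ∈ 𝔭 ↔ r * u ∈ Id w d) {v : R} (hv : ∀ p ∈ 𝔭, v * p ∈ Id w d) : v ∈ I := by
  have h𝔭A : AssI (Id w d) 𝔭 := ⟨h𝔭, u, hu⟩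
  have hht := hy.assI_height hw hwm h𝔭A
  have hdn : d ≤ n := by exact_mod_cast hht.ge.trans (hy.height_le h𝔭)
  obtain ⟨w', hw'w, hw', hw'm⟩ := hy.extend_max hw hwm hdn
  rw [← Id_congr hw'w] at hu hv hJI h𝔭A
  have hw'd := hw'.mono hdn
  have hw'dm : ∀ j < d, w' j ∈ maximalIdeal R := fun j hj => hw'm j (hj.trans_le hdn)
  clear hw'w hw hwm w
  obtain ⟨N, hN⟩ := hy.exists_pow_le hw' hw'm
  obtain ⟨δ, hδ⟩ := Nat.exists_eq_add_of_le hdn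
  obtain ⟨-, b, hb𝔭, hb⟩ := exists_uniform_colon (hy.mem_minimalPrimes hw'd hw'dm h𝔭A) hu (δ := δ)
    (fun (T : ℕ) j => w' (d + j) ^ (T + 1))
    fun T => hy.regular_pow hw'm hN hδ.symm (Nat.succ_pos T)
  have hbv : b * v ∈ I := by
    by_contra hcon
    obtain ⟨T, hT⟩ := exists_notMem_ideal_sup_pow hcon
    refine hT ?_
    obtain ⟨wT, h1, h2, ⟨N', hN'⟩, h3, h4⟩ := hy.exists_pow_seq hw'm hN hδ.symm (Nat.succ_pos T)
    obtain ⟨e, he, hme⟩ := hy.exists_socle_gen h1 h2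
    have hK := h4 δ
    rw [← hδ] at hK
    have key : b * v ∈ Ideal.span {u} ⊔ Id wT n := by
      refine mem_of_double_ann hN' he hme le_sup_right fun r hr => ?_
      have h5 := hr u (Ideal.mem_sup_left (Ideal.mem_span_singleton_self u))
      rw [hK] at h5
      obtain ⟨p, hp, s, hs, hps⟩ := Submodule.mem_sup.mp (hb T r h5)
      rw [hK, show r * (b * v) = b * r * v by ring, ← hps, add_mul, mul_comm p v]
      exact Ideal.add_mem _ (Ideal.mem_sup_left (hv p hp))
        (Ideal.mul_mem_right _ _ (Ideal.mem_sup_right hs))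
    refine (sup_le ?_ ?_ : Ideal.span {u} ⊔ Id wT n ≤ _) key
    · rw [Ideal.span_singleton_le_iff_mem]
      exact Ideal.mem_sup_left huI
    · rw [hK]
      refine sup_le_sup hJI (Id_le fun j hj => ?_)
      exact Ideal.pow_le_pow_right (Nat.le_succ T) (Ideal.pow_mem_pow (hw'm _ (by omega)) _)
  by_contra hvI
  obtain ⟨Q, hQ, hQI⟩ := exists_assI hvI
  have hJQ := hJI.trans hQ.le
  by_cases hQp : 𝔭 ≤ Q
  · have : 𝔭 = Q := hy.eq_of_le_of_height h𝔭 hQ.1 hQp (by rw [hI Q hQ, hht])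
    exact hb𝔭 (this ▸ hQI b hbv)
  · obtain ⟨c, hc, hcQ⟩ := Set.not_subset.mp hQp
    exact hcQ (hQI c (hJI (by rw [mul_comm]; exact hv c hc)))
end

section
variable {R : Type u} [CommRing R] [IsLocalRing R] [IsNoetherianRing R] {n : ℕ} {y : ℕ → R}

theorem RegPar.contr_or_ladder (hy : RegPar y n) {w : ℕ → R} {d : ℕ} (hw : RegSeq w d)
    (hwm : ∀ j < d, w j ∈ maximalIdeal R) {I : Ideal R} (hI : ∀ P, AssI I P → P.height = d)
    (hJI : Id w d ≤ I) {u : R} (huI : u ∈ I) {𝔭 : Ideal R} (h𝔭 : 𝔭.IsPrime)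
    (hu : ∀ r, r ∈ 𝔭 ↔ r * u ∈ Id w d) {a : ℕ → Fin n → R}
    (ha : Expr (fun j : Fin n => y j) w a d) :
    (∃ κ, In I (wp a d - contr (fun j : Fin n => y j) κ)) ∨
    ∃ (w' : ℕ → R) (δ T : ℕ) (A : ℕ → KV n R) (T₀ : Finset (Fin n)),
      (∀ j < d, w' j = w j) ∧ RegSeq w' n ∧ (∀ j < n, w' j ∈ maximalIdeal R) ∧ d + δ = n ∧
      0 < T ∧ In 𝔭 (A δ) ∧ A 0 T₀ ∉ maximalIdeal R ∧
      ∀ i < δ, In (Id w d ⊔ Id (fun j => w' (d + j) ^ T) i)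
        (wedge (fun j : Fin n => y j) (A (i + 1)) - w' (d + i) ^ T • A i) := by
  rw [or_iff_not_imp_left]
  intro hfail
  push Not at hfail
  have hht := hy.assI_height hw hwm ⟨h𝔭, u, hu⟩
  have hdn : d ≤ n := by exact_mod_cast hht.ge.trans (hy.height_le h𝔭)
  obtain ⟨w', hw'w, hw', hw'm⟩ := hy.extend_max hw hwm hdn
  obtain ⟨N, hN⟩ := hy.exists_pow_le hw' hw'm
  obtain ⟨δ, hδ⟩ := Nat.exists_eq_add_of_le hdn
  have hI' : ∀ r, r ∈ (Id w d).colon (𝔭 : Set R) ↔ ∀ p ∈ 𝔭, r * p ∈ Id w d := fun r => by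
    simp [Submodule.mem_colon]
  have hJ𝔭 : Id w d ≤ 𝔭 := fun r hr => (hu r).mpr (Ideal.mul_mem_right _ _ hr)
  have hid := Id_congr hw'w
  rw [← hid] at hI' hJ𝔭
  obtain ⟨T, hT, A, h1, ⟨T₀, h2⟩, h3⟩ := exists_ladder hy hw'm hN hδ.symm (a := a)
    (fun i hi => by rw [hw'w i hi]; exact ha i hi) hJ𝔭 hI' fun κ hκ => hfail κ (hκ.mono fun v hv =>
      hy.colon_le hw hwm hI hJI huI h𝔭 hu (by rw [← hid]; exact (hI' v).mp hv))
  rw [hid] at h3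
  exact ⟨w', δ, T, A, T₀, hw'w, hw', hw'm, hδ.symm, hT, h1, h2, h3⟩

/-- The canonical element conjecture modulo an associated prime, in residue characteristic `p`. -/
theorem RegPar.exists_contr_of_natCast_mem (hy : RegPar y n) {w : ℕ → R} {d : ℕ} (hw : RegSeq w d)
    (hwm : ∀ j < d, w j ∈ maximalIdeal R) {I : Ideal R} (hI : ∀ P, AssI I P → P.height = d)
    (hJI : Id w d ≤ I) {u : R} (huI : u ∈ I) {𝔭 : Ideal R} (h𝔭 : 𝔭.IsPrime)
    (hu : ∀ r, r ∈ 𝔭 ↔ r * u ∈ Id w d) {a : ℕ → Fin n → R}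
    (ha : Expr (fun j : Fin n => y j) w a d) {p : ℕ} [Fact p.Prime] (hp : (p : R) ∈ 𝔭) :
    ∃ κ, In I (wp a d - contr (fun j : Fin n => y j) κ) := by
  refine (hy.contr_or_ladder hw hwm hI hJI huI h𝔭 hu ha).resolve_right ?_
  rintro ⟨w', δ, T, A, T₀, hw'w, hw', hw'm, hδ, hT, h1, h2, h3⟩
  have hid := Id_congr hw'w
  obtain ⟨N, hN⟩ := hy.exists_pow_le hw' hw'm
  have hJ𝔭 : Id w d ≤ 𝔭 := fun r hr => (hu r).mpr (Ideal.mul_mem_right _ _ hr)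
  refine false_of_ladder (hy.mem_minimalPrimes hw hwm ⟨h𝔭, u, hu⟩) hu hp (fun j => hy.mem j.2)
    (z := fun j => w' (d + j) ^ T) (fun q hq i hi r hr => ?_) h1 h2
    fun i hi => (h3 i hi).mono (sup_le_sup_right hJ𝔭 _)
  simp only [← pow_mul, ← hid] at hr ⊢
  exact hy.regular_pow hw'm hN hδ (Nat.mul_pos hT hq) i hi r hr
end

section
variable {R : Type u} [CommRing R]

/-- Hartshorne's connectedness lemma: in depth at least two, two ideals with zero product
cannot have an `m`-primary sum, unless one of them vanishes. -/
lemma eq_bot_or_eq_bot_of_mul {B : Type*} [CommRing B] [IsLocalRing B] {f g : B}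
    (hf : ∀ b, f * b = 0 → b = 0) (hg : ∀ b, g * b ∈ Ideal.span {f} → b ∈ Ideal.span {f})
    {I₁ I₂ : Ideal B} (hmul : ∀ a ∈ I₁, ∀ b ∈ I₂, a * b = 0) {k l : ℕ}
    (hfk : f ^ k ∈ I₁ ⊔ I₂) (hgl : g ^ l ∈ I₁ ⊔ I₂) : I₁ = ⊥ ∨ I₂ = ⊥ := by
  have hfpow : ∀ k b, f ^ k * b = 0 → b = 0 := by
    intro k
    induction k with
    | zero => intro b hb; simpa using hb
    | succ k ih => intro b hb; exact hf b (ih _ (by rw [← hb]; ring))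
  have hgf : ∀ k b c, g * b = f ^ k * c → ∃ t, b = f ^ k * t := by
    intro k
    induction k with
    | zero => intro b c _; exact ⟨b, by simp⟩
    | succ k ih =>
      intro b c hbc
      obtain ⟨b', rfl⟩ := Ideal.mem_span_singleton'.mp (hg b (by
        rw [hbc, pow_succ']
        exact Ideal.mem_span_singleton'.mpr ⟨f ^ k * c, by ring⟩))
      have h1 : g * b' = f ^ k * c := by
        rw [← sub_eq_zero]
        refine hf _ ?_
        linear_combination hbc
      obtain ⟨t, rfl⟩ := ih _ _ h1
      exact ⟨t, by ring⟩
  have hgpow : ∀ l k b c, g ^ l * b = f ^ k * c → ∃ t, b = f ^ k * t := by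
    intro l
    induction l with
    | zero => intro k b c hbc; exact ⟨c, by simpa using hbc⟩
    | succ l ih =>
      intro k b c hbc
      obtain ⟨t, ht⟩ := ih k (g * b) c (by rw [← hbc]; ring)
      exact hgf k b t ht
  obtain ⟨a₁, ha₁, a₂, ha₂, ha⟩ := Submodule.mem_sup.mp hfk
  obtain ⟨b₁, hb₁, b₂, hb₂, hb⟩ := Submodule.mem_sup.mp hgl
  have h1 : g ^ l * a₁ = f ^ k * b₁ := by
    rw [← ha, ← hb]
    linear_combination hmul a₁ ha₁ b₂ hb₂ - hmul b₁ hb₁ a₂ ha₂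
  obtain ⟨t, ht⟩ := hgpow l k a₁ b₁ h1
  have h2 : t * (1 - t) = 0 := by
    refine hfpow k _ (hfpow k _ ?_)
    have h3 := hmul a₁ ha₁ a₂ ha₂
    rw [show a₂ = f ^ k - a₁ by rw [← ha]; ring, ht] at h3
    linear_combination h3
  rcases IsLocalRing.isUnit_or_isUnit_one_sub_self t with h | h
  · right
    have h4 : t = 1 := by
      have := (h.mul_right_eq_zero).mp h2
      linear_combination -this
    rw [h4, mul_one] at ht
    exact (Submodule.eq_bot_iff _).mpr fun b hb => hfpow k b (by rw [← ht]; exact hmul _ ha₁ _ hb)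
  · left
    have h4 : t = 0 := (h.mul_left_eq_zero).mp h2
    rw [h4, mul_zero] at ht
    rw [ht, zero_add] at ha
    exact (Submodule.eq_bot_iff _).mpr fun b hb =>
      hfpow k b (by rw [← ha, mul_comm]; exact hmul _ hb _ ha₂)

open scoped Pointwise in
/-- The local ring of `R ⧸ I` at `P`, for `R ⧸ I` satisfying Serre's condition `S_2`. -/
lemma SerreS.exists_local {I : Ideal R} (h : SerreS (R ⧸ I) 2) {P : Ideal R} [P.IsPrime]
    (hIP : I ≤ P) : ∃ (B : Type u) (_ : CommRing B) (_ : IsLocalRing B) (φ : R →+* B),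
      (∀ r, φ r = 0 ↔ ∃ s ∉ P, s * r ∈ I) ∧ (∀ r, IsUnit (φ r) ↔ r ∉ P) ∧
      (∀ b, ∃ r, ∃ s ∉ P, b * φ s = φ r) ∧
      (∀ Q : Ideal R, Q.IsPrime → I ≤ Q → Q < P → ∃ f ∈ P, ∀ b, φ f * b = 0 → b = 0) ∧
      ∀ Q Q' : Ideal R, Q.IsPrime → Q'.IsPrime → I ≤ Q → Q < Q' → Q' < P →
        ∃ f ∈ P, ∃ g ∈ P, (∀ b, φ f * b = 0 → b = 0) ∧
          ∀ b, φ g * b ∈ Ideal.span {φ f} → b ∈ Ideal.span {φ f} := by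
  have hmk := Ideal.Quotient.mk_surjective (I := I)
  have hcomap : ∀ Q : Ideal R, I ≤ Q →
      (Q.map (Ideal.Quotient.mk I)).comap (Ideal.Quotient.mk I) = Q := fun Q hQ => by
    rw [Ideal.comap_map_of_surjective' _ hmk, Ideal.mk_ker, sup_eq_left.mpr hQ]
  have hprime : ∀ Q : Ideal R, Q.IsPrime → I ≤ Q → (Q.map (Ideal.Quotient.mk I)).IsPrime :=
    fun Q hQ hIQ => Ideal.map_isPrime_of_surjective hmk (by rwa [Ideal.mk_ker])
  have hlt : ∀ Q Q' : Ideal R, I ≤ Q → Q < Q' →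
      Q.map (Ideal.Quotient.mk I) < Q'.map (Ideal.Quotient.mk I) := fun Q Q' hQ hlt => by
    refine lt_of_le_of_ne (Ideal.map_mono hlt.le) fun he => hlt.ne ?_
    rw [← hcomap Q hQ, he, hcomap Q' (hQ.trans hlt.le)]
  have hmem : ∀ r, Ideal.Quotient.mk I r ∈ P.map (Ideal.Quotient.mk I) ↔ r ∈ P := fun r => by
    rw [← Ideal.mem_comap, hcomap P hIP]
  haveI hP := hprime P ‹_› hIP
  set 𝔓 := P.map (Ideal.Quotient.mk I)
  let B := Localization.AtPrime 𝔓
  let φ : R →+* B := (algebraMap (R ⧸ I) B).comp (Ideal.Quotient.mk I)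
  have hunit : ∀ r, IsUnit (φ r) ↔ r ∉ P := fun r => by
    rw [RingHom.comp_apply, IsLocalization.AtPrime.isUnit_to_map_iff B 𝔓, ← hmem]
    rfl
  have hsurj : ∀ b, ∃ r, ∃ s ∉ P, b * φ s = φ r := by
    intro b
    obtain ⟨⟨r, s⟩, h⟩ := IsLocalization.surj 𝔓.primeCompl b
    obtain ⟨r, rfl⟩ := hmk r
    obtain ⟨s, hs⟩ := s
    obtain ⟨s, rfl⟩ := hmk s
    exact ⟨r, s, fun h => hs ((hmem s).mpr h), h⟩
  have hmax : ∀ b ∈ maximalIdeal B, ∃ r ∈ P, ∃ v, IsUnit v ∧ b * v = φ r := by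
    intro b hb
    obtain ⟨r, s, hs, h⟩ := hsurj b
    refine ⟨r, ?_, φ s, (hunit s).mpr hs, h⟩
    by_contra hr
    have := (hunit r).mpr hr
    rw [← h] at this
    exact (mem_maximalIdeal b).mp hb (isUnit_of_mul_isUnit_left this)
  have hregular : ∀ (f : B) r v, IsUnit v → f * v = φ r → IsSMulRegular B f →
      ∀ b, φ r * b = 0 → b = 0 := by
    intro f r v hv hvr hf b hb
    rw [← hvr, mul_assoc] at hb
    exact (hv.mul_right_eq_zero).mp (hf.right_eq_zero_of_smul hb)
  refine ⟨B, inferInstance, inferInstance, φ, fun r => ?_, hunit, hsurj, ?_, ?_⟩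
  · rw [RingHom.comp_apply, IsLocalization.map_eq_zero_iff 𝔓.primeCompl B]
    constructor
    · rintro ⟨⟨s, hs⟩, h⟩
      obtain ⟨s, rfl⟩ := hmk s
      refine ⟨s, fun h => hs ((hmem s).mpr h), ?_⟩
      rw [← Ideal.Quotient.eq_zero_iff_mem, map_mul]
      exact h
    · rintro ⟨s, hs, h⟩
      refine ⟨⟨Ideal.Quotient.mk I s, fun h => hs ((hmem s).mp h)⟩, ?_⟩
      rw [← Ideal.Quotient.eq_zero_iff_mem, map_mul] at h
      exact h
  · intro Q hQ hIQ hQP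
    haveI := hprime Q hQ hIQ
    have hdim : ((1 : ℕ) : WithBot ℕ∞) ≤ ringKrullDim B := by
      rw [IsLocalization.AtPrime.ringKrullDim_eq_height 𝔓]
      have := Ideal.height_add_one_le_of_lt_of_isPrime (hlt Q P hIQ hQP)
      exact_mod_cast le_add_self.trans this
    obtain ⟨rs, hlen, hmem, hreg⟩ := h 𝔓 hP 1 (by norm_num) hdim
    obtain ⟨f, rfl⟩ := List.length_eq_one_iff.mp hlen
    rw [RingTheory.Sequence.isWeaklyRegular_cons_iff] at hreg
    obtain ⟨r, hr, v, hv, hvr⟩ := hmax f (hmem f (by simp))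
    exact ⟨r, hr, hregular f r v hv hvr hreg.1⟩
  · intro Q Q' hQ hQ' hIQ hQQ' hQ'P
    haveI := hprime Q hQ hIQ
    haveI := hprime Q' hQ' (hIQ.trans hQQ'.le)
    have hdim : ((2 : ℕ) : WithBot ℕ∞) ≤ ringKrullDim B := by
      rw [IsLocalization.AtPrime.ringKrullDim_eq_height 𝔓]
      have h1 := Ideal.height_add_one_le_of_lt_of_isPrime (hlt Q Q' hIQ hQQ')
      have h2 := Ideal.height_add_one_le_of_lt_of_isPrime (hlt Q' P (hIQ.trans hQQ'.le) hQ'P)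
      have h3 : (2 : ℕ∞) ≤ 𝔓.height := by
        refine le_trans ?_ ((add_le_add_left h1 1).trans h2)
        rw [add_assoc]
        exact le_add_self
      exact WithBot.coe_le_coe.mpr h3
    obtain ⟨rs, hlen, hmem, hreg⟩ := h 𝔓 hP 2 le_rfl hdim
    obtain ⟨f, g, rfl⟩ := List.length_eq_two.mp hlen
    rw [RingTheory.Sequence.isWeaklyRegular_cons_iff,
      RingTheory.Sequence.isWeaklyRegular_cons_iff] at hreg
    obtain ⟨r, hr, v, hv, hvr⟩ := hmax f (hmem f (by simp))
    obtain ⟨r', hr', v', hv', hvr'⟩ := hmax g (hmem g (by simp))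
    refine ⟨r, hr, r', hr', hregular f r v hv hvr hreg.1, fun b hb => ?_⟩
    have h1 := (isSMulRegular_quotient_iff_mem_of_smul_mem _ _).mp hreg.2.1
    have h2 : ∀ b : B, b ∈ f • (⊤ : Submodule B B) ↔ b ∈ Ideal.span {φ r} := by
      intro b
      rw [← hvr, Ideal.span_singleton_mul_right_unit hv, Ideal.mem_span_singleton',
        Submodule.mem_smul_pointwise_iff_exists]
      simp [mul_comm]
    rw [← Ideal.unit_mul_mem_iff_mem _ hv', ← h2]
    refine h1 _ ((h2 _).mpr ?_)
    rw [smul_eq_mul, ← mul_assoc, hvr']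
    exact hb
end

section
variable {R : Type u} [CommRing R]

lemma exists_component (I : Ideal R) (S : Set (Ideal R)) (hS : ∀ P ∈ S, P.IsPrime) :
    ∃ L : Ideal R, ∀ r, r ∈ L ↔ ∀ P ∈ S, ∃ s ∉ P, s * r ∈ I := by
  refine ⟨⟨⟨⟨{r | ∀ P ∈ S, ∃ s ∉ P, s * r ∈ I}, ?_⟩, ?_⟩, ?_⟩, fun r => Iff.rfl⟩
  · intro a b ha hb P hP
    obtain ⟨s, hs, hsa⟩ := ha P hP
    obtain ⟨t, ht, htb⟩ := hb P hP
    refine ⟨s * t, fun h => ((hS P hP).mem_or_mem h).elim hs ht, ?_⟩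
    rw [show s * t * (a + b) = t * (s * a) + s * (t * b) by ring]
    exact I.add_mem (I.mul_mem_left _ hsa) (I.mul_mem_left _ htb)
  · intro P hP
    exact ⟨1, fun h => (hS P hP).ne_top ((Ideal.eq_top_iff_one _).2 h), by simp⟩
  · intro c r hr P hP
    obtain ⟨s, hs, hsr⟩ := hr P hP
    refine ⟨s, hs, ?_⟩
    rw [smul_eq_mul, mul_left_comm]
    exact I.mul_mem_left _ hsr

lemma exists_mul_pow_mem_of_mem_minimalPrimes {L P : Ideal R} (hP : P ∈ L.minimalPrimes) {f : R}
    (hf : f ∈ P) : ∃ s ∉ P, ∃ k, s * f ^ k ∈ L := by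
  haveI := hP.1.1
  by_contra hcon
  push Not at hcon
  obtain ⟨Q, hQ, hLQ, hdisj⟩ := Ideal.exists_le_prime_disjoint L
    (P.primeCompl ⊔ Submonoid.powers f) (by
      rw [Set.disjoint_left]
      intro r hr hr'
      obtain ⟨s, hs, _, ⟨k, rfl⟩, rfl⟩ := Submonoid.mem_sup.mp hr'
      exact hcon s hs k hr)
  rw [Set.disjoint_left] at hdisj
  have hQP : Q ≤ P := fun r hr => by
    by_contra h
    exact hdisj hr (Submonoid.mem_sup_left (S := P.primeCompl) h)
  exact hdisj (hP.2 ⟨hQ, hLQ⟩ hQP hf) (Submonoid.mem_sup_right (Submonoid.mem_powers f))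

variable [IsNoetherianRing R]

lemma AssI.mem_of_component {I L : Ideal R} {S : Set (Ideal R)} (hS : ∀ P ∈ S, P ∈ I.minimalPrimes)
    (hL : ∀ r, r ∈ L ↔ ∀ P ∈ S, ∃ s ∉ P, s * r ∈ I) {Q : Ideal R} (hQ : AssI L Q) : Q ∈ S := by
  obtain ⟨hQp, u, hu⟩ := hQ
  have hu' : u ∉ L := fun h =>
    hQp.ne_top ((Ideal.eq_top_iff_one _).2 ((hu 1).2 (by simpa using h)))
  rw [hL] at hu'
  push Not at hu'
  obtain ⟨P, hP, hPu⟩ := hu'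
  have hQP : Q ≤ P := by
    intro q hq
    obtain ⟨s, hs, hsq⟩ := (hL _).mp ((hu q).mp hq) P hP
    by_contra hqP
    refine hPu (s * q) (fun h => ((hS P hP).1.1.mem_or_mem h).elim hs hqP) ?_
    rwa [mul_assoc]
  have hIQ : I ≤ Q := fun r hr => (hu r).mpr ((hL _).mpr fun P hP =>
    ⟨1, fun h => (hS P hP).1.1.ne_top ((Ideal.eq_top_iff_one _).2 h),
      by rw [one_mul]; exact I.mul_mem_right _ hr⟩)
  rwa [le_antisymm hQP ((hS P hP).2 ⟨hQp, hIQ⟩ hQP)]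

/-- An ideal whose quotient satisfies `S_2` (or only `S_1`) has no embedded primes. -/
lemma SerreS.mem_minimalPrimes {I : Ideal R} (h : SerreS (R ⧸ I) 2) {P : Ideal R} (hP : AssI I P) :
    P ∈ I.minimalPrimes := by
  haveI := hP.1
  obtain ⟨Q, hQ, hQP⟩ := Ideal.exists_minimalPrimes_le hP.le
  rcases hQP.eq_or_lt with rfl | hlt
  · exact hQ
  obtain ⟨B, _, _, φ, h0, -, -, h1, -⟩ := SerreS.exists_local h hP.le
  obtain ⟨f, hf, hreg⟩ := h1 Q hQ.1.1 hQ.1.2 hlt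
  have ⟨_, u, hu⟩ := hP
  have h2 := hreg (φ u) (by
    rw [← map_mul, h0]
    exact ⟨1, fun h => hP.1.ne_top ((Ideal.eq_top_iff_one _).2 h),
      by rw [one_mul]; exact (hu f).mp hf⟩)
  obtain ⟨s, hs, hsu⟩ := (h0 u).mp h2
  exact absurd ((hu s).mpr hsu) hs

variable [IsLocalRing R] {n : ℕ} {y : ℕ → R}

theorem RegPar.height_of_serreS (hy : RegPar y n) {I : Ideal R} (h : SerreS (R ⧸ I) 2) {d : ℕ∞}
    (hd : ∃ P : Ideal R, P.IsPrime ∧ I ≤ P ∧ P.height = d)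
    (hle : ∀ P : Ideal R, P.IsPrime → I ≤ P → d ≤ P.height) {P : Ideal R} (hP : AssI I P) :
    P.height = d := by
  by_contra hPd
  have hPmin := SerreS.mem_minimalPrimes h hP
  set S₁ : Set (Ideal R) := {Q | Q ∈ I.minimalPrimes ∧ Q.height = d}
  set S₂ : Set (Ideal R) := {Q | Q ∈ I.minimalPrimes ∧ Q.height ≠ d}
  have hPS₂ : P ∈ S₂ := ⟨hPmin, hPd⟩
  obtain ⟨P₁, hP₁⟩ : ∃ P₁, P₁ ∈ S₁ := by
    obtain ⟨Q, hQ, hIQ, hQd⟩ := hd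
    haveI := hQ
    obtain ⟨Q', hQ', hQQ'⟩ := Ideal.exists_minimalPrimes_le hIQ
    exact ⟨Q', hQ', le_antisymm ((Ideal.height_mono hQQ').trans hQd.le) (hle _ hQ'.1.1 hQ'.1.2)⟩
  obtain ⟨I₁, hI₁⟩ := exists_component I S₁ fun Q hQ => hQ.1.1.1
  obtain ⟨I₂, hI₂⟩ := exists_component I S₂ fun Q hQ => hQ.1.1.1
  have hle₁ : ∀ Q ∈ S₁, I₁ ≤ Q := fun Q hQ r hr => by
    obtain ⟨s, hs, hsr⟩ := (hI₁ r).mp hr Q hQ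
    exact (hQ.1.1.1.mem_or_mem (hQ.1.1.2 hsr)).resolve_left hs
  have hle₂ : ∀ Q ∈ S₂, I₂ ≤ Q := fun Q hQ r hr => by
    obtain ⟨s, hs, hsr⟩ := (hI₂ r).mp hr Q hQ
    exact (hQ.1.1.1.mem_or_mem (hQ.1.1.2 hsr)).resolve_left hs
  have hinf : ∀ a ∈ I₁, a ∈ I₂ → a ∈ I := by
    intro a ha ha'
    by_contra haI
    obtain ⟨Q, hQ, hQa⟩ := exists_assI haI
    have hQm := SerreS.mem_minimalPrimes h hQ
    obtain ⟨s, hs, hsa⟩ : ∃ s ∉ Q, s * a ∈ I := by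
      by_cases hQd : Q.height = d
      · exact (hI₁ a).mp ha Q ⟨hQm, hQd⟩
      · exact (hI₂ a).mp ha' Q ⟨hQm, hQd⟩
    exact hs (hQa s hsa)
  have hI₁m : I₁ ⊔ I₂ ≤ maximalIdeal R :=
    sup_le ((hle₁ _ hP₁).trans (le_maximalIdeal hP₁.1.1.1.ne_top))
      ((hle₂ _ hPS₂).trans (le_maximalIdeal hPmin.1.1.ne_top))
  have hIle : I ≤ I₁ := fun r hr => (hI₁ r).mpr fun Q hQ =>
    ⟨1, fun h => hQ.1.1.1.ne_top ((Ideal.eq_top_iff_one _).2 h), by simpa using hr⟩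
  obtain ⟨𝔓, h𝔓, -⟩ := Ideal.exists_minimalPrimes_le hI₁m
  haveI := h𝔓.1.1
  have hex : ∀ (S : Set (Ideal R)) (L : Ideal R), (∀ Q ∈ S, Q ∈ I.minimalPrimes) →
      (∀ r, r ∈ L ↔ ∀ P ∈ S, ∃ s ∉ P, s * r ∈ I) → ∀ 𝔓 : Ideal R, 𝔓.IsPrime → L ≤ 𝔓 →
      ∃ Q ∈ S, Q ≤ 𝔓 := by
    intro S L hS hL 𝔓 h𝔓 hle
    obtain ⟨Q, hQ, hQ𝔓⟩ := Ideal.exists_minimalPrimes_le hle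
    exact ⟨Q, AssI.mem_of_component hS hL (AssI.of_mem_minimalPrimes hQ), hQ𝔓⟩
  obtain ⟨Q₁, hQ₁, hQ₁𝔓⟩ := hex S₁ I₁ (fun Q hQ => hQ.1) hI₁ 𝔓 h𝔓.1.1 (le_sup_left.trans h𝔓.1.2)
  obtain ⟨Q₂, hQ₂, hQ₂𝔓⟩ := hex S₂ I₂ (fun Q hQ => hQ.1) hI₂ 𝔓 h𝔓.1.1 (le_sup_right.trans h𝔓.1.2)
  have hnle₁₂ : ¬ Q₁ ≤ Q₂ := fun hh =>
    hQ₂.2 (by rw [← le_antisymm hh (hQ₂.1.2 hQ₁.1.1 hh), hQ₁.2])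
  have hnle₂₁ : ¬ Q₂ ≤ Q₁ := fun hh =>
    hQ₂.2 (by rw [le_antisymm hh (hQ₁.1.2 hQ₂.1.1 hh), hQ₁.2])
  have hlt₁ : Q₁ < 𝔓 := lt_of_le_of_ne hQ₁𝔓 fun hh => hnle₂₁ (hh ▸ hQ₂𝔓)
  have hlt₂ : Q₂ < 𝔓 := lt_of_le_of_ne hQ₂𝔓 fun hh => hnle₁₂ (hh ▸ hQ₁𝔓)
  obtain ⟨Q, Q', hQ, hQ', hIQ, hQQ', hQ'𝔓⟩ : ∃ Q Q' : Ideal R, Q.IsPrime ∧ Q'.IsPrime ∧ I ≤ Q ∧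
      Q < Q' ∧ Q' < 𝔓 := by
    by_contra hcon
    push Not at hcon
    have hadj : ∀ Q₀ : Ideal R, Q₀.IsPrime → I ≤ Q₀ → Q₀ < 𝔓 → 𝔓.height = Q₀.height + 1 := by
      intro Q₀ hQ₀ hI hlt
      refine hy.height_of_adjacent hQ₀ h𝔓.1.1 hlt fun Q hQ h1 h2 => ?_
      by_contra hne
      exact hcon Q₀ Q hQ₀ hQ hI h1 (lt_of_le_of_ne h2 hne)
    have h1 := hadj Q₁ hQ₁.1.1.1 hQ₁.1.1.2 hlt₁
    have h2 := hadj Q₂ hQ₂.1.1.1 hQ₂.1.1.2 hlt₂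
    obtain ⟨c₁, hc₁⟩ := hy.exists_height hQ₁.1.1.1
    obtain ⟨c₂, hc₂⟩ := hy.exists_height hQ₂.1.1.1
    refine hQ₂.2 ?_
    rw [h1, hc₁, hc₂] at h2
    rw [hc₂, ← hQ₁.2, hc₁]
    have : c₁ + 1 = c₂ + 1 := by exact_mod_cast h2
    rw [Nat.succ.inj this]
  obtain ⟨B, _, _, φ, h0, hun, -, -, hB⟩ := SerreS.exists_local h (hIle.trans (le_sup_left.trans h𝔓.1.2))
  obtain ⟨f, hf, g, hg, hf', hg'⟩ := hB Q Q' hQ hQ' hIQ hQQ' hQ'𝔓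
  have hone : (1 : R) ∉ 𝔓 := fun h => h𝔓.1.1.ne_top ((Ideal.eq_top_iff_one _).2 h)
  have hpow : ∀ f ∈ 𝔓, ∃ k, φ f ^ k ∈ I₁.map φ ⊔ I₂.map φ := by
    intro f hf
    obtain ⟨s, hs, k, hk⟩ := exists_mul_pow_mem_of_mem_minimalPrimes h𝔓 hf
    refine ⟨k, ?_⟩
    have := Ideal.mem_map_of_mem φ hk
    rw [Ideal.map_sup, map_mul, map_pow] at this
    exact (Ideal.unit_mul_mem_iff_mem _ ((hun s).mpr hs)).mp this
  obtain ⟨k, hk⟩ := hpow f hf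
  obtain ⟨l, hl⟩ := hpow g hg
  have hmul : ∀ a ∈ I₁.map φ, ∀ b ∈ I₂.map φ, a * b = 0 := by
    intro a ha b hb
    have h1 : a * b ∈ I₁.map φ * I₂.map φ := Ideal.mul_mem_mul ha hb
    rw [← Ideal.map_mul] at h1
    have h2 : (I₁ * I₂).map φ = ⊥ := by
      refine (Ideal.map_eq_bot_iff_le_ker φ).mpr (Ideal.mul_le.mpr fun a ha b hb => ?_)
      rw [RingHom.mem_ker, h0]
      exact ⟨1, hone, by
        rw [one_mul]; exact hinf _ (I₁.mul_mem_right _ ha) (I₂.mul_mem_left _ hb)⟩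
    rwa [h2, Ideal.mem_bot] at h1
  have hkill : ∀ L Q₀ : Ideal R, Q₀.IsPrime → I ≤ Q₀ → Q₀ ≤ 𝔓 → L.map φ = ⊥ → L ≤ Q₀ := by
    intro L Q₀ hQ₀ hI hle hL r hr
    obtain ⟨s, hs, hsr⟩ := (h0 r).mp ((Ideal.map_eq_bot_iff_le_ker φ).mp hL hr)
    exact (hQ₀.mem_or_mem (hI hsr)).resolve_left fun h => hs (hle h)
  rcases eq_bot_or_eq_bot_of_mul hf' hg' hmul hk hl with hb | hb
  · obtain ⟨Q₀, hQ₀, hle⟩ := hex S₁ I₁ (fun Q hQ => hQ.1) hI₁ Q₂ hQ₂.1.1.1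
      (hkill I₁ Q₂ hQ₂.1.1.1 hQ₂.1.1.2 hQ₂𝔓 hb)
    exact hQ₂.2 (by rw [← le_antisymm hle (hQ₂.1.2 hQ₀.1.1 hle), hQ₀.2])
  · obtain ⟨Q₀, hQ₀, hle⟩ := hex S₂ I₂ (fun Q hQ => hQ.1) hI₂ Q₁ hQ₁.1.1.1
      (hkill I₂ Q₁ hQ₁.1.1.1 hQ₁.1.1.2 hQ₁𝔓 hb)
    exact hQ₀.2 (by rw [le_antisymm hle (hQ₁.1.2 hQ₀.1.1 hle), hQ₁.2])

/-- The `S_2` property makes `I + (v)` unmixed for a nonzerodivisor `v` modulo `I`. -/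
theorem RegPar.height_of_serreS_sup (hy : RegPar y n) {I : Ideal R} (h : SerreS (R ⧸ I) 2) {d : ℕ∞}
    (hd : ∀ P, AssI I P → P.height = d) {v : R} (hv : ∀ r, v * r ∈ I → r ∈ I) {P : Ideal R}
    (hP : AssI (I ⊔ Ideal.span {v}) P) : P.height = d + 1 := by
  haveI := hP.1
  have hIP : I ≤ P := le_sup_left.trans hP.le
  have hvP : v ∈ P := hP.le (Ideal.mem_sup_right (Ideal.mem_span_singleton_self v))
  obtain ⟨Q, hQ, hQP⟩ := Ideal.exists_minimalPrimes_le hIP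
  have hQA := AssI.of_mem_minimalPrimes hQ
  have hvQ : v ∉ Q := fun hh => by
    obtain ⟨r, hr, hr'⟩ := hQA.mem_of_mul_mem hh
    exact hr' (hv r hr)
  have hlt : Q < P := lt_of_le_of_ne hQP fun hh => hvQ (hh ▸ hvP)
  rw [← hd Q hQA]
  refine hy.height_of_adjacent hQ.1.1 hP.1 hlt fun Q' hQ' h1 h2 => ?_
  by_contra hne
  obtain ⟨B, _, _, φ, h0, hun, hsurj, -, hB⟩ := SerreS.exists_local h hIP
  obtain ⟨f, hf, g, hg, hf', hg'⟩ := hB Q Q' hQ.1.1 hQ' hQ.1.2 h1 (lt_of_le_of_ne h2 hne)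
  have ⟨_, u, hu⟩ := hP
  have hone : (1 : R) ∉ P := fun h => hP.1.ne_top ((Ideal.eq_top_iff_one _).2 h)
  have hvB : ∀ b, φ v * b = 0 → b = 0 := by
    intro b hb
    obtain ⟨r, s, hs, hrs⟩ := hsurj b
    have h2 : φ (v * r) = 0 := by rw [map_mul, ← hrs, ← mul_assoc, hb, zero_mul]
    obtain ⟨t, ht, htr⟩ := (h0 _).mp h2
    have h3 : φ r = 0 := (h0 r).mpr ⟨t, ht, hv _ (by rwa [mul_left_comm])⟩
    rw [h3] at hrs
    exact (((hun s).mpr hs).mul_left_eq_zero).mp hrs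
  have hmul : ∀ p ∈ P, ∃ a, φ p * φ u = φ v * a := by
    intro p hp
    obtain ⟨a, ha, b, hb, hab⟩ := Submodule.mem_sup.mp ((hu p).mp hp)
    obtain ⟨c, rfl⟩ := Ideal.mem_span_singleton'.mp hb
    refine ⟨φ c, ?_⟩
    have : φ a = 0 := (h0 a).mpr ⟨1, hone, by simpa using ha⟩
    rw [← map_mul, ← hab, map_add, this, zero_add, map_mul, mul_comm]
  obtain ⟨a, ha⟩ := hmul f hf
  obtain ⟨b, hb⟩ := hmul g hg
  have h3 : φ g * a = φ f * b := by
    rw [← sub_eq_zero]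
    refine hvB _ ?_
    linear_combination φ f * hb - φ g * ha
  obtain ⟨c, hc⟩ := Ideal.mem_span_singleton'.mp (hg' a (by
    rw [h3]; exact Ideal.mul_mem_right _ _ (Ideal.mem_span_singleton_self _)))
  have h4 : φ u = φ v * c := by
    rw [← sub_eq_zero]
    refine hf' _ ?_
    linear_combination ha - φ v * hc
  obtain ⟨r, s, hs, hrs⟩ := hsurj c
  have h5 : φ (s * u - v * r) = 0 := by
    rw [map_sub, map_mul, map_mul, h4, ← hrs]
    ring
  obtain ⟨t, ht, hts⟩ := (h0 _).mp h5
  have h6 : t * s ∈ P := by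
    rw [hu]
    have := Ideal.add_mem _ (Ideal.mem_sup_left (T := Ideal.span {v}) hts)
      (Ideal.mem_sup_right (S := I) (Ideal.mul_mem_left _ (t * r) (Ideal.mem_span_singleton_self v)))
    convert this using 1
    ring
  exact (hP.1.mem_or_mem h6).elim ht hs
end

section
variable {R : Type u} [CommRing R] [IsNoetherianRing R]

/-- Nakayama's lemma for `I ⧸ J` at a prime. -/
lemma exists_notMem_sup_of_notMem {I J P : Ideal R} [P.IsPrime] {v u : R} (hvP : v ∈ P)
    (hv : ∀ r, v * r ∈ I → r ∈ I) (hJI : J ≤ I) (huI : u ∈ I) (hu : ∀ s, s * u ∈ J → s ∈ P) :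
    ∃ i ∈ I, ∀ s, s * i ∈ J ⊔ Ideal.span {v} → s ∈ P := by
  by_contra hcon
  push Not at hcon
  let B := Localization.AtPrime P
  let φ := algebraMap R B
  have hle : I.map φ ≤ J.map φ ⊔ maximalIdeal B • I.map φ := by
    refine Ideal.map_le_of_le_comap fun i hi => ?_
    obtain ⟨s, hs, hsP⟩ := hcon i hi
    obtain ⟨j, hj, b, hb, hjb⟩ := Submodule.mem_sup.mp hs
    obtain ⟨c, rfl⟩ := Ideal.mem_span_singleton'.mp hb
    have hc : c ∈ I := hv c (by
      rw [show v * c = s * i - j by rw [← hjb]; ring]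
      exact I.sub_mem (I.mul_mem_left _ hi) (hJI hj))
    rw [Ideal.mem_comap, ← Ideal.unit_mul_mem_iff_mem _
      ((IsLocalization.AtPrime.isUnit_to_map_iff B P s).mpr hsP), ← map_mul, ← hjb, map_add,
      map_mul, mul_comm]
    refine Ideal.add_mem _ (Ideal.mem_sup_left (Ideal.mem_map_of_mem φ hj))
      (Ideal.mem_sup_right (Ideal.mul_mem_mul ?_ (Ideal.mem_map_of_mem φ hc)))
    exact (IsLocalization.AtPrime.to_map_mem_maximal_iff B P v).mpr hvP
  have h1 := Submodule.le_of_le_smul_of_le_jacobson_bot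
    (((isNoetherianRing_iff_ideal_fg R).mp inferInstance I).map φ)
    (IsLocalRing.maximalIdeal_le_jacobson ⊥) hle (Ideal.mem_map_of_mem φ huI)
  obtain ⟨⟨⟨j, hj⟩, ⟨s, hs⟩⟩, h⟩ :=
    (IsLocalization.mem_map_algebraMap_iff P.primeCompl B).mp h1
  change algebraMap R B u * algebraMap R B s = algebraMap R B j at h
  rw [← map_mul] at h
  obtain ⟨⟨t, ht⟩, h2⟩ := (IsLocalization.eq_iff_exists P.primeCompl B).mp h
  refine (‹P.IsPrime›.mul_notMem ht hs) (hu (t * s) ?_)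
  have : t * s * u = t * j := by rw [← show t * (u * s) = t * j from h2]; ring
  rw [this]
  exact J.mul_mem_left _ hj

end
section
variable {R : Type u} [CommRing R] [IsLocalRing R] [IsNoetherianRing R] {n : ℕ} {y : ℕ → R}

theorem RegPar.exists_contr_of_natCast_notMem (hy : RegPar y n) {w : ℕ → R} {d : ℕ}
    (hw : RegSeq w d)
    (hwm : ∀ j < d, w j ∈ maximalIdeal R) {I : Ideal R} (hI : ∀ P, AssI I P → P.height = d)
    (hS : SerreS (R ⧸ I) 2)
    (hJI : Id w d ≤ I) {u : R} (huI : u ∈ I) {𝔭 : Ideal R} (h𝔭 : 𝔭.IsPrime)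
    (hu : ∀ r, r ∈ 𝔭 ↔ r * u ∈ Id w d) {a : ℕ → Fin n → R}
    (ha : Expr (fun j : Fin n => y j) w a d) {p : ℕ} [Fact p.Prime] (hpm : (p : R) ∈ maximalIdeal R)
    (hp : (p : R) ∉ 𝔭) :
    ∃ κ, In I (wp a d - contr (fun j : Fin n => y j) κ) := by
  have hht := hy.assI_height hw hwm ⟨h𝔭, u, hu⟩
  have hJ𝔭 : Id w d ≤ 𝔭 := fun r hr => (hu r).mpr (Ideal.mul_mem_right _ _ hr)
  obtain ⟨𝔮, h𝔮, -⟩ := Ideal.exists_minimalPrimes_le (I := 𝔭 ⊔ Ideal.span {(p : R)})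
    (J := maximalIdeal R) (sup_le (le_maximalIdeal h𝔭.ne_top)
      ((Ideal.span_singleton_le_iff_mem _).mpr hpm))
  haveI := h𝔮.1.1
  have h𝔮ht : 𝔮.height = (d + 1 : ℕ) := by
    rw [hy.height_of_mem_minimalPrimes h𝔭 hp h𝔮, hht]; rfl
  have hp𝔮 : (p : R) ∈ 𝔮 := h𝔮.1.2 (Ideal.mem_sup_right (Ideal.mem_span_singleton_self _))
  have h𝔭𝔮 : 𝔭 ≤ 𝔮 := le_sup_left.trans h𝔮.1.2
  obtain ⟨v, hv𝔮, hv⟩ := exists_mem_not_mem ({P | AssI I P} ∪ {P | AssI (Id w d) P})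
    ((assI_finite _).union (assI_finite _)) (fun P hP => hP.elim (fun h => h.1) fun h => h.1) 𝔮
    (fun P hP hle => by
      have h1 := Ideal.height_mono hle
      rw [hP.elim (fun h => hI P h) fun h => hy.assI_height hw hwm h, h𝔮ht] at h1
      exact absurd h1 (by rw [Nat.cast_le]; omega))
  have hvI : ∀ r, v * r ∈ I → r ∈ I := fun r hr =>
    mem_of_mul_mem_of_forall_assI (fun P hP => hv P (Or.inl hP)) hr
  have hvJ : ∀ r, v * r ∈ Id w d → r ∈ Id w d := fun r hr =>
    mem_of_mul_mem_of_forall_assI (fun P hP => hv P (Or.inr hP)) hr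
  set w' := Function.update w d v
  have hne : ∀ j < d, w' j = w j := fun j hj => Function.update_of_ne hj.ne _ _
  have hw'd : w' d = v := Function.update_self _ _ _
  have hid : Id w' d = Id w d := Id_congr hne
  have hid' : Id w' (d + 1) = Id w d ⊔ Ideal.span {v} := by rw [Id_succ, hid, hw'd]
  have hw' : RegSeq w' (d + 1) := by
    intro j hj r hr
    rcases Nat.lt_succ_iff_lt_or_eq.1 hj with hj' | rfl
    · exact hw.congr (fun i hi => (hne i hi).symm) j hj' r hr
    · rw [hid] at hr ⊢
      exact hvJ r (by rwa [← hw'd])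
  have hvm : v ∈ maximalIdeal R := le_maximalIdeal h𝔮.1.1.ne_top hv𝔮
  have hw'm : ∀ j < d + 1, w' j ∈ maximalIdeal R := by
    intro j hj
    rcases Nat.lt_succ_iff_lt_or_eq.1 hj with hj' | rfl
    · rw [hne j hj']; exact hwm j hj'
    · rwa [hw'd]
  obtain ⟨i, hiI, hi⟩ := exists_notMem_sup_of_notMem hv𝔮 hvI hJI huI
    fun s hs => h𝔭𝔮 ((hu s).mpr hs)
  obtain ⟨Q, hQ, hQ𝔮⟩ := Ideal.exists_minimalPrimes_le (I := (Id w' (d + 1)).colon {i}) (J := 𝔮)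
    fun s hs => hi s (by rw [← hid']; simpa [Submodule.mem_colon_singleton] using hs)
  obtain ⟨hQp, t, ht⟩ := AssI.of_mem_minimalPrimes hQ
  have ht' : ∀ r, r ∈ Q ↔ r * (t * i) ∈ Id w' (d + 1) := fun r => by
    rw [ht, Submodule.mem_colon_singleton, smul_eq_mul, mul_assoc]
  have hQht := hy.assI_height hw' hw'm ⟨hQp, _, ht'⟩
  obtain rfl := hy.eq_of_le_of_height hQp h𝔮.1.1 hQ𝔮 (by rw [h𝔮ht, hQht])
  obtain ⟨b, hb⟩ : ∃ b : Fin n → R, v = ∑ j, b j * y j := by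
    obtain ⟨c, hc⟩ := exists_expr hy.span fun _ => v
    exact ⟨c 0, hc 0 hvm⟩
  have hae : ∀ j < d, Function.update a d b j = a j := fun j hj => Function.update_of_ne hj.ne _ _
  have hab : Function.update a d b d = b := Function.update_self _ _ _
  obtain ⟨κ', hκ'⟩ := hy.exists_contr_of_natCast_mem hw' hw'm (I := I ⊔ Ideal.span {v})
    (a := Function.update a d b) (p := p)
    (fun P hP => by
      rw [hy.height_of_serreS_sup hS hI hvI hP]; rfl)
    (by rw [hid']; exact sup_le_sup_right hJI _)
    (Ideal.mem_sup_left (I.mul_mem_left t hiI)) hQp ht'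
    (fun j hj => by
      rcases Nat.lt_succ_iff_lt_or_eq.1 hj with hj' | rfl
      · rw [hne j hj', hae j hj']; exact ha j hj'
      · rw [hw'd, hab]; exact hb) hp𝔮
  rw [wp, hab, wp_congr hae] at hκ'
  have hex : ∀ T, ∃ c, (wedge b (wp a d) - contr (fun j : Fin n => y j) κ') T - v * c ∈ I := by
    intro T
    obtain ⟨x, hx, z, hz, hxz⟩ := Submodule.mem_sup.mp (hκ' T)
    obtain ⟨c, rfl⟩ := Ideal.mem_span_singleton'.mp hz
    exact ⟨c, by rw [← hxz]; convert hx using 1; ring⟩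
  choose κ hκ using hex
  refine ⟨κ, fun T => hvI _ ?_⟩
  have h1 : In I (contr (fun j : Fin n => y j) (wedge b (wp a d) -
      contr (fun j : Fin n => y j) κ' - v • κ)) := In.contr (u := wedge b (wp a d) -
      contr (fun j : Fin n => y j) κ' - v • κ) (fun T => hκ T) _
  have h2 : In I (wedge b (contr (fun j : Fin n => y j) (wp a d))) :=
    ((contr_wp ha).mono hJI).wedge b
  have h3 := (h1.add h2) T
  rw [map_sub, map_sub, contr_wedge, contr_contr, ← hb, map_smul] at h3
  convert h3 using 1
  simp only [Pi.add_apply, Pi.sub_apply, Pi.smul_apply, Pi.zero_apply, smul_eq_mul]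
  ring
end

section
variable {R : Type u} [CommRing R] {s : ℕ}

lemma wedge_sub_left {M : Type*} [AddCommGroup M] [Module R M] (v v' : Fin s → R) (u : KV s M) :
    wedge v u - wedge v' u = wedge (v - v') u := by
  simp only [wedge_apply, ← Finset.sum_sub_distrib, Pi.sub_apply, sub_smul]

lemma in_wedge_of_mem {I : Ideal R} {v : Fin s → R} (hv : ∀ i, v i ∈ I) (u : KV s R) :
    In I (wedge v u) := by
  intro T
  rw [wedge_apply, Finset.sum_apply]
  exact I.sum_mem fun j _ => I.mul_mem_right _ (hv j)

/-- Congruent vectors have congruent exterior products. -/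
lemma in_wp_sub_wp {I : Ideal R} {v v' : ℕ → Fin s → R} {d : ℕ}
    (h : ∀ k < d, ∀ i, v k i - v' k i ∈ I) : In I (wp v d - wp v' d) := by
  induction d with
  | zero => intro T; simp [wp]
  | succ d ih =>
    have h1 := (ih fun k hk => h k (hk.trans d.lt_succ_self)).wedge (v d)
    have h2 := in_wedge_of_mem (v := v d - v' d) (fun i => h d d.lt_succ_self i) (wp v' d)
    have h3 := h1.add h2
    rw [map_sub, ← wedge_sub_left] at h3
    simpa [wp] using h3

/-- The exterior product of distinct basis vectors is a basis vector up to sign. -/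
lemma exists_wp_single (t : ℕ → Fin s) {d : ℕ} (ht : Set.InjOn t (Set.Iio d)) :
    ∃ ε : ℤ, ε * ε = 1 ∧ (wp (fun k => Pi.single (t k) 1) d : KV s R) =
      ε • Pi.single ((Finset.range d).image t) (1 : R) := by
  induction d with
  | zero => exact ⟨1, by simp, by simp [wp, eOne]⟩
  | succ d ih =>
    obtain ⟨ε, hε, h⟩ := ih (ht.mono (Set.Iio_subset_Iio d.le_succ))
    have hnot : t d ∉ (Finset.range d).image t := by
      simp only [Finset.mem_image, Finset.mem_range, not_exists, not_and]
      intro k hk hkd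
      exact hk.ne (ht (Set.mem_Iio.2 (hk.trans d.lt_succ_self)) (Set.mem_Iio.2 d.lt_succ_self) hkd)
    set T := (Finset.range d).image t with hT
    refine ⟨sgn (insert (t d) T) (t d) * ε, ?_, ?_⟩
    · rw [mul_mul_mul_comm, sgn_mul_self, hε, one_mul]
    · have himg : (Finset.range (d + 1)).image t = insert (t d) T := by
        rw [Finset.range_add_one, Finset.image_insert]
      rw [himg, wp, h, wedge_apply, Finset.sum_eq_single (t d)]
      · ext U
        rw [Pi.smul_apply, crea_apply]
        by_cases hU : U = insert (t d) T
        · subst hU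
          simp [Finset.erase_insert hnot, mul_smul, mul_comm, mul_assoc]
        · have h0 : (Pi.single (insert (t d) T) (1 : R) : KV s R) U = 0 := Pi.single_eq_of_ne hU _
          simp only [Pi.smul_apply, h0, smul_zero]
          split_ifs with h1
          · have : U.erase (t d) ≠ T := by
              rintro h2; exact hU (by rw [← h2, Finset.insert_erase h1])
            simp [Pi.single_eq_of_ne this]
          · simp
      · intro j _ hj
        simp [Pi.single_eq_of_ne hj]
      · simp

end
section
variable {R : Type u} [CommRing R] [IsLocalRing R] [IsNoetherianRing R] {s n : ℕ} {y : ℕ → R}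

/-- Coset prime avoidance: selected generators of `I` can be perturbed inside `𝔪 I` to form a
regular sequence. -/
lemma RegPar.exists_perturb (hy : RegPar y n) {I : Ideal R} {x : Fin s → R}
    (hx : Ideal.span (Set.range x) = I) (hI : I ≠ ⊤) {d : ℕ}
    (hht : ∀ P : Ideal R, P.IsPrime → I ≤ P → (d : ℕ∞) ≤ P.height) (t : ℕ → Fin s) {k : ℕ}
    (hk : k ≤ d) : ∃ v : ℕ → Fin s → R, RegSeq (fun j => ∑ i, v j i * x i) k ∧
      (∀ j < k, ∀ i, v j i - (Pi.single (t j) 1 : Fin s → R) i ∈ maximalIdeal R) ∧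
      ∀ j ≥ k, v j = 0 := by
  induction k with
  | zero => exact ⟨0, fun i hi => absurd hi (Nat.not_lt_zero _), by simp, fun _ _ => rfl⟩
  | succ k ih =>
    obtain ⟨v, hreg, hv, hv0⟩ := ih (by omega)
    set w : ℕ → R := fun j => ∑ i, v j i * x i with hw
    have hxI : ∀ i, x i ∈ I := fun i => hx ▸ Ideal.subset_span ⟨i, rfl⟩
    have hwI : ∀ j, w j ∈ I := fun j => I.sum_mem fun i _ => I.mul_mem_left _ (hxI i)
    have hIm := le_maximalIdeal hI
    obtain ⟨μ, hμ, hP⟩ := exists_add_not_mem (assI_finite (Id w k)).toFinset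
      (fun P hP => ((Set.Finite.mem_toFinset _).mp hP).1) (x (t k)) (maximalIdeal R * I) (by
        intro P hP _ hle
        replace hP := (Set.Finite.mem_toFinset _).mp hP
        have h1 := hy.assI_height hreg (fun j _ => hIm (hwI j)) hP
        have hIP : I ≤ P := (hP.1.mul_le.mp hle).elim (fun h => hIm.trans h) id
        have := hht P hP.1 hIP
        rw [h1] at this
        have : d ≤ k := by exact_mod_cast this
        omega)
    obtain ⟨c, hc, hcμ⟩ : ∃ c : Fin s → R, (∀ i, c i ∈ maximalIdeal R) ∧ ∑ i, c i * x i = μ := by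
      rw [← hx, ← smul_eq_mul, Submodule.mem_ideal_smul_span_iff_exists_sum] at hμ
      obtain ⟨a, ha, rfl⟩ := hμ
      exact ⟨a, ha, by simp [Finsupp.sum_fintype]⟩
    refine ⟨Function.update v k (Pi.single (t k) 1 + c), ?_, ?_, ?_⟩
    · have hne : ∀ j < k, w j = ∑ i, Function.update v k (Pi.single (t k) 1 + c) j i * x i := by
        intro j hj
        rw [Function.update_of_ne hj.ne]
      have hk' : ∑ i, Function.update v k (Pi.single (t k) 1 + c) k i * x i = x (t k) + μ := by
        rw [Function.update_self, ← hcμ]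
        simp [add_mul, Finset.sum_add_distrib, Pi.single_apply]
      intro j hj r hr
      rcases Nat.lt_succ_iff_lt_or_eq.1 hj with hj' | rfl
      · exact hreg.congr hne j hj' r hr
      · rw [← Id_congr hne] at hr ⊢
        beta_reduce at hr
        rw [hk'] at hr
        exact mem_of_mul_mem_of_forall_assI
          (fun P hPA => hP P ((Set.Finite.mem_toFinset _).mpr hPA)) hr
    · intro j hj i
      rcases Nat.lt_succ_iff_lt_or_eq.1 hj with hj' | rfl
      · rw [Function.update_of_ne hj'.ne]; exact hv j hj' i
      · rw [Function.update_self]; simpa using hc i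
    · intro j hj
      rw [Function.update_of_ne (by omega)]
      exact hv0 j (by omega)

theorem RegPar.koszulTorMapZero (hy : RegPar y n) {I : Ideal R} {x : Fin s → R}
    (hx : Ideal.span (Set.range x) = I) (hI : I ≠ ⊤) {d : ℕ}
    (hht : ∀ P : Ideal R, P.IsPrime → I ≤ P → (d : ℕ∞) ≤ P.height)
    (H : ∀ w : ℕ → R, RegSeq w d → Id w d ≤ I → ∀ a : ℕ → Fin n → R,
      Expr (fun j : Fin n => y j) w a d → ∃ κ, In I (wp a d - contr (fun j : Fin n => y j) κ)) :
    KoszulTorMapZero R x I d := by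
  intro P L v
  set N := LinearMap.range (P.d d) ⊔ (maximalIdeal R) • (⊤ : Submodule R (P.F d)) with hN
  have hmN : ∀ r ∈ maximalIdeal R, ∀ g, r • g ∈ N := fun r hr g =>
    Submodule.mem_sup_right (Submodule.smul_mem_smul hr Submodule.mem_top)
  have hxI : ∀ i, x i ∈ I := fun i => hx ▸ Ideal.subset_span ⟨i, rfl⟩
  have hIm := le_maximalIdeal hI
  suffices hb : ∀ T : KIdx s d, L.ψ d (Finsupp.single T 1) ∈ N by
    induction v using Finsupp.induction_linear with
    | zero => simp
    | add f g hf hg => rw [map_add]; exact N.add_mem hf hg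
    | single T r =>
      rw [← mul_one r, ← smul_eq_mul, ← Finsupp.smul_single, map_smul]
      exact N.smul_mem _ (hb T)
  intro T
  rcases Nat.eq_zero_or_pos s with rfl | hs
  · obtain ⟨T, rfl⟩ := T
    obtain rfl : T = ∅ := Subsingleton.elim _ _
    have h1 := lift_wp_mem L (fun j : Fin n => hy.mem j.2) 0 0 (by simp) 0
      (H 0 (fun i hi => absurd hi (Nat.not_lt_zero _)) (by simp [Id_zero]) 0
        fun i hi => absurd hi (Nat.not_lt_zero _))
    have h2 : restr 0 (wp 0 0 : KV 0 R) = Finsupp.single ⟨∅, rfl⟩ 1 := by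
      ext U
      obtain ⟨U, hU⟩ := U
      obtain rfl : U = ∅ := Subsingleton.elim _ _
      simp [wp, eOne]
    rwa [h2] at h1
  obtain ⟨t, htinj, htT⟩ : ∃ t : ℕ → Fin s, Set.InjOn t (Set.Iio d) ∧
      (Finset.range d).image t = T.1 := by
    let e := T.1.orderEmbOfFin T.2
    refine ⟨fun k => if h : k < d then e ⟨k, h⟩ else ⟨0, hs⟩, fun i hi j hj hij => ?_, ?_⟩
    · have hi' : i < d := hi
      have hj' : j < d := hj
      simp only [hi', hj', dif_pos] at hij
      simpa using e.injective hij
    · ext i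
      rw [← T.1.mem_coe, ← Finset.range_orderEmbOfFin T.1 T.2]
      simp only [Finset.mem_image, Finset.mem_range, Set.mem_range]
      constructor
      · rintro ⟨k, hk, rfl⟩; exact ⟨⟨k, hk⟩, by simp [hk, e]⟩
      · rintro ⟨k, rfl⟩; exact ⟨k, k.2, by simp [e]⟩
  obtain ⟨v, hreg, hv, hv0⟩ := hy.exists_perturb hx hI hht t le_rfl
  set w : ℕ → R := fun j => ∑ i, v j i * x i with hw
  have hwI : ∀ j, w j ∈ I := fun j => I.sum_mem fun i _ => I.mul_mem_left _ (hxI i)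
  obtain ⟨a, ha⟩ := exists_expr hy.span w
  have ha' : ∀ i, w i = ∑ j, a i j * y j := fun i => ha i (hIm (hwI i))
  have h1 := lift_wp_mem L (fun j : Fin n => hy.mem j.2) v a ha' d
    (H w hreg (Id_le fun j _ => hwI j) a fun i _ => ha' i)
  obtain ⟨ε, hε, hεT⟩ := exists_wp_single (R := R) t htinj
  have h2 := in_wp_sub_wp hv
  have h3 : L.ψ d (restr d (wp v d - wp (fun k => Pi.single (t k) 1) d)) ∈ N := by
    rw [← Finsupp.sum_single (restr d _), Finsupp.sum, map_sum]
    refine N.sum_mem fun U _ => ?_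
    rw [← mul_one ((restr d (wp v d - wp (fun k => Pi.single (t k) 1) d)) U), ← smul_eq_mul,
      ← Finsupp.smul_single, map_smul]
    exact hmN _ (h2 U.1) _
  rw [map_sub, map_sub] at h3
  have h4 := N.sub_mem h1 h3
  rw [sub_sub_cancel, hεT] at h4
  have h5 : restr d (ε • Pi.single ((Finset.range d).image t) (1 : R) : KV s R) =
      ε • Finsupp.single T 1 := by
    ext U
    simp [htT, Finsupp.single_apply, Pi.single_apply, Subtype.ext_iff, eq_comm]
  rw [h5, map_zsmul] at h4
  have h6 := N.smul_of_tower_mem ε h4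
  rwa [smul_smul, hε, one_smul] at h6
end

section
variable {R : Type*} [CommRing R] {n : ℕ}

/-- Replace all terms from the `d`-th on by their `k`-th powers. -/
def powFrom (w : ℕ → R) (d k j : ℕ) : R := if j < d then w j else w j ^ k

lemma Id_powFrom_left (w : ℕ → R) (d k : ℕ) : Id (powFrom w d k) d = Id w d :=
  Id_congr fun j hj => by simp [powFrom, hj]

lemma Id_powFrom (w : ℕ → R) (d k i : ℕ) :
    Id (powFrom w d k) (d + i) = Id w d ⊔ Id (fun j => w (d + j) ^ k) i := by
  rw [Id_add, Id_powFrom_left]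
  congr 1
  exact Id_congr fun j _ => by simp [powFrom]

lemma map_powFrom {S : Type*} [CommRing S] (φ : R →+* S) (w : ℕ → R) (d k j : ℕ) :
    φ (powFrom w d k j) = powFrom (fun j => φ (w j)) d k j := by
  unfold powFrom; split_ifs <;> simp

lemma map_mem_Id {S : Type*} [CommRing S] (φ : R →+* S) {w : ℕ → R} {k : ℕ} {r : R}
    (h : r ∈ Id w k) : φ r ∈ Id (fun j => φ (w j)) k := by
  have := Ideal.mem_map_of_mem φ h
  rwa [Id, Ideal.map_span, ← Set.image_comp] at this

/-- The equational data of a counterexample. -/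
structure Ladder (C : Type*) [CommRing C] (n : ℕ) where
  (d δ T N k : ℕ)
  (Y w : ℕ → C)
  (a c : ℕ → Fin n → C)
  (A : ℕ → KV n C)
  (T₀ : Finset (Fin n))
  (u b r r' t' : C)
  hd : d + δ = n
  hT : 0 < T
  hk : 0 < k
  ha : Expr (fun j : Fin n => Y j) w a n
  hN : ∀ j < n, Y j ^ N ∈ Id w n
  hA : ∀ U, A δ U * u ∈ Id w d
  h0 : A 0 T₀ * t' = 1
  hl : ∀ i < δ, In (Id (powFrom w d T) (d + i))
    (wedge (fun j : Fin n => Y j) (A (i + 1)) - w (d + i) ^ T • A i)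
  hc : Expr (fun j : Fin n => Y j) (powFrom w d k) c n
  hr : r * r' = 1
  hu : b * u - r * wp c n Finset.univ ∈ Id (powFrom w d k) n

lemma ringHom_wedge' {S : Type*} [CommRing S] (φ : R →+* S) (v : Fin n → R) (u : KV n R)
    (T : Finset (Fin n)) :
    φ (wedge v u T) = wedge (fun j => φ (v j)) (fun T => φ (u T)) T := by
  simp only [wedge_apply, Finset.sum_apply, Pi.smul_apply, smul_eq_mul, map_sum, map_mul,
    crea_apply]
  refine Finset.sum_congr rfl fun j _ => ?_
  split_ifs <;> simp

lemma ringHom_wp {S : Type*} [CommRing S] (φ : R →+* S) (a : ℕ → Fin n → R) (k : ℕ)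
    (T : Finset (Fin n)) : φ (wp a k T) = wp (fun i j => φ (a i j)) k T := by
  induction k generalizing T with
  | zero => simp only [wp, eOne, Pi.single_apply]; split_ifs <;> simp
  | succ k ih => rw [wp, wp, ringHom_wedge', funext ih]

lemma Expr.map {S : Type*} [CommRing S] (φ : R →+* S) {y : Fin n → R} {w : ℕ → R}
    {a : ℕ → Fin n → R} {k : ℕ} (h : Expr y w a k) :
    Expr (fun j => φ (y j)) (fun i => φ (w i)) (fun i j => φ (a i j)) k := fun i hi => by
  simp only [h i hi, map_sum, map_mul]

end
section
variable {R : Type*} [CommRing R] [IsLocalRing R] [IsNoetherianRing R] {n : ℕ} {y : ℕ → R}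

theorem RegPar.wp_notMem (hy : RegPar y n) {w : ℕ → R} (hw : RegSeq w n)
    (hwm : ∀ j < n, w j ∈ maximalIdeal R) {c : ℕ → Fin n → R}
    (hc : Expr (fun j : Fin n => y j) w c n) : wp c n Finset.univ ∉ Id w n := by
  intro h
  obtain ⟨N, hN⟩ := hy.exists_pow_le hw hwm
  obtain ⟨v, -, hv, hvm⟩ := exists_socle (N := Id w n) (N' := ⊤)
    (fun h => (Id_le fun j hj => hwm j hj : Id w n ≤ maximalIdeal R).trans_lt
      (lt_top_iff_ne_top.mpr (Ideal.IsPrime.ne_top inferInstance)) |>.ne (top_le_iff.mp h))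
    (k := N) (fun r hr v _ => Ideal.mul_mem_right _ _ (hN hr))
  obtain ⟨s, hs⟩ := socle_of_forall_mul_mem (acyclic_of_regSeq hy.regSeq) hw hc
    fun j => hvm _ (hy.mem j.2)
  exact hv (by simpa using Ideal.add_mem _ hs ((Id w n).mul_mem_left s h))

theorem Ladder.false {C : Type*} [CommRing C] (L : Ladder C n) (φ : C →+* R) (hy : RegPar y n)
    (hφ : ∀ j < n, φ (L.Y j) = y j) {p : ℕ} [Fact p.Prime] (hp : (p : R) = 0) : False := by
  obtain ⟨d, δ, T, N, k, Y, w, a, c, A, T₀, u, b, r, r', t', hd, hT, hk, ha, hN, hA, h0, hl, hc,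
    hr, hu⟩ := L
  simp only at hφ
  have hY : (fun j : Fin n => φ (Y j)) = fun j : Fin n => y j := funext fun j => hφ j j.2
  set w' := fun j => φ (w j) with hw'
  have ha' : Expr (fun j : Fin n => y j) w' _ n := hY ▸ ha.map φ
  have hw'm : ∀ j < n, w' j ∈ maximalIdeal R := fun j hj => by
    rw [ha' j hj]
    exact Ideal.sum_mem _ fun i _ => Ideal.mul_mem_left _ _ (hy.mem i.2)
  have hdn : d ≤ n := by omega
  obtain ⟨M, hM⟩ : ∃ M, maximalIdeal R ^ M ≤ Id w' n :=
    exists_pow_le_of_pow_mem (w := y) (m := maximalIdeal R) (N := 1) (by rw [hy.span, pow_one])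
      fun j hj => ⟨N, by simpa [hφ j hj] using map_mem_Id φ (hN j hj)⟩
  have hreg := hy.regSeq_of_pow_le hw'm hM
  have hpm : ∀ k : ℕ, 0 < k → (∀ j < n, powFrom w' d k j ∈ maximalIdeal R) := fun k hk j hj => by
    unfold powFrom; split_ifs
    · exact hw'm j hj
    · exact Ideal.pow_mem_of_mem _ (hw'm j hj) k hk
  obtain ⟨M', hM'⟩ : ∃ M, maximalIdeal R ^ M ≤ Id (powFrom w' d k) n :=
    exists_pow_le_of_pow_mem hM fun j hj => by
      by_cases hjd : j < d
      · exact ⟨1, by simpa [powFrom, hjd] using mem_Id (w := powFrom w' d k) hj⟩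
      · exact ⟨k, by simpa [powFrom, hjd] using mem_Id (w := powFrom w' d k) hj⟩
  have hreg' := hy.regSeq_of_pow_le (hpm k hk) hM'
  have hIdle : Id w' d ≤ Id (powFrom w' d k) n := Id_powFrom_left w' d k ▸ Id_mono _ hdn
  have hc' : Expr (fun j : Fin n => y j) (powFrom w' d k) (fun i j => φ (c i j)) n := by
    have := hc.map φ
    rw [hY] at this
    intro i hi
    exact (map_powFrom φ w d k i).symm.trans (this i hi)
  have hr1 : IsUnit (φ r) := IsUnit.of_mul_eq_one (φ r') (by rw [← map_mul, hr, map_one])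
  have hu' : φ u ∉ Id w' d := by
    intro hu'
    have h1 := map_mem_Id φ hu
    rw [map_sub, map_mul, map_mul, ringHom_wp, funext (map_powFrom φ w d k)] at h1
    have h2 := Ideal.sub_mem _ (Ideal.mul_mem_left _ (φ b) (hIdle hu')) h1
    rw [sub_sub_cancel, Ideal.unit_mul_mem_iff_mem _ hr1] at h2
    exact hy.wp_notMem hreg' (hpm k hk) hc' h2
  obtain ⟨𝔭, t, h𝔭, h𝔭u, h𝔭t⟩ := exists_assI_mul hu'
  have hJ𝔭 : Id w' d ≤ 𝔭 := fun r hr => (h𝔭u r).mpr (Ideal.mul_mem_right _ _ hr)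
  refine false_of_ladder (hy.mem_minimalPrimes (hreg.mono hdn)
    (fun j hj => hw'm j (hj.trans_le hdn)) ⟨h𝔭, _, h𝔭u⟩) h𝔭u (p := p) (by rw [hp]; exact 𝔭.zero_mem)
    (Y := fun j : Fin n => y j) (fun j => hy.mem j.2)
    (δ := δ) (z := fun j => w' (d + j) ^ T) (fun q hq i hi r hr => ?_) (A := fun i U => φ (A i U))
    (fun U => h𝔭t _ ?_) (T₀ := T₀) ?_ fun i hi U => ?_
  · simp only [← pow_mul] at hr ⊢
    exact hy.regular_pow hw'm hM hd (Nat.mul_pos hT hq) i hi r hr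
  · simpa using map_mem_Id φ (hA U)
  · intro h
    refine (Ideal.IsPrime.ne_top (inferInstance : (maximalIdeal R).IsPrime)) ?_
    rw [Ideal.eq_top_iff_one, ← map_one φ, ← h0, map_mul]
    exact Ideal.mul_mem_right _ _ h
  · have h1 := map_mem_Id φ (hl i hi U)
    rw [funext (map_powFrom φ w d T), Id_powFrom] at h1
    refine sup_le_sup_right hJ𝔭 _ ?_
    rw [Pi.sub_apply, map_sub, ringHom_wedge', hY] at h1
    simpa using h1

end

section
variable {R : Type*} [CommRing R] [IsLocalRing R] [IsNoetherianRing R] {n : ℕ} {y : ℕ → R}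

theorem RegPar.exists_ladder (hy : RegPar y n) {w : ℕ → R} {d δ T : ℕ} {u : R} {𝔭 : Ideal R}
    (hw : RegSeq w n) (hwm : ∀ j < n, w j ∈ maximalIdeal R) (hδ : d + δ = n) (hT : 0 < T)
    (hu : ∀ r ∈ 𝔭, r * u ∈ Id w d) (huJ : u ∉ Id w d) {A : ℕ → KV n R} {T₀ : Finset (Fin n)}
    (hA : In 𝔭 (A δ)) (hA₀ : A 0 T₀ ∉ maximalIdeal R)
    (hl : ∀ i < δ, In (Id w d ⊔ Id (fun j => w (d + j) ^ T) i)
        (wedge (fun j : Fin n => y j) (A (i + 1)) - w (d + i) ^ T • A i)) :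
    ∃ L : Ladder R n, L.Y = y := by
  obtain ⟨N, hN⟩ := hy.exists_pow_le hw hwm
  obtain ⟨k₀, hk₀⟩ := exists_notMem_ideal_sup_pow huJ
  have hpm : ∀ j < n, powFrom w d (k₀ + 1) j ∈ maximalIdeal R := fun j hj => by
    unfold powFrom
    split_ifs
    · exact hwm j hj
    · exact Ideal.pow_mem_of_mem _ (hwm j hj) _ k₀.succ_pos
  obtain ⟨M, hM⟩ : ∃ M, maximalIdeal R ^ M ≤ Id (powFrom w d (k₀ + 1)) n :=
    exists_pow_le_of_pow_mem hN fun j hj => by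
      by_cases hjd : j < d
      · exact ⟨1, by simpa [powFrom, hjd] using mem_Id (w := powFrom w d (k₀ + 1)) hj⟩
      · exact ⟨k₀ + 1, by simpa [powFrom, hjd] using mem_Id (w := powFrom w d (k₀ + 1)) hj⟩
  have hreg := hy.regSeq_of_pow_le hpm hM
  have huK : u ∉ Id (powFrom w d (k₀ + 1)) n := fun h => hk₀ (by
    refine Id_le (I := Id w d ⊔ maximalIdeal R ^ k₀) (fun j hj => ?_) h
    unfold powFrom
    split_ifs with hjd
    · exact Ideal.mem_sup_left (mem_Id hjd)
    · exact Ideal.mem_sup_right (Ideal.pow_le_pow_right k₀.le_succ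
        (Ideal.pow_mem_pow (hwm j hj) _)))
  obtain ⟨t, htu, htK, htm⟩ := exists_socle (N := Id (powFrom w d (k₀ + 1)) n)
    (N' := Ideal.span {u}) (fun h => huK (h (Ideal.mem_span_singleton_self u))) (k := M)
    fun r hr v _ => Ideal.mul_mem_right _ _ (hM hr)
  obtain ⟨b, rfl⟩ := Ideal.mem_span_singleton'.mp htu
  obtain ⟨a, ha⟩ := exists_expr hy.span w
  obtain ⟨c, hc⟩ := exists_expr hy.span (powFrom w d (k₀ + 1))
  have hc' : Expr (fun j : Fin n => y j) (powFrom w d (k₀ + 1)) c n :=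
    fun i hi => hc i (hpm i hi)
  obtain ⟨r, hr⟩ := socle_of_forall_mul_mem (acyclic_of_regSeq hy.regSeq) hreg hc'
    fun j => htm _ (hy.mem j.2)
  have hru : IsUnit r := by
    by_contra hru
    obtain ⟨e, he⟩ := exists_coeff (hy.span ▸ hru : r ∈ Id y n)
    refine htK ((Submodule.sub_mem_iff_left _ ?_).mp hr)
    rw [he, Finset.sum_mul]
    refine Ideal.sum_mem _ fun j hj => ?_
    rw [mul_assoc]
    exact Ideal.mul_mem_left _ _ (mul_wp_mem hc' ⟨j, Finset.mem_range.mp hj⟩ Finset.univ)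
  obtain ⟨r', hr'⟩ := hru.exists_right_inv
  obtain ⟨t', ht'⟩ := (not_not.mp hA₀ : IsUnit (A 0 T₀)).exists_right_inv
  exact ⟨{
    d := d, δ := δ, T := T, N := N, k := k₀ + 1, Y := y, w := w, a := a, c := c, A := A
    T₀ := T₀, u := u, b := b, r := r, r' := r', t' := t', hd := hδ, hT := hT, hk := k₀.succ_pos
    ha := fun i hi => ha i (hwm i hi)
    hN := fun j hj => hN (Ideal.pow_mem_pow (hy.mem hj) N)
    hA := fun U => hu _ (hA U)
    h0 := ht'
    hl := fun i hi => by rw [Id_powFrom]; exact hl i hi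
    hc := hc', hr := hr', hu := hr }, rfl⟩

end

section
open Filter
variable {R : Type*} [CommRing R] {n : ℕ}

open Classical in
/-- The element `r` as an element of the subring `C` (zero if `r ∉ C`). -/
noncomputable def lft (C : Subring R) (r : R) : C := if h : r ∈ C then ⟨r, h⟩ else 0

lemma coe_lft {C : Subring R} {r : R} (h : r ∈ C) : C.subtype (lft C r) = r := by simp [lft, h]

lemma subtype_mem {C : Subring R} (r : C) : C.subtype r ∈ C := r.2

lemma eventually_mem_closure (r : R) :
    ∀ᶠ S : Finset R in atTop, r ∈ Subring.closure (S : Set R) :=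
  (eventually_ge_atTop {r}).mono fun _ hS => Subring.subset_closure (hS (by simp))

lemma eventually_lft_mem_Id {w : ℕ → R} {k : ℕ} {r : R} (h : r ∈ Id w k) :
    ∀ᶠ S : Finset R in atTop, lft (Subring.closure (S : Set R)) r ∈
      Id (fun j => lft (Subring.closure (S : Set R)) (w j)) k := by
  obtain ⟨c, hc⟩ := exists_coeff h
  filter_upwards [eventually_mem_closure r,
    (eventually_all_finset (Finset.range k)).mpr fun j _ => eventually_mem_closure (w j),
    (eventually_all_finset (Finset.range k)).mpr fun j _ => eventually_mem_closure (c j)]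
    with S hr hw hc'
  have : lft (Subring.closure (S : Set R)) r = ∑ j ∈ Finset.range k,
      lft (Subring.closure (S : Set R)) (c j) * lft (Subring.closure (S : Set R)) (w j) := by
    apply Subring.subtype_injective
    rw [coe_lft hr, map_sum, hc]
    refine Finset.sum_congr rfl fun j hj => ?_
    rw [map_mul, coe_lft (hw j hj), coe_lft (hc' j hj)]
  rw [this]
  exact Ideal.sum_mem _ fun j hj =>
    Ideal.mul_mem_left _ _ (mem_Id (w := fun j => lft _ (w j)) (Finset.mem_range.mp hj))

lemma lft_powFrom {C : Subring R} {w : ℕ → R} {j : ℕ} (h : w j ∈ C) (d k : ℕ) :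
    lft C (powFrom w d k j) = powFrom (fun j => lft C (w j)) d k j := by
  apply Subring.subtype_injective
  rw [map_powFrom, coe_lft]
  · simp only [powFrom]
    rw [coe_lft h]
  · unfold powFrom
    split_ifs
    exacts [h, pow_mem h _]

lemma eventually_lft_mem_Id_powFrom {w : ℕ → R} {d k i : ℕ} {r : R}
    (h : r ∈ Id (powFrom w d k) i) :
    ∀ᶠ S : Finset R in atTop, lft (Subring.closure (S : Set R)) r ∈
      Id (powFrom (fun j => lft (Subring.closure (S : Set R)) (w j)) d k) i := by
  filter_upwards [eventually_lft_mem_Id h,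
    (eventually_all_finset (Finset.range i)).mpr fun j _ => eventually_mem_closure (w j)]
    with S hr hw
  rwa [Id_congr fun j hj => lft_powFrom (hw j (Finset.mem_range.mpr hj)) d k] at hr

lemma eventually_expr_lft {y : Fin n → R} {w : ℕ → R} {a : ℕ → Fin n → R} {k : ℕ}
    (h : Expr y w a k) : ∀ᶠ S : Finset R in atTop,
      Expr (fun j => lft (Subring.closure (S : Set R)) (y j))
        (fun j => lft (Subring.closure (S : Set R)) (w j))
        (fun i j => lft (Subring.closure (S : Set R)) (a i j)) k := by
  filter_upwards [eventually_all.mpr fun j => eventually_mem_closure (y j),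
    (eventually_all_finset (Finset.range k)).mpr fun j _ => eventually_mem_closure (w j),
    (eventually_all_finset (Finset.range k)).mpr fun i _ => eventually_all.mpr fun j =>
      eventually_mem_closure (a i j)] with S hy hw ha i hi
  have hi' := Finset.mem_range.mpr hi
  apply Subring.subtype_injective
  simp only [map_sum, map_mul]
  rw [coe_lft (hw i hi'), h i hi]
  exact Finset.sum_congr rfl fun j _ => by rw [coe_lft (ha i hi' j), coe_lft (hy j)]

/-- Equational data over `R` descends to a finitely generated subring. -/
theorem Ladder.eventually_closure (L : Ladder R n) : ∀ᶠ S : Finset R in atTop,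
    ∃ L' : Ladder (Subring.closure (S : Set R)) n, ∀ j < n, (L'.Y j : R) = L.Y j := by
  obtain ⟨d, δ, T, N, k, Y, w, a, c, A, T₀, u, b, r, r', t', hd, hT, hk, ha, hN, hA, h0, hl, hc,
    hr, hu⟩ := L
  have hdn : d ≤ n := by omega
  filter_upwards [eventually_expr_lft ha,
    (eventually_all_finset (Finset.range n)).mpr fun j hj =>
      eventually_lft_mem_Id (hN j (Finset.mem_range.mp hj)),
    eventually_all.mpr fun U => eventually_lft_mem_Id (hA U),
    (eventually_all_finset (Finset.range δ)).mpr fun i hi => eventually_all.mpr fun U =>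
      eventually_lft_mem_Id_powFrom (hl i (Finset.mem_range.mp hi) U),
    eventually_expr_lft hc, eventually_lft_mem_Id_powFrom hu,
    (eventually_all_finset (Finset.range n)).mpr fun j _ => eventually_mem_closure (Y j),
    (eventually_all_finset (Finset.range n)).mpr fun j _ => eventually_mem_closure (w j),
    (eventually_all_finset (Finset.range (δ + 1))).mpr fun i _ => eventually_all.mpr fun U =>
      eventually_mem_closure (A i U),
    (eventually_all_finset (Finset.range n)).mpr fun i _ => eventually_all.mpr fun j =>
      eventually_mem_closure (c i j),
    eventually_mem_closure u, eventually_mem_closure b, eventually_mem_closure r,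
    eventually_mem_closure r', eventually_mem_closure t'] with S h1 h2 h3 h4 h5 h6 hY hw hA' hc' hu'
    hb' hr1 hr2 ht'
  simp only [Finset.mem_range] at h2 h4 hY hw hA' hc'
  set C := Subring.closure (S : Set R)
  have inj := Subring.subtype_injective C
  refine ⟨{
    d := d, δ := δ, T := T, N := N, k := k, Y := fun j => lft C (Y j), w := fun j => lft C (w j)
    a := fun i j => lft C (a i j), c := fun i j => lft C (c i j), A := fun i U => lft C (A i U)
    T₀ := T₀, u := lft C u, b := lft C b, r := lft C r, r' := lft C r', t' := lft C t'
    hd := hd, hT := hT, hk := hk, ha := h1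
    hN := fun j hj => ?_
    hA := fun U => ?_
    h0 := ?_
    hl := fun i hi U => ?_
    hc := fun i hi => ?_
    hr := ?_
    hu := ?_ }, fun j hj => coe_lft (hY j hj)⟩
  · convert h2 j hj using 1
    apply inj
    rw [map_pow, coe_lft (hY j hj), coe_lft (pow_mem (hY j hj) N)]
  · convert h3 U using 1
    apply inj
    rw [map_mul, coe_lft (hA' δ (by omega) U), coe_lft hu', coe_lft]
    exact mul_mem (hA' δ (by omega) U) hu'
  · apply inj
    rw [map_mul, coe_lft (hA' 0 (by omega) T₀), coe_lft ht', h0, map_one]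
  · convert h4 i hi U using 1
    have key : C.subtype ((wedge (fun j : Fin n => lft C (Y j)) (fun U => lft C (A (i + 1) U)) -
        lft C (w (d + i)) ^ T • fun U => lft C (A i U)) U) =
        (wedge (fun j : Fin n => Y j) (A (i + 1)) - w (d + i) ^ T • A i) U := by
      simp only [Pi.sub_apply, Pi.smul_apply, smul_eq_mul, map_sub, map_mul, map_pow]
      rw [ringHom_wedge', coe_lft (hw _ (by omega)), coe_lft (hA' i (by omega) U)]
      have e1 : (fun j : Fin n => C.subtype (lft C (Y j))) = fun j : Fin n => Y j :=
        funext fun j => coe_lft (hY j j.2)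
      have e2 : (fun U => C.subtype (lft C (A (i + 1) U))) = A (i + 1) :=
        funext fun U => coe_lft (hA' (i + 1) (by omega) U)
      rw [e1, e2]
    apply inj
    rw [key, coe_lft]
    rw [← key]
    exact subtype_mem _
  · rw [← lft_powFrom (hw i hi)]
    exact h5 i hi
  · apply inj
    rw [map_mul, coe_lft hr1, coe_lft hr2, hr, map_one]
  · convert h6 using 1
    have key : C.subtype (lft C b * lft C u - lft C r * wp (fun i j => lft C (c i j)) n
        Finset.univ) = b * u - r * wp c n Finset.univ := by
      simp only [map_sub, map_mul]
      rw [ringHom_wp, coe_lft hb', coe_lft hu', coe_lft hr1]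
      rw [wp_congr fun i hi => funext fun j => coe_lft (hc' i hi j)]
    apply inj
    rw [key, coe_lft]
    rw [← key]
    exact subtype_mem _
end

section
open Polynomial

lemma exists_pseudo_div {D : Type*} [CommRing D] [IsDomain D] {f : D[X]} (hf : f ≠ 0) (h : D[X]) :
    ∃ (N : ℕ) (q r : D[X]), C f.leadingCoeff ^ N * h = f * q + r ∧ r.degree < f.degree := by
  induction hn : h.degree using WellFounded.induction (wellFounded_lt (α := WithBot ℕ))
    generalizing h with
  | _ n ih =>
    by_cases hlt : h.degree < f.degree
    · exact ⟨0, 0, h, by simp, hlt⟩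
    · push Not at hlt
      have hh : h ≠ 0 := by
        rintro rfl
        simp [hf] at hlt
      have hlc : f.leadingCoeff ≠ 0 := leadingCoeff_ne_zero.mpr hf
      have hd := degree_sub_lt (p := C f.leadingCoeff * h)
        (q := C h.leadingCoeff * X ^ (h.natDegree - f.natDegree) * f) (by
          rw [degree_mul, degree_mul, degree_mul, degree_C hlc,
            degree_C (leadingCoeff_ne_zero.mpr hh), degree_X_pow, degree_eq_natDegree hf,
            degree_eq_natDegree hh, zero_add, zero_add, ← Nat.cast_add,
            Nat.sub_add_cancel (natDegree_le_natDegree hlt)]) (mul_ne_zero (C_ne_zero.mpr hlc) hh) (by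
          rw [leadingCoeff_mul, leadingCoeff_mul, leadingCoeff_mul, leadingCoeff_C, leadingCoeff_C,
            leadingCoeff_X_pow, mul_one, mul_comm])
      rw [degree_mul, degree_C hlc, zero_add] at hd
      obtain ⟨N, q, r, he, hr⟩ := ih _ (hn ▸ hd) _ rfl
      refine ⟨N + 1, q + C f.leadingCoeff ^ N * (C h.leadingCoeff *
        X ^ (h.natDegree - f.natDegree)), r, ?_, hr⟩
      linear_combination he

/-- A finitely generated algebraic extension of domains of characteristic zero is generically
presented by a single separable equation. -/
theorem exists_generic_presentation {D B ι : Type*} [CommRing D] [CommRing B] [IsDomain D]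
    [IsDomain B] [Algebra D B] [FaithfulSMul D B] [Algebra.IsAlgebraic D B] [CharZero D]
    [Finite ι] (c : ι → B) (hc : Algebra.adjoin D (Set.range c) = ⊤) :
    ∃ (θ : B) (f : D[X]) (E : D) (G : ι → D[X]), aeval θ f = 0 ∧ aeval θ (derivative f) ≠ 0 ∧
      E ≠ 0 ∧ (∀ i, algebraMap D B E * c i = aeval θ (G i)) ∧ f.leadingCoeff ∣ E ∧
      ∀ h : D[X], aeval θ h = 0 → h.degree < f.degree → h = 0 := by
  cases nonempty_fintype ι
  classical
  let K := FractionRing D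
  let L := FractionRing B
  letI : Algebra K L := FractionRing.liftAlgebra D L
  have : IsScalarTower D K L := FractionRing.isScalarTower_liftAlgebra D L
  have : Algebra.IsAlgebraic K L := by
    have := (IsFractionRing.isAlgebraic_iff' D B L).1 inferInstance
    exact ⟨fun x => (IsFractionRing.isAlgebraic_iff D K L).1 (Algebra.IsAlgebraic.isAlgebraic x)⟩
  have : CharZero K := charZero_of_injective_algebraMap (IsFractionRing.injective D K)
  have hinj : Function.Injective (algebraMap B L) := IsFractionRing.injective B L
  have htop : IntermediateField.adjoin K (Set.range fun i => algebraMap B L (c i)) = ⊤ := by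
    rw [eq_top_iff]
    have key : ∀ x : B, algebraMap B L x ∈
        IntermediateField.adjoin K (Set.range fun i => algebraMap B L (c i)) := fun x => by
      have hx : x ∈ Algebra.adjoin D (Set.range c) := hc ▸ Algebra.mem_top
      induction hx using Algebra.adjoin_induction with
      | mem x hx =>
        obtain ⟨i, rfl⟩ := hx
        exact IntermediateField.subset_adjoin _ _ ⟨i, rfl⟩
      | algebraMap d =>
        rw [← IsScalarTower.algebraMap_apply D B L, IsScalarTower.algebraMap_apply D K L]
        exact IntermediateField.algebraMap_mem _ _
      | add x y _ _ hx hy => rw [map_add]; exact add_mem hx hy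
      | mul x y _ _ hx hy => rw [map_mul]; exact mul_mem hx hy
    intro z _
    obtain ⟨a, b, hb, rfl⟩ := IsFractionRing.div_surjective (A := B) z
    exact div_mem (key a) (key b)
  have hfd : FiniteDimensional K L := by
    have h1 : FiniteDimensional K
        (IntermediateField.adjoin K (Set.range fun i => algebraMap B L (c i))) :=
      IntermediateField.finiteDimensional_adjoin fun x _ => Algebra.IsIntegral.isIntegral x
    rw [htop] at h1
    exact h1.equiv IntermediateField.topEquiv.toLinearEquiv
  obtain ⟨α, hα⟩ := Field.exists_primitive_element K L
  obtain ⟨a, b, hb, rfl⟩ := IsFractionRing.div_surjective (A := B) α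
  obtain ⟨e, he, b', hbe⟩ := (Algebra.IsAlgebraic.isAlgebraic (R := D) b).exists_nonzero_dvd hb
  have hb0 : algebraMap B L b ≠ 0 := by
    simpa using nonZeroDivisors.ne_zero hb
  have hθ : IntermediateField.adjoin K {algebraMap B L (a * b')} = ⊤ := by
    rw [eq_top_iff, ← hα, IntermediateField.adjoin_simple_le_iff]
    have h1 : algebraMap B L a / algebraMap B L b =
        algebraMap B L (a * b') / algebraMap K L (algebraMap D K e) := by
      rw [← IsScalarTower.algebraMap_apply D K L, IsScalarTower.algebraMap_apply D B L, hbe,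
        map_mul, map_mul, mul_div_mul_right]
      intro h0
      rw [map_eq_zero_iff _ hinj] at h0
      rw [h0, mul_zero, map_eq_zero_iff _ (FaithfulSMul.algebraMap_injective D B)] at hbe
      exact he hbe
    rw [h1]
    exact div_mem (IntermediateField.mem_adjoin_simple_self _ _)
      (IntermediateField.algebraMap_mem _ _)
  set θ := a * b' with hθdef
  have h_integral : IsIntegral K (algebraMap B L θ) := Algebra.IsIntegral.isIntegral _
  have haev : ∀ h : D[X], aeval (algebraMap B L θ) (h.map (algebraMap D K)) =
      algebraMap B L (aeval θ h) := fun h => by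
    rw [aeval_map_algebraMap, aeval_algebraMap_apply]
  obtain ⟨s, hs⟩ := IsLocalization.integerNormalization_map_to_map (nonZeroDivisors D)
    (minpoly K (algebraMap B L θ))
  set f := IsLocalization.integerNormalization (nonZeroDivisors D) (minpoly K (algebraMap B L θ))
  have hs0 : algebraMap D K s ≠ 0 := by
    simpa using nonZeroDivisors.ne_zero s.2
  have hs' : f.map (algebraMap D K) = C (algebraMap D K s) * minpoly K (algebraMap B L θ) := by
    rw [hs, Algebra.smul_def, Polynomial.algebraMap_apply]
  have hKinj : Function.Injective (algebraMap D K) := IsFractionRing.injective D K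
  have hdeg : f.degree = (minpoly K (algebraMap B L θ)).degree := by
    rw [← degree_map_eq_of_injective hKinj f, hs', degree_mul, degree_C hs0, zero_add]
  have hf0 : f ≠ 0 := by
    rintro h0
    rw [h0, Polynomial.map_zero, eq_comm, mul_eq_zero] at hs'
    exact hs'.elim (by simpa using hs0) (minpoly.ne_zero h_integral)
  have hG : ∀ i, ∃ (e : D) (g : D[X]), e ≠ 0 ∧ algebraMap D B e * c i = aeval θ g := fun i => by
    have h1 : algebraMap B L (c i) ∈ IntermediateField.adjoin K {algebraMap B L θ} :=
      hθ ▸ IntermediateField.mem_top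
    rw [← IntermediateField.mem_toSubalgebra,
      IntermediateField.adjoin_simple_toSubalgebra_of_isAlgebraic h_integral.isAlgebraic,
      Algebra.adjoin_singleton_eq_range_aeval] at h1
    obtain ⟨g, hg⟩ := h1
    obtain ⟨b, hb⟩ := IsLocalization.integerNormalization_map_to_map (nonZeroDivisors D) g
    refine ⟨b, IsLocalization.integerNormalization (nonZeroDivisors D) g,
      nonZeroDivisors.ne_zero b.2, hinj ?_⟩
    have hg' : aeval (algebraMap B L θ) g = algebraMap B L (c i) := hg
    have hb' : algebraMap B L (algebraMap D B b) = algebraMap K L (algebraMap D K b) := by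
      rw [← IsScalarTower.algebraMap_apply D K L, ← IsScalarTower.algebraMap_apply D B L]
    rw [← haev, hb, Algebra.smul_def, Polynomial.algebraMap_apply, map_mul, map_mul, aeval_C,
      hg', hb']
  choose e' g he' hg using hG
  refine ⟨θ, f, f.leadingCoeff * ∏ i, e' i,
    fun i => C (f.leadingCoeff * ∏ j ∈ Finset.univ.erase i, e' j) * g i, ?_, ?_, ?_, fun i => ?_,
    dvd_mul_right _ _, fun h hh hd => ?_⟩
  · apply hinj
    rw [← haev, hs', map_mul, minpoly.aeval, mul_zero, map_zero]
  · intro h0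
    have h1 := congrArg (algebraMap B L) h0
    rw [← haev, ← derivative_map, hs', derivative_C_mul, map_mul, aeval_C, map_zero,
      mul_eq_zero] at h1
    refine h1.elim (by simpa using hs0) ?_
    exact (Algebra.IsSeparable.isSeparable K (algebraMap B L θ)).aeval_derivative_ne_zero
      (minpoly.aeval _ _)
  · exact mul_ne_zero (leadingCoeff_ne_zero.mpr hf0) (Finset.prod_ne_zero_iff.mpr fun i _ => he' i)
  · rw [map_mul (aeval θ), aeval_C, ← hg, ← mul_assoc, ← map_mul, mul_assoc,
      Finset.prod_erase_mul _ _ (Finset.mem_univ i)]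
  · apply Polynomial.map_injective _ hKinj
    rw [Polynomial.map_zero]
    by_contra h0
    have h1 := minpoly.degree_le_of_ne_zero K (algebraMap B L θ) h0 (by rw [haev, hh, map_zero])
    rw [degree_map_eq_of_injective hKinj, ← hdeg] at h1
    exact h1.not_gt hd
end

section
open Polynomial

/-- Evaluation of an integral polynomial. -/
noncomputable def evp {σ Λ : Type*} [CommRing Λ] (t : σ → Λ) : MvPolynomial σ ℤ →+* Λ :=
  MvPolynomial.eval₂Hom (Int.castRingHom Λ) t

/-- Evaluation of a polynomial with integral polynomials as coefficients. -/
noncomputable def evq {σ Λ : Type*} [CommRing Λ] (t : σ → Λ) (θ : Λ) :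
    (MvPolynomial σ ℤ)[X] →+* Λ :=
  eval₂RingHom (evp t) θ

lemma evp_X {σ Λ : Type*} [CommRing Λ] (t : σ → Λ) (i : σ) : evp t (MvPolynomial.X i) = t i := by
  simp [evp]

lemma evq_C {σ Λ : Type*} [CommRing Λ] (t : σ → Λ) (θ : Λ) (p : MvPolynomial σ ℤ) :
    evq t θ (C p) = evp t p := by simp [evq]

lemma map_evp {σ Λ Λ' : Type*} [CommRing Λ] [CommRing Λ'] (φ : Λ →+* Λ') (t : σ → Λ)
    (p : MvPolynomial σ ℤ) : φ (evp t p) = evp (fun i => φ (t i)) p := by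
  have : φ.comp (evp t) = evp fun i => φ (t i) := by
    apply MvPolynomial.ringHom_ext
    · simp
    · simp [evp]
  exact congrArg (fun g => g p) this

lemma map_evq {σ Λ Λ' : Type*} [CommRing Λ] [CommRing Λ'] (φ : Λ →+* Λ') (t : σ → Λ) (θ : Λ)
    (h : (MvPolynomial σ ℤ)[X]) : φ (evq t θ h) = evq (fun i => φ (t i)) (φ θ) h := by
  have : φ.comp (evq t θ) = evq (fun i => φ (t i)) (φ θ) := by
    apply Polynomial.ringHom_ext
    · intro p
      simp only [RingHom.comp_apply, evq_C, map_evp]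
    · simp [evq]
  exact congrArg (fun g => g h) this

lemma exists_clear_denominators {σ ι : Type u} (E : MvPolynomial σ ℤ)
    (G : ι → (MvPolynomial σ ℤ)[X]) (H : MvPolynomial ι ℤ) :
    ∃ (N : ℕ) (h : (MvPolynomial σ ℤ)[X]), ∀ (Λ : Type u) [CommRing Λ] (t : σ → Λ) (θ : Λ)
      (c : ι → Λ), (∀ i, evp t E * c i = evq t θ (G i)) → evp t E ^ N * evp c H = evq t θ h := by
  induction H using MvPolynomial.induction_on with
  | C a => exact ⟨0, (a : (MvPolynomial σ ℤ)[X]), fun Λ _ t θ c hc => by simp [evp]⟩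
  | add p q hp hq =>
    obtain ⟨N, h, hN⟩ := hp
    obtain ⟨N', h', hN'⟩ := hq
    refine ⟨N + N', C E ^ N' * h + C E ^ N * h', fun Λ _ t θ c hc => ?_⟩
    simp only [map_add, map_mul, map_pow, evq_C, ← hN Λ t θ c hc, ← hN' Λ t θ c hc]
    ring
  | mul_X p i hp =>
    obtain ⟨N, h, hN⟩ := hp
    refine ⟨N + 1, h * G i, fun Λ _ t θ c hc => ?_⟩
    simp only [map_mul, ← hN Λ t θ c hc, ← hc i, evp_X]
    ring

lemma isAlgebraic_of_isTranscendenceBasis {B : Type u} [CommRing B] [IsDomain B]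
    {s : Set B} [Algebra (MvPolynomial s ℤ) B]
    (hmap : ∀ p, algebraMap (MvPolynomial s ℤ) B p = MvPolynomial.aeval (Subtype.val : s → B) p)
    (htb : IsTranscendenceBasis ℤ (Subtype.val : s → B)) :
    Algebra.IsAlgebraic (MvPolynomial s ℤ) B := by
  have := htb.isAlgebraic
  refine Algebra.IsAlgebraic.of_ringHom_of_comp_eq
    (htb.1.aevalEquiv : MvPolynomial s ℤ ≃ₐ[ℤ] _) (RingHom.id B) htb.1.aevalEquiv.surjective
    (fun _ _ h => h) ?_
  ext x
  · simp
  · simp [hmap, Subalgebra.algebraMap_def]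

/-- A finitely generated domain of characteristic zero is generically presented by one separable
equation over a polynomial ring. -/
theorem exists_specialization_data_of_adjoin_eq_top {B : Type u} [CommRing B] [IsDomain B]
    [CharZero B] {ι : Type u} [Finite ι] (c₀ : ι → B)
    (hc₀ : Algebra.adjoin ℤ (Set.range c₀) = ⊤) :
    ∃ (σ : Type u) (_ : Finite σ) (t : σ → B) (θ : B) (f : (MvPolynomial σ ℤ)[X])
      (E : MvPolynomial σ ℤ) (G : ι → (MvPolynomial σ ℤ)[X]),
      evq t θ f = 0 ∧ evq t θ (derivative f) ≠ 0 ∧ evp t E ≠ 0 ∧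
      (∀ i, evp t E * c₀ i = evq t θ (G i)) ∧ f.leadingCoeff ∣ E ∧
      ∀ h, evq t θ h = 0 → h.degree < f.degree → h = 0 := by
  have : Algebra.IsAlgebraic (Algebra.adjoin ℤ (Set.range c₀)) B := by
    refine ⟨fun x => ?_⟩
    exact isAlgebraic_algebraMap (⟨x, hc₀ ▸ Algebra.mem_top⟩ : Algebra.adjoin ℤ (Set.range c₀))
  obtain ⟨s, hs, htb⟩ := exists_isTranscendenceBasis_subset (R := ℤ) (A := B) (Set.range c₀)
  have hsf : Finite s := (Set.finite_range c₀).subset hs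
  letI : Algebra (MvPolynomial s ℤ) B :=
    (MvPolynomial.aeval (Subtype.val : s → B) : MvPolynomial s ℤ →ₐ[ℤ] B).toRingHom.toAlgebra
  have hmap : ∀ p, algebraMap (MvPolynomial s ℤ) B p =
    MvPolynomial.aeval (Subtype.val : s → B) p := fun p => rfl
  have hinj : Function.Injective (algebraMap (MvPolynomial s ℤ) B) := htb.1
  have : FaithfulSMul (MvPolynomial s ℤ) B := (faithfulSMul_iff_algebraMap_injective _ B).mpr hinj
  have : Algebra.IsAlgebraic (MvPolynomial s ℤ) B := isAlgebraic_of_isTranscendenceBasis hmap htb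
  have hgen : Algebra.adjoin (MvPolynomial s ℤ) (Set.range c₀) = ⊤ := by
    rw [eq_top_iff]
    intro x _
    have hx : x ∈ Algebra.adjoin ℤ (Set.range c₀) := hc₀ ▸ Algebra.mem_top
    induction hx using Algebra.adjoin_induction with
    | mem x hx => exact Algebra.subset_adjoin hx
    | algebraMap r =>
      rw [eq_intCast]
      exact intCast_mem _ _
    | add x y _ _ hx hy => exact add_mem (hx trivial) (hy trivial)
    | mul x y _ _ hx hy => exact mul_mem (hx trivial) (hy trivial)
  obtain ⟨θ, f, E, G, hf, hf', hE, hG, hlc, hmin⟩ :=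
    exists_generic_presentation (D := MvPolynomial s ℤ) c₀ hgen
  have hevp : ∀ p, algebraMap (MvPolynomial s ℤ) B p = evp (fun i : s => (i : B)) p := fun p => rfl
  have hevq : ∀ h : (MvPolynomial s ℤ)[X], aeval θ h = evq (fun i : s => (i : B)) θ h :=
    fun h => rfl
  simp only [hevp, hevq] at hf hf' hG hmin
  refine ⟨s, hsf, fun i => (i : B), θ, f, E, G, hf, hf', ?_, hG, hlc, hmin⟩
  rw [← hevp]
  exact (map_ne_zero_iff _ hinj).mpr hE

/-- A finitely generated domain of characteristic zero is generically presented by one separable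
equation over a polynomial ring. -/
theorem exists_specialization_data {R : Type u} [CommRing R] [IsDomain R] [CharZero R]
    {ι : Type u} [Finite ι] (c : ι → R) :
    ∃ (σ : Type u) (_ : Finite σ) (t : σ → R) (θ : R) (f : (MvPolynomial σ ℤ)[X])
      (E : MvPolynomial σ ℤ) (G : ι → (MvPolynomial σ ℤ)[X]),
      evq t θ f = 0 ∧ evq t θ (derivative f) ≠ 0 ∧ evp t E ≠ 0 ∧
      (∀ i, evp t E * c i = evq t θ (G i)) ∧
      ∀ (Λ : Type u) [CommRing Λ] [IsDomain Λ] (t' : σ → Λ) (θ' : Λ) (c' : ι → Λ),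
        evq t' θ' f = 0 → evp t' E ≠ 0 → (∀ i, evp t' E * c' i = evq t' θ' (G i)) →
        ∀ H : MvPolynomial ι ℤ, evp c H = 0 → evp c' H = 0 := by
  have hc₀ : Algebra.adjoin ℤ (Set.range fun i =>
      (⟨c i, Algebra.subset_adjoin ⟨i, rfl⟩⟩ : Algebra.adjoin ℤ (Set.range c))) = ⊤ := by
    have := Algebra.adjoin_adjoin_coe_preimage (R := ℤ) (s := Set.range c)
    convert this using 2
    ext x
    simp [Subtype.ext_iff]
  obtain ⟨σ, hσ, t, θ, f, E, G, hf, hf', hE, hG, hlc, hmin⟩ :=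
    exists_specialization_data_of_adjoin_eq_top _ hc₀
  obtain ⟨ρ, hρ, hρc⟩ : ∃ ρ : Algebra.adjoin ℤ (Set.range c) →+* R, Function.Injective ρ ∧
      ∀ i, ρ ⟨c i, Algebra.subset_adjoin ⟨i, rfl⟩⟩ = c i :=
    ⟨(Algebra.adjoin ℤ (Set.range c)).val.toRingHom, Subtype.val_injective, fun i => rfl⟩
  have hG' : ∀ i, evp (fun i => ρ (t i)) E * c i = evq (fun i => ρ (t i)) (ρ θ) (G i) := fun i => by
    rw [← map_evq, ← hG, map_mul, map_evp, hρc]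
  refine ⟨σ, hσ, fun i => ρ (t i), ρ θ, f, E, G, ?_, ?_, ?_, hG', ?_⟩
  · rw [← map_evq, hf, map_zero]
  · rw [← map_evq]
    exact (map_ne_zero_iff _ hρ).mpr hf'
  · rw [← map_evp]
    exact (map_ne_zero_iff _ hρ).mpr hE
  · intro Λ _ _ t' θ' c' hf0 hE0 hG0 H hH
    obtain ⟨N, h, hN⟩ := exists_clear_denominators E G H
    have h1 := hN R (fun i => ρ (t i)) (ρ θ) c hG'
    rw [hH, mul_zero, ← map_evq, eq_comm, map_eq_zero_iff ρ hρ] at h1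
    have hf00 : f ≠ 0 := by
      rintro rfl
      simp at hf'
    obtain ⟨M, q, r, hq, hr⟩ := exists_pseudo_div hf00 h
    have hr0 : r = 0 := hmin r (by
      have := congrArg (evq t θ) hq
      rw [map_mul, map_add, map_mul, hf, h1] at this
      simpa using this.symm) hr
    have h2 := congrArg (evq t' θ') hq
    rw [hr0, add_zero, map_mul, map_mul, hf0, zero_mul, map_pow, evq_C, mul_eq_zero] at h2
    have hlc0 : evp t' f.leadingCoeff ≠ 0 := by
      obtain ⟨z, hz⟩ := hlc
      intro h0
      rw [hz, map_mul, h0, zero_mul] at hE0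
      exact hE0 rfl
    have h3 := h2.resolve_left (pow_ne_zero _ hlc0)
    rw [← hN Λ t' θ' c' hG0] at h3
    exact (mul_eq_zero.mp h3).resolve_left (pow_ne_zero _ hE0)

/-- A ring homomorphism out of a finitely generated subring, from the relations. -/
theorem exists_ringHom_closure {R Λ ι : Type*} [CommRing R] [CommRing Λ] (c : ι → R) (c' : ι → Λ)
    (h : ∀ H : MvPolynomial ι ℤ, evp c H = 0 → evp c' H = 0) :
    ∃ φ : Subring.closure (Set.range c) →+* Λ,
      ∀ i, φ ⟨c i, Subring.subset_closure ⟨i, rfl⟩⟩ = c' i := by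
  have hle : ∀ H, evp c H ∈ Subring.closure (Set.range c) := fun H => by
    induction H using MvPolynomial.induction_on with
    | C a => simp [evp]
    | add p q hp hq => rw [map_add]; exact add_mem hp hq
    | mul_X p i hp =>
      rw [map_mul, evp_X]
      exact mul_mem hp (Subring.subset_closure ⟨i, rfl⟩)
  let π := (evp c).codRestrict (Subring.closure (Set.range c)) hle
  have hπ : Function.Surjective π := by
    rintro ⟨x, hx⟩
    suffices ∃ H, evp c H = x from this.imp fun H hH => Subtype.ext hH
    induction hx using Subring.closure_induction with
    | mem x hx =>
      obtain ⟨i, rfl⟩ := hx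
      exact ⟨_, evp_X c i⟩
    | zero => exact ⟨0, map_zero _⟩
    | one => exact ⟨1, map_one _⟩
    | add x y _ _ hx hy =>
      obtain ⟨p, rfl⟩ := hx
      obtain ⟨q, rfl⟩ := hy
      exact ⟨p + q, map_add _ _ _⟩
    | neg x _ hx =>
      obtain ⟨p, rfl⟩ := hx
      exact ⟨-p, map_neg _ _⟩
    | mul x y _ _ hx hy =>
      obtain ⟨p, rfl⟩ := hx
      obtain ⟨q, rfl⟩ := hy
      exact ⟨p * q, map_mul _ _ _⟩
  refine ⟨π.liftOfSurjective hπ ⟨evp c', fun H hH => h H ?_⟩, fun i => ?_⟩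
  · exact congrArg Subtype.val hH
  · have : (⟨c i, Subring.subset_closure ⟨i, rfl⟩⟩ : Subring.closure (Set.range c)) =
        π (MvPolynomial.X i) := Subtype.ext (evp_X c i).symm
    rw [this]
    exact (RingHom.liftOfRightInverse_comp_apply _ _ _ _ _).trans (evp_X c' i)
end

section
lemma RegPar.of_le {R : Type*} [CommRing R] [IsLocalRing R] [IsNoetherianRing R] {y : ℕ → R} {n : ℕ}
    (h : Id y n = maximalIdeal R) (hn : (n : WithBot ℕ∞) ≤ ringKrullDim R) : RegPar y n := by
  have h1 : (maximalIdeal R).height ≤ n :=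
    height_le_of_minimalPrimes_Id (w := y) ⟨⟨inferInstance, h.le⟩, fun Q hQ _ => h ▸ hQ.2⟩
  refine ⟨h, le_antisymm ?_ hn⟩
  rw [← IsLocalRing.maximalIdeal_height_eq_ringKrullDim]
  exact WithBot.coe_le_coe.mpr h1
end
section
open PowerSeries
variable {A : Type*} [CommRing A] [IsLocalRing A]

lemma mem_maximalIdeal_powerSeries {f : A⟦X⟧} :
    f ∈ maximalIdeal A⟦X⟧ ↔ constantCoeff f ∈ maximalIdeal A := by
  simp only [mem_maximalIdeal, mem_nonunits_iff, isUnit_iff_constantCoeff]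

lemma C_mem_maximalIdeal {a : A} (h : a ∈ maximalIdeal A) : C a ∈ maximalIdeal A⟦X⟧ := by
  rw [mem_maximalIdeal_powerSeries]
  simpa using h

lemma X_mem_maximalIdeal : (X : A⟦X⟧) ∈ maximalIdeal A⟦X⟧ := by
  rw [mem_maximalIdeal_powerSeries]
  simp

lemma C_mem_maximalIdeal_pow {a : A} {k : ℕ} (h : a ∈ maximalIdeal A ^ k) :
    C a ∈ maximalIdeal A⟦X⟧ ^ k := by
  have h1 := Ideal.mem_map_of_mem (C : A →+* A⟦X⟧) h
  rw [Ideal.map_pow] at h1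
  exact Ideal.pow_right_mono (Ideal.map_le_of_le_comap fun a ha => Ideal.mem_comap.mpr (C_mem_maximalIdeal ha)) k h1

lemma coeff_mem_maximalIdeal_pow {k : ℕ} {f : A⟦X⟧} (h : f ∈ maximalIdeal A⟦X⟧ ^ k) (i : ℕ) :
    coeff i f ∈ maximalIdeal A ^ (k - i) := by
  induction k generalizing f i with
  | zero => simp
  | succ k ih =>
    rw [pow_succ'] at h
    induction h using Submodule.mul_induction_on' with
    | add f _ g _ hf hg =>
      rw [map_add]
      exact add_mem hf hg
    | mem_mul_mem f hf g hg =>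
      rw [coeff_mul]
      refine Ideal.sum_mem _ fun ⟨p, q⟩ hpq => ?_
      rw [Finset.HasAntidiagonal.mem_antidiagonal] at hpq
      dsimp only at hpq ⊢
      rcases Nat.eq_zero_or_pos p with rfl | hp
      · refine Ideal.pow_le_pow_right (by lia : k + 1 - i ≤ (k - q) + 1) ?_
        rw [pow_succ']
        exact Ideal.mul_mem_mul (by simpa using mem_maximalIdeal_powerSeries.mp hf) (ih hg q)
      · exact Ideal.mul_mem_left _ _
          (Ideal.pow_le_pow_right (by lia : k + 1 - i ≤ k - q) (ih hg q))

lemma mem_maximalIdeal_pow_of_coeff {k : ℕ} {f : A⟦X⟧}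
    (h : ∀ i < k, coeff i f ∈ maximalIdeal A ^ (k - i)) : f ∈ maximalIdeal A⟦X⟧ ^ k := by
  induction k generalizing f with
  | zero => simp
  | succ k ih =>
    rw [eq_X_mul_shift_add_const f]
    refine add_mem ?_ ?_
    · rw [pow_succ']
      refine Ideal.mul_mem_mul X_mem_maximalIdeal (ih fun i hi => ?_)
      have := h (i + 1) (by lia)
      rw [coeff_mk]
      convert this using 2
      lia
    · exact C_mem_maximalIdeal_pow (by simpa using h 0 (by lia))

instance isAdicComplete_powerSeries [IsNoetherianRing A] [IsAdicComplete (maximalIdeal A) A] :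
    IsAdicComplete (maximalIdeal A⟦X⟧) A⟦X⟧ where
  prec' f hf := by
    have hf' : ∀ {m n}, m ≤ n → f m - f n ∈ maximalIdeal A⟦X⟧ ^ m := fun {m n} hmn => by
      have := hf hmn
      rwa [SModEq.sub_mem, smul_eq_mul, Ideal.mul_top] at this
    have h1 : ∀ i, ∃ c : A, ∀ k, coeff i (f (k + i)) - c ∈ maximalIdeal A ^ k := fun i => by
      obtain ⟨c, hc⟩ := IsPrecomplete.prec (I := maximalIdeal A) (M := A) inferInstance
        (f := fun k => coeff i (f (k + i))) fun {m n} hmn => by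
          rw [SModEq.sub_mem, smul_eq_mul, Ideal.mul_top, ← map_sub]
          have := coeff_mem_maximalIdeal_pow (hf' (by lia : m + i ≤ n + i)) i
          rwa [Nat.add_sub_cancel] at this
      refine ⟨c, fun k => ?_⟩
      have := hc k
      rwa [SModEq.sub_mem, smul_eq_mul, Ideal.mul_top] at this
    choose c hc using h1
    refine ⟨mk c, fun k => ?_⟩
    rw [SModEq.sub_mem, smul_eq_mul, Ideal.mul_top]
    refine mem_maximalIdeal_pow_of_coeff fun i hi => ?_
    have := hc i (k - i)
    rw [Nat.sub_add_cancel hi.le] at this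
    simpa using this

/-- Regular parameters of a power series ring. -/
noncomputable def extX (x : ℕ → A) (n : ℕ) : ℕ → A⟦X⟧ := fun j => if j < n then C (x j) else X

omit [IsLocalRing A] in
lemma extX_of_lt (x : ℕ → A) {n j : ℕ} (h : j < n) : extX x n j = C (x j) := if_pos h

omit [IsLocalRing A] in
lemma extX_self (x : ℕ → A) (n : ℕ) : extX x n n = X := if_neg (lt_irrefl n)

lemma RegPar.powerSeries [IsNoetherianRing A] {x : ℕ → A} {n : ℕ} (hx : RegPar x n) :
    RegPar (extX x n) (n + 1) := by
  have hs : Id (extX x n) (n + 1) = maximalIdeal A⟦X⟧ := by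
    refine le_antisymm (Id_le fun i hi => ?_) fun f hf => ?_
    · rcases Nat.lt_succ_iff_lt_or_eq.mp hi with hi | rfl
      · rw [extX_of_lt _ hi]
        exact C_mem_maximalIdeal (hx.mem hi)
      · rw [extX_self]
        exact X_mem_maximalIdeal
    · rw [mem_maximalIdeal_powerSeries, ← hx.span] at hf
      rw [eq_X_mul_shift_add_const f]
      refine add_mem (Ideal.mul_mem_right _ _ ?_) ?_
      · have := mem_Id (w := extX x n) (Nat.lt_succ_self n)
        rwa [extX_self] at this
      · refine Id_mono _ (Nat.le_succ n) ?_
        have h1 : Id (extX x n) n = Id (fun j => (C : A →+* A⟦X⟧) (x j)) n :=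
          Id_congr fun i hi => extX_of_lt x hi
        rw [h1]
        exact map_mem_Id (C : A →+* A⟦X⟧) hf
  refine RegPar.of_le hs ?_
  have h2 := ringKrullDim_succ_le_ringKrullDim_powerseries (R := A)
  rw [hx.dim] at h2
  rw [Nat.cast_add, Nat.cast_one]
  exact h2
end

section
open PowerSeries
/-- Extending a ring homomorphism to a power series ring, with values in a complete ring. -/
theorem exists_ringHom_powerSeries {A B : Type*} [CommRing A] [CommRing B] (J : Ideal B)
    [IsAdicComplete J B] (α : A →+* B) {z : B} (hz : z ∈ J) :
    ∃ β : A⟦X⟧ →+* B, (∀ a, β (C a) = α a) ∧ β X = z := by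
  have key : ∀ (N : ℕ) (p q : Polynomial A), (∀ i < N, p.coeff i = q.coeff i) →
      Ideal.Quotient.mk (J ^ N) (p.eval₂ α z) = Ideal.Quotient.mk (J ^ N) (q.eval₂ α z) := by
    intro N p q h
    have h1 : Polynomial.X ^ N ∣ p - q := by
      rw [Polynomial.X_pow_dvd_iff]
      intro i hi
      rw [Polynomial.coeff_sub, h i hi, sub_self]
    obtain ⟨r, hr⟩ := h1
    rw [Ideal.Quotient.mk_eq_mk_iff_sub_mem, ← Polynomial.eval₂_sub, hr, Polynomial.eval₂_mul,
      Polynomial.eval₂_X_pow]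
    exact Ideal.mul_mem_right _ _ (Ideal.pow_mem_pow hz N)
  have hc : ∀ (N i : ℕ) (f : A⟦X⟧), i < N → (PowerSeries.trunc N f).coeff i = coeff i f := fun N i f h => by
    rw [coeff_trunc, if_pos h]
  let F : (N : ℕ) → A⟦X⟧ →+* B ⧸ J ^ N := fun N =>
    { toFun := fun f => Ideal.Quotient.mk (J ^ N) ((PowerSeries.trunc N f).eval₂ α z)
      map_one' := by
        have h1 := key N (PowerSeries.trunc N 1) 1 fun i hi => by
          rw [hc _ _ _ hi, coeff_one, Polynomial.coeff_one]
        rw [h1, Polynomial.eval₂_one, map_one]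
      map_mul' := fun f g => by
        have h1 := key N (PowerSeries.trunc N (f * g)) (PowerSeries.trunc N f * PowerSeries.trunc N g) fun i hi => by
          rw [hc _ _ _ hi, coeff_mul, Polynomial.coeff_mul]
          refine Finset.sum_congr rfl fun pq hpq => ?_
          have := Finset.HasAntidiagonal.mem_antidiagonal.mp hpq
          rw [hc _ _ _ (by lia), hc _ _ _ (by lia)]
        rw [h1, Polynomial.eval₂_mul, map_mul]
      map_zero' := by simp
      map_add' := fun f g => by rw [map_add, Polynomial.eval₂_add, map_add] }
  have hF : ∀ N f, F N f = Ideal.Quotient.mk (J ^ N) ((PowerSeries.trunc N f).eval₂ α z) := fun N f => rfl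
  have hcompat : ∀ {m n : ℕ} (hle : m ≤ n),
      (Ideal.Quotient.factorPow J hle).comp (F n) = F m := fun {m n} hle => by
    ext f
    rw [RingHom.comp_apply, hF, hF]
    exact key m _ _ fun i hi => by rw [hc _ _ _ (by lia), hc _ _ _ hi]
  refine ⟨IsAdicComplete.liftRingHom J F hcompat, fun a => ?_, ?_⟩
  · refine IsHausdorff.eq_iff_smodEq (I := J) |>.mpr fun N => ?_
    rw [SModEq.sub_mem, smul_eq_mul, Ideal.mul_top, ← Ideal.Quotient.mk_eq_mk_iff_sub_mem,
      IsAdicComplete.mk_liftRingHom, hF]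
    have h1 := key N (PowerSeries.trunc N (C a)) (Polynomial.C a) fun i hi => by
      rw [hc _ _ _ hi, coeff_C, Polynomial.coeff_C]
    rw [h1, Polynomial.eval₂_C]
  · refine IsHausdorff.eq_iff_smodEq (I := J) |>.mpr fun N => ?_
    rw [SModEq.sub_mem, smul_eq_mul, Ideal.mul_top, ← Ideal.Quotient.mk_eq_mk_iff_sub_mem,
      IsAdicComplete.mk_liftRingHom, hF]
    have h1 := key N (PowerSeries.trunc N X) Polynomial.X fun i hi => by
      rw [hc _ _ _ hi, coeff_X, Polynomial.coeff_X]
      simp [eq_comm]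
    rw [h1, Polynomial.eval₂_X]
end

section
/-- The universal property of a power series ring in `n` variables over a field. -/
structure IsFormalPower {K : Type u} [Field K] {A : Type u} [CommRing A] [IsLocalRing A]
    [IsNoetherianRing A] (κ : K →+* A) (x : ℕ → A) (n : ℕ) : Prop where
  par : RegPar x n
  complete : IsAdicComplete (maximalIdeal A) A
  lift : ∀ (B : Type u) [CommRing B] (J : Ideal B) [IsAdicComplete J B] (β : K →+* B) (z : ℕ → B),
    (∀ j < n, z j ∈ J) → ∃ α : A →+* B, (∀ k, α (κ k) = β k) ∧ ∀ j < n, α (x j) = z j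

lemma isFormalPower_zero (K : Type u) [Field K] :
    IsFormalPower (RingHom.id K) (0 : ℕ → K) 0 where
  par := ⟨by rw [Id_zero, maximalIdeal_eq_bot], by simp⟩
  complete := inferInstance
  lift := fun B _ J _ β z _ => ⟨β, fun k => rfl, fun j hj => absurd hj (Nat.not_lt_zero j)⟩

open PowerSeries in
lemma IsFormalPower.powerSeries {K : Type u} [Field K] {A : Type u} [CommRing A] [IsLocalRing A]
    [IsNoetherianRing A] {κ : K →+* A} {x : ℕ → A} {n : ℕ} (h : IsFormalPower κ x n) :
    IsFormalPower ((C : A →+* A⟦X⟧).comp κ) (extX x n) (n + 1) where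
  par := h.par.powerSeries
  complete := by
    have := h.complete
    infer_instance
  lift := fun B _ J _ β z hz => by
    obtain ⟨α, hα, hαx⟩ := h.lift B J β z fun j hj => hz j (by lia)
    obtain ⟨α', hα', hX⟩ := exists_ringHom_powerSeries J α (hz n (by lia))
    refine ⟨α', fun k => (hα' _).trans (hα k), fun j hj => ?_⟩
    rcases Nat.lt_succ_iff_lt_or_eq.mp hj with hj | rfl
    · rw [extX_of_lt _ hj, hα', hαx j hj]
    · rw [extX_self, hX]

lemma exists_isFormalPower (K : Type u) [Field K] (n : ℕ) :
    ∃ (A : Type u) (_ : CommRing A) (_ : IsLocalRing A) (_ : IsNoetherianRing A) (κ : K →+* A)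
      (x : ℕ → A), IsFormalPower κ x n := by
  induction n with
  | zero => exact ⟨K, inferInstance, inferInstance, inferInstance, _, _, isFormalPower_zero K⟩
  | succ n ih =>
    obtain ⟨A, _, _, _, κ, x, h⟩ := ih
    exact ⟨PowerSeries A, inferInstance, inferInstance, inferInstance, _, _, h.powerSeries⟩

lemma formallySmooth_rat (K : Type u) [Field K] [CharZero K] : Algebra.FormallySmooth ℚ K := by
  obtain ⟨s, hs⟩ := exists_isTranscendenceBasis' ℚ K
  obtain ⟨v, hv⟩ := hs
  have := hv.isAlgebraic_field
  have : Algebra.IsSeparable (IntermediateField.adjoin ℚ (Set.range v)) K := inferInstance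
  exact .of_algebraicIndependent_of_isSeparable hv.1

variable {R : Type u} [CommRing R] [IsLocalRing R] [IsNoetherianRing R]

lemma exists_coefficientField (h0 : ∀ p : ℕ, p.Prime → (p : R) ∉ maximalIdeal R) :
    ∃ β : ResidueField R →+* AdicCompletion (maximalIdeal R) R,
      ∀ k, AdicCompletion.evalOneₐ (maximalIdeal R) (β k) = k := by
  have hne : ∀ n : ℕ, n ≠ 0 → (n : R) ∉ maximalIdeal R := fun n => by
    induction n using Nat.recOnMul with
    | zero => simp
    | one => simp
    | prime p hp => exact fun _ => h0 p hp
    | mul a b ha hb =>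
      intro h h'
      rw [Nat.cast_mul] at h'
      exact ((maximalIdeal.isMaximal R).isPrime.mem_or_mem h').elim
        (ha (left_ne_zero_of_mul h)) (hb (right_ne_zero_of_mul h))
  have h1 : ∀ I : Ideal R, I ≠ ⊤ → CharZero (R ⧸ I) := fun I hI => by
    refine charZero_of_inj_zero fun n hn => ?_
    by_contra h
    have : ((n : R) : R ⧸ I) = 0 := hn
    exact hne n h (le_maximalIdeal hI (Ideal.Quotient.eq_zero_iff_mem.mp this))
  have : CharZero (ResidueField R) := h1 _ (maximalIdeal.isMaximal R).ne_top
  obtain ⟨_⟩ := (EqualCharZero.nonempty_algebraRat_iff R).mpr h1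
  have key : ∀ a : Algebra ℚ (ResidueField R), @Algebra.FormallySmooth ℚ (ResidueField R) _ _ a :=
    fun a => by
      rw [Subsingleton.elim a DivisionRing.toRatAlgebra]
      exact formallySmooth_rat _
  have : Algebra.FormallySmooth ℚ (R ⧸ maximalIdeal R) :=
    key (Ideal.instAlgebraQuotient ℚ (maximalIdeal R))
  obtain ⟨g, hg⟩ := Algebra.FormallySmooth.exists_adicCompletionEvalOneₐ_comp_eq
    (AlgHom.id ℚ (R ⧸ maximalIdeal R))
  exact ⟨(g : (R ⧸ maximalIdeal R) →+* _), fun k => DFunLike.congr_fun hg k⟩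
end

section
lemma map_Id {R S : Type*} [CommRing R] [CommRing S] (φ : R →+* S) (w : ℕ → R) (k : ℕ) :
    (Id w k).map φ = Id (fun j => φ (w j)) k := by
  rw [Id, Id, Ideal.map_span, Set.image_image]

variable {R : Type u} [CommRing R] [IsLocalRing R] [IsNoetherianRing R]

lemma RegPar.map_maximalIdeal {S : Type*} [CommRing S] (φ : R →+* S) {y : ℕ → R} {n : ℕ}
    (hy : RegPar y n) : (maximalIdeal R).map φ = Id (fun j => φ (y j)) n := by
  rw [← hy.span, map_Id]

/-- A homomorphism from a regular local ring to a completion of another one of the same dimension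
which matches regular parameters is injective. -/
lemma RegPar.injective_of_map_eq {T : Type u} [CommRing T] [IsLocalRing T] [IsNoetherianRing T]
    {x : ℕ → T} {y : ℕ → R} {n : ℕ} (hx : RegPar x n) (hy : RegPar y n)
    (γ : T →+* AdicCompletion (maximalIdeal R) R) (hγ : ∀ j < n, γ (x j) = algebraMap R _ (y j)) :
    Function.Injective γ := by
  have := hx.isDomain
  rw [injective_iff_map_eq_zero]
  intro g hg
  by_contra hg0
  have hgm : g ∈ maximalIdeal T := by
    rw [mem_maximalIdeal]
    exact fun hu => not_isUnit_zero (hg ▸ hu.map γ)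
  rcases n with _ | n
  · rw [← hx.span, Id_zero] at hgm
    exact hg0 hgm
  obtain ⟨c, hc0, hc, hcm⟩ := hx.extend_max (w := fun _ => g) (i := 1)
    (fun i hi r hr => by
      obtain rfl : i = 0 := by lia
      rw [Id_zero] at hr ⊢
      exact (mul_eq_zero.mp hr).resolve_left hg0)
    (fun _ _ => hgm) (by lia)
  obtain ⟨N, hN⟩ := hx.exists_pow_le hc hcm
  let ψ : T →+* R ⧸ maximalIdeal R ^ (N + 1) :=
    ((AdicCompletion.evalₐ (maximalIdeal R) (N + 1)) : _ →+* _).comp γ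
  have hψx : ∀ j < n + 1, ψ (x j) = Ideal.Quotient.mk _ (y j) := fun j hj => by
    change AdicCompletion.evalₐ _ _ (γ (x j)) = _
    rw [hγ j hj]
    exact AdicCompletion.evalₐ_of _ _ _
  have hψm : (maximalIdeal T).map ψ =
      (maximalIdeal R).map (Ideal.Quotient.mk (maximalIdeal R ^ (N + 1))) := by
    rw [hx.map_maximalIdeal, hy.map_maximalIdeal]
    exact Id_congr hψx
  have hlift : ∀ j, ∃ r, j < n → r ∈ maximalIdeal R ∧
      Ideal.Quotient.mk (maximalIdeal R ^ (N + 1)) r = ψ (c (j + 1)) := fun j => by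
    by_cases hj : j < n
    · have := Ideal.mem_map_of_mem ψ (hcm (j + 1) (by lia))
      rw [hψm, Ideal.mem_map_iff_of_surjective _ Ideal.Quotient.mk_surjective] at this
      exact this.imp fun r hr _ => hr
    · exact ⟨0, fun h => absurd h hj⟩
  choose r hr using hlift
  have hle : maximalIdeal R ^ N ≤ Id r n ⊔ maximalIdeal R • maximalIdeal R ^ N := by
    intro s hs
    have h1 : Ideal.Quotient.mk (maximalIdeal R ^ (N + 1)) s ∈ (Id r n).map (Ideal.Quotient.mk _) := by
      have h2 := Ideal.mem_map_of_mem (Ideal.Quotient.mk (maximalIdeal R ^ (N + 1))) hs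
      rw [Ideal.map_pow, ← hψm, ← Ideal.map_pow] at h2
      refine (Ideal.map_mono hN).trans ?_ h2
      rw [map_Id, map_Id]
      refine Id_le fun i hi => ?_
      rcases i with _ | i
      · have : ψ (c 0) = 0 := by
          rw [hc0 0 (by lia)]
          change AdicCompletion.evalₐ _ _ (γ g) = _
          rw [hg, map_zero]
        rw [this]
        exact zero_mem _
      · rw [← (hr i (by lia)).2]
        exact mem_Id (by lia : i < n)
    rw [← Ideal.mem_comap, Ideal.comap_map_of_surjective _ Ideal.Quotient.mk_surjective,
      ← RingHom.ker_eq_comap_bot, Ideal.mk_ker, pow_succ'] at h1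
    exact h1
  have hle' : maximalIdeal R ^ N ≤ Id r n :=
    Submodule.le_of_le_smul_of_le_jacobson_bot (IsNoetherian.noetherian _)
      (maximalIdeal_le_jacobson _) hle
  have hmin : maximalIdeal R ∈ (Id r n).minimalPrimes := by
    refine ⟨⟨inferInstance, Id_le fun i hi => (hr i hi).1⟩, fun P hP _ => ?_⟩
    exact hP.1.le_of_pow_le (hle'.trans hP.2)
  have h3 := height_le_of_minimalPrimes_Id hmin
  rw [hy.height] at h3
  have := Nat.cast_le.mp h3
  lia

/-- A regular local ring whose residue field has characteristic zero embeds into a power series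
ring over its residue field. -/
lemma IsFormalPower.exists_ringHom {T : Type u} [CommRing T] [IsLocalRing T] [IsNoetherianRing T]
    {κ : ResidueField R →+* T} {x : ℕ → T} {n : ℕ} (h : IsFormalPower κ x n) {y : ℕ → R}
    (hy : RegPar y n) (h0 : ∀ p : ℕ, p.Prime → (p : R) ∉ maximalIdeal R) :
    ∃ ι : R →+* T, ∀ j < n, ι (y j) = x j := by
  obtain ⟨β, hβ⟩ := exists_coefficientField h0
  obtain ⟨γ, hγκ, hγ⟩ := h.lift _ (maximalIdeal (AdicCompletion (maximalIdeal R) R)) β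
    (fun j => algebraMap R _ (y j)) fun j hj => by
      rw [AdicCompletion.maximalIdeal_eq_map]
      exact Ideal.mem_map_of_mem _ (hy.mem hj)
  have hmap : (maximalIdeal T).map γ = maximalIdeal (AdicCompletion (maximalIdeal R) R) := by
    rw [AdicCompletion.maximalIdeal_eq_map, h.par.map_maximalIdeal, hy.map_maximalIdeal]
    exact Id_congr hγ
  have := h.complete
  have hsurj : Function.Surjective γ := by
    have : IsHausdorff ((maximalIdeal T).map γ) (AdicCompletion (maximalIdeal R) R) := by
      rw [hmap]
      infer_instance
    refine surjective_of_mk_map_comp_surjective (I := maximalIdeal T) γ fun b => ?_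
    obtain ⟨b, rfl⟩ := Ideal.Quotient.mk_surjective b
    obtain ⟨k, hk⟩ : ∃ k : ResidueField R, k = AdicCompletion.evalOneₐ (maximalIdeal R) b := ⟨_, rfl⟩
    refine ⟨κ k, ?_⟩
    rw [RingHom.comp_apply, hγκ, Ideal.Quotient.mk_eq_mk_iff_sub_mem, hmap,
      AdicCompletion.maximalIdeal_eq_map, ← AdicCompletion.ker_evalOneₐ_eq_map _
        (maximalIdeal R).fg_of_isNoetherianRing, RingHom.mem_ker]
    change AdicCompletion.evalOneₐ (maximalIdeal R) (_ - _) = 0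
    rw [map_sub]
    exact sub_eq_zero.mpr ((hβ k).trans hk)
  have hinj := h.par.injective_of_map_eq hy γ hγ
  let e := RingEquiv.ofBijective γ ⟨hinj, hsurj⟩
  refine ⟨(e.symm : AdicCompletion (maximalIdeal R) R →+* T).comp (algebraMap R _), fun j hj => ?_⟩
  change e.symm (algebraMap R _ (y j)) = x j
  rw [← hγ j hj]
  exact e.symm_apply_apply (x j)
end

section
open Polynomial
variable {A : Type*} [CommRing A]

lemma exists_fixedPoint_powerSeries (s : (PowerSeries A)[X]) (g : PowerSeries A) :
    ∃ w, w = g + PowerSeries.X * s.eval w := by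
  let I : Ideal (PowerSeries A) := Ideal.span {PowerSeries.X}
  let W : ℕ → PowerSeries A := fun k => Nat.rec g (fun _ v => g + PowerSeries.X * s.eval v) k
  have hW : ∀ k, W (k + 1) = g + PowerSeries.X * s.eval (W k) := fun k => rfl
  have hstep : ∀ k, PowerSeries.X ^ k ∣ W (k + 1) - W k := fun k => by
    induction k with
    | zero => simp
    | succ k ih =>
      rw [hW (k + 1), hW k, add_sub_add_left_eq_sub, ← hW k, ← mul_sub, pow_succ']
      exact mul_dvd_mul_left _ (ih.trans (Polynomial.sub_dvd_eval_sub _ _ s))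
  have hmono : ∀ k l, PowerSeries.X ^ k ∣ W (k + l) - W k := fun k l => by
    induction l with
    | zero => simp
    | succ l ih =>
      rw [← sub_add_sub_cancel _ (W (k + l))]
      exact dvd_add ((pow_dvd_pow _ (by lia)).trans (hstep (k + l))) ih
  have hI : ∀ k (a b : PowerSeries A), a ≡ b [SMOD (I ^ k • ⊤ : Submodule (PowerSeries A) (PowerSeries A))] ↔
      PowerSeries.X ^ k ∣ a - b := fun k a b => by
    refine SModEq.sub_mem.trans ?_
    rw [smul_eq_mul, Ideal.mul_top, Ideal.span_singleton_pow,
      Ideal.mem_span_singleton]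
  obtain ⟨w, hw⟩ := IsPrecomplete.prec (I := I) inferInstance (f := W) fun {k l} hkl => by
    rw [hI, ← neg_sub, dvd_neg]
    simpa [Nat.add_sub_cancel' hkl] using hmono k (l - k)
  refine ⟨w, IsHausdorff.eq_iff_smodEq (I := I) |>.mpr fun k => ?_⟩
  rw [hI]
  have h1 := (hI k _ _).mp (hw k)
  have h2 := (hI _ _ _).mp (hw (k + 1))
  rw [hW] at h2
  have h3 : PowerSeries.X ^ k ∣ PowerSeries.X * (s.eval (W k) - s.eval w) :=
    (h1.trans (Polynomial.sub_dvd_eval_sub _ _ s)).mul_left _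
  have h4 := dvd_sub h3 ((pow_dvd_pow _ (Nat.le_succ k)).trans h2)
  convert h4 using 1
  ring

/-- A form of Newton's lemma for power series, which also corrects the solutions of linear
equations `e * c i = G i (θ)` along with the root `θ`. -/
lemma exists_root_powerSeries {ι : Type*} {f : (PowerSeries A)[X]} {G : ι → (PowerSeries A)[X]}
    {θ e P Q F : PowerSeries A} {Y H : ι → PowerSeries A}
    (hf : f.eval θ = P * PowerSeries.X ^ 2 * F) (hd : (derivative f).eval θ ^ 2 * e = P * Q)
    (hQ : IsUnit Q) (hG : ∀ i, e * Y i - (G i).eval θ = P * PowerSeries.X ^ 2 * H i) :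
    ∃ (θ' : PowerSeries A) (c' : ι → PowerSeries A), f.eval θ' = 0 ∧ ∀ i, e * c' i = (G i).eval θ' ∧ PowerSeries.X ^ 2 ∣ c' i - Y i := by
  obtain ⟨q, hq⟩ := hQ.exists_right_inv
  let b := (derivative f).eval θ
  let h : (PowerSeries A)[X] := C (b * e * PowerSeries.X ^ 2) * X
  obtain ⟨k, hk⟩ := binomExpansion (f.map C) (C θ) h
  obtain ⟨w, hw⟩ :=
    exists_fixedPoint_powerSeries (-(C (e * PowerSeries.X) * X ^ 2 * k) : (PowerSeries A)[X]) (-(q * F))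
  have hk' := congrArg (eval w) hk
  rw [derivative_map, eval_map, eval_map, eval_map, ← comp, ← comp, ← comp, comp_C, comp_C,
    eval_comp] at hk'
  simp only [eval_add, eval_mul, eval_C, eval_X, eval_pow, h, eval_neg] at hk' hw
  have hGw : ∀ i, b * e * PowerSeries.X ^ 2 * w ∣
      (G i).eval (θ + b * e * PowerSeries.X ^ 2 * w) - (G i).eval θ := fun i => by
    convert Polynomial.sub_dvd_eval_sub (θ + b * e * PowerSeries.X ^ 2 * w) θ (G i) using 1
    ring
  choose g hg using hGw
  refine ⟨θ + b * e * PowerSeries.X ^ 2 * w, fun i => Y i + PowerSeries.X ^ 2 *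
    (b * w * g i - b ^ 2 * q * H i), ?_, fun i => ⟨?_, ?_⟩⟩
  · rw [hk', hf]
    linear_combination (PowerSeries.X ^ 2 * w + e * PowerSeries.X ^ 4 * w ^ 2 * eval w k) * hd
      + (P * Q * PowerSeries.X ^ 2) * hw - P * PowerSeries.X ^ 2 * F * hq
  · linear_combination hG i - hg i - q * PowerSeries.X ^ 2 * H i * hd
      - P * PowerSeries.X ^ 2 * H i * hq
  · simp
end

section
open Polynomial

lemma dvd_evp_sub_evp {σ Λ : Type*} [CommRing Λ] {M : Λ} {t t' : σ → Λ} (ht : ∀ i, M ∣ t i - t' i)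
    (h : MvPolynomial σ ℤ) : M ∣ evp t h - evp t' h := by
  simp only [← Ideal.mem_span_singleton, ← Ideal.Quotient.eq] at ht ⊢
  rw [map_evp, map_evp]
  simp only [ht]

lemma dvd_evq_sub_evq {σ Λ : Type*} [CommRing Λ] {M : Λ} {t t' : σ → Λ} (ht : ∀ i, M ∣ t i - t' i)
    {θ θ' : Λ} (hθ : M ∣ θ - θ') (h : (MvPolynomial σ ℤ)[X]) : M ∣ evq t θ h - evq t' θ' h := by
  simp only [← Ideal.mem_span_singleton, ← Ideal.Quotient.eq] at ht hθ ⊢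
  rw [map_evq, map_evq]
  simp only [ht, hθ]

section
variable {A : Type*} [CommRing A] {I : Ideal A} [IsAdicComplete I A] {P : A[X]}

lemma dvd_of_coe_dvd_coe (hP : P.IsDistinguishedAt I) {p : A[X]}
    (h : (P : PowerSeries A) ∣ p) : P ∣ p := by
  rw [← Ideal.mem_span_singleton, ← Ideal.Quotient.eq_zero_iff_mem] at h ⊢
  apply hP.algEquivQuotient.injective
  rw [map_zero]
  exact h

lemma exists_coe_dvd_sub_coe (hP : P.IsDistinguishedAt I) (r : PowerSeries A) :
    ∃ T : A[X], (P : PowerSeries A) ∣ r - T := by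
  obtain ⟨T, hT⟩ := hP.algEquivQuotient.surjective (Ideal.Quotient.mk _ r)
  obtain ⟨T, rfl⟩ := Ideal.Quotient.mk_surjective T
  refine ⟨T, ?_⟩
  rw [← Ideal.mem_span_singleton, ← Ideal.Quotient.eq]
  exact hT.symm
end

variable {A : Type*} [CommRing A] [IsLocalRing A] [IsDomain A] [IsAdicComplete (maximalIdeal A) A]

/-- Weierstrass division turns a solution of polynomial equations in power series over a complete
local ring into an approximate solution in polynomials. -/
lemma exists_polynomial_approximation {σ ι : Type*} {f : (MvPolynomial σ ℤ)[X]}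
    {E : MvPolynomial σ ℤ} {G : ι → (MvPolynomial σ ℤ)[X]} {t : σ → PowerSeries A}
    {θ : PowerSeries A} {c : ι → PowerSeries A} (hf : evq t θ f = 0)
    (hG : ∀ i, evp t E * c i = evq t θ (G i))
    (ha : (evq t θ (derivative f) ^ 2 * evp t E).map (residue A) ≠ 0) :
    ∃ (T : σ → A[X]) (Θ P F Q : A[X]) (Y H : ι → A[X]), P.Monic ∧
      evq T Θ f = P * X ^ 2 * F ∧ evq T Θ (derivative f) ^ 2 * evp T E = P * Q ∧
      IsUnit (Q.coeff 0) ∧ (∀ i, evp T E * Y i - evq T Θ (G i) = P * X ^ 2 * H i) ∧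
      ∀ i, ∀ p : A[X], c i = p → Y i = p := by
  obtain ⟨P, u, hP, hu, hPu⟩ := PowerSeries.exists_isWeierstrassFactorization ha
  have hX : (X : A[X]).IsDistinguishedAt (maximalIdeal A) := by
    refine ⟨⟨fun {n} hn => ?_⟩, monic_X⟩
    obtain rfl : n = 0 := by simpa using hn
    simp
  have hM : (P * X ^ 2).IsDistinguishedAt (maximalIdeal A) := by
    rw [pow_two]
    exact hP.mul (hX.mul hX)
  choose T hT using fun i => exists_coe_dvd_sub_coe hM (t i)
  obtain ⟨Θ, hΘ⟩ := exists_coe_dvd_sub_coe hM θ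
  have hY : ∀ i, ∃ Y : A[X], ((P * X ^ 2 : A[X]) : PowerSeries A) ∣ c i - Y ∧
      ∀ p : A[X], c i = p → Y = p := fun i => by
    by_cases h : ∃ p : A[X], c i = p
    · obtain ⟨p, hp⟩ := h
      exact ⟨p, by simp [hp], fun p' hp' => coe_injective A (hp.symm.trans hp')⟩
    · obtain ⟨Y, hY⟩ := exists_coe_dvd_sub_coe hM (c i)
      exact ⟨Y, hY, fun p hp => absurd ⟨p, hp⟩ h⟩
  choose Y hYM hY using hY
  have hcoep : ∀ h : MvPolynomial σ ℤ, ((evp T h : A[X]) : PowerSeries A) =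
      evp (fun i => (T i : PowerSeries A)) h := fun h => map_evp (coeToPowerSeries.ringHom : A[X] →+* PowerSeries A) T h
  have hcoeq : ∀ h : (MvPolynomial σ ℤ)[X], ((evq T Θ h : A[X]) : PowerSeries A) =
      evq (fun i => (T i : PowerSeries A)) (Θ : PowerSeries A) h :=
    fun h => map_evq (coeToPowerSeries.ringHom : A[X] →+* PowerSeries A) T Θ h
  have hfM : P * X ^ 2 ∣ evq T Θ f := by
    refine dvd_of_coe_dvd_coe hM ?_
    have := dvd_evq_sub_evq hT hΘ f
    rwa [hf, zero_sub, dvd_neg, ← hcoeq] at this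
  have hGM : ∀ i, P * X ^ 2 ∣ evp T E * Y i - evq T Θ (G i) := fun i => by
    refine dvd_of_coe_dvd_coe hM ?_
    rw [coe_sub, coe_mul (evp T E), hcoep, hcoeq]
    have h1 := dvd_evq_sub_evq hT hΘ (G i)
    have h2 := (dvd_evp_sub_evp hT E).mul_right (c i)
    have h3 := (hYM i).mul_left (evp (fun i => (T i : PowerSeries A)) E)
    convert dvd_sub h1 (dvd_add h2 h3) using 1
    linear_combination hG i
  obtain ⟨F, hF⟩ := hfM
  choose H hH using hGM
  have hd : ((P * X ^ 2 : A[X]) : PowerSeries A) ∣ (P : PowerSeries A) * u -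
      ((evq T Θ (derivative f) ^ 2 * evp T E : A[X]) : PowerSeries A) := by
    rw [← hPu, coe_mul _ (evp T E), coe_pow, hcoep, hcoeq]
    have h1 := dvd_evq_sub_evq hT hΘ (derivative f)
    have h2 := dvd_evp_sub_evp hT E
    convert dvd_add ((h1.mul_right (evq t θ (derivative f) +
      evq (fun i => (T i : PowerSeries A)) Θ (derivative f))).mul_right (evp t E))
      (h2.mul_left (evq (fun i => (T i : PowerSeries A)) Θ (derivative f) ^ 2)) using 1
    ring
  obtain ⟨z, hz⟩ := hd
  have hPd : P ∣ evq T Θ (derivative f) ^ 2 * evp T E := by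
    refine dvd_of_coe_dvd_coe hP ⟨u - PowerSeries.X ^ 2 * z, ?_⟩
    rw [coe_mul P, coe_pow (φ := X), coe_X] at hz
    linear_combination -hz
  obtain ⟨Q, hQ⟩ := hPd
  refine ⟨T, Θ, P, F, Q, Y, H, hP.monic, hF, hQ, ?_, hH, hY⟩
  have hP0 : (P : PowerSeries A) ≠ 0 := by
    rw [Ne, coe_eq_zero_iff]
    exact hP.monic.ne_zero
  have hQu : (Q : PowerSeries A) = u - PowerSeries.X ^ 2 * z := by
    refine mul_left_cancel₀ hP0 ?_
    rw [hQ, coe_mul P Q, coe_mul P, coe_pow (φ := X), coe_X] at hz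
    linear_combination -hz
  have := congrArg PowerSeries.constantCoeff hQu
  rw [map_sub, map_mul, map_pow, PowerSeries.constantCoeff_X, zero_pow two_ne_zero, zero_mul,
    sub_zero] at this
  have h3 : Q.coeff 0 = PowerSeries.constantCoeff u := by
    rw [← this, ← PowerSeries.coeff_zero_eq_constantCoeff_apply, coeff_coe]
  rw [h3]
  exact hu.map _
end

section
open Polynomial Filter

lemma evq_eq_eval {σ Λ : Type*} [CommRing Λ] (t : σ → Λ) (θ : Λ) (h : (MvPolynomial σ ℤ)[X]) :
    evq t θ h = (h.map (evp t)).eval θ := by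
  rw [eval_map]
  rfl

variable {A : Type u} [CommRing A]

lemma eventually_exists_map_subtype_eq (p : A[X]) : ∀ᶠ S : Finset A in atTop,
    ∃ q : (Subring.closure (S : Set A))[X], q.map (Subring.subtype _) = p := by
  have : ∀ᶠ S : Finset A in atTop, ∀ k ∈ p.support, p.coeff k ∈ Subring.closure (S : Set A) :=
    (eventually_all_finset _).mpr fun k _ => eventually_mem_closure _
  filter_upwards [this] with S hS
  have h : p ∈ lifts (Subring.closure (S : Set A)).subtype := by
    rw [lifts_iff_coeff_lifts]
    intro k
    by_cases hk : k ∈ p.support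
    · exact ⟨⟨_, hS k hk⟩, rfl⟩
    · exact ⟨0, by rw [notMem_support_iff.mp hk, map_zero]⟩
  exact (mem_lifts p).mp h

/-- Approximate solutions of polynomial equations in polynomials over `A` give exact solutions in
power series over every ring to which a finitely generated subring of `A` maps. -/
lemma eventually_exists_solution {σ ι : Type*} [Finite σ] [Finite ι] {f : (MvPolynomial σ ℤ)[X]}
    {E : MvPolynomial σ ℤ} {G : ι → (MvPolynomial σ ℤ)[X]} {T : σ → A[X]} {Θ P F Q : A[X]}
    {Y H : ι → A[X]} (hP : P.Monic) (hf : evq T Θ f = P * X ^ 2 * F)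
    (hd : evq T Θ (derivative f) ^ 2 * evp T E = P * Q) (hQ : IsUnit (Q.coeff 0))
    (hG : ∀ i, evp T E * Y i - evq T Θ (G i) = P * X ^ 2 * H i) :
    ∀ᶠ S : Finset A in atTop, ∀ (A' : Type u) [CommRing A'] [IsDomain A']
      (φ : Subring.closure (S : Set A) →+* A'), ∃ (t : σ → PowerSeries A') (θ : PowerSeries A')
      (c : ι → PowerSeries A'), evq t θ f = 0 ∧ evp t E ≠ 0 ∧
        (∀ i, evp t E * c i = evq t θ (G i)) ∧
        ∀ i (p : (Subring.closure (S : Set A))[X]), p.map (Subring.subtype _) = Y i →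
          PowerSeries.X ^ 2 ∣ c i - ((p.map φ : A'[X]) : PowerSeries A') := by
  obtain ⟨q, hq⟩ := hQ.exists_right_inv
  filter_upwards [eventually_all.mpr fun i => eventually_exists_map_subtype_eq (T i),
    eventually_exists_map_subtype_eq Θ, eventually_exists_map_subtype_eq P,
    eventually_exists_map_subtype_eq F, eventually_exists_map_subtype_eq Q,
    eventually_all.mpr fun i => eventually_exists_map_subtype_eq (Y i),
    eventually_all.mpr fun i => eventually_exists_map_subtype_eq (H i),
    eventually_mem_closure q] with S hT hΘ hP' hF hQ hY hH hqS
  generalize Subring.closure (S : Set A) = B at *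
  intro A' _ _ φ
  choose T' hT using hT
  obtain ⟨Θ', hΘ⟩ := hΘ
  obtain ⟨P', hP'⟩ := hP'
  obtain ⟨F', hF⟩ := hF
  obtain ⟨Q', hQ⟩ := hQ
  choose Y' hY using hY
  choose H' hH using hH
  have hinj : Function.Injective (mapRingHom B.subtype) :=
    map_injective _ B.subtype_injective
  have hT' : (fun i => mapRingHom B.subtype (T' i)) = T := funext hT
  have hΘ' : mapRingHom B.subtype Θ' = Θ := hΘ
  have hcP : mapRingHom B.subtype P' = P := hP'
  have hcF : mapRingHom B.subtype F' = F := hF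
  have hcQ : mapRingHom B.subtype Q' = Q := hQ
  have hcX : mapRingHom B.subtype X = X := map_X _
  have hcY : ∀ i, mapRingHom B.subtype (Y' i) = Y i := hY
  have hcH : ∀ i, mapRingHom B.subtype (H' i) = H i := hH
  have hf' : evq T' Θ' f = P' * X ^ 2 * F' := hinj <| by
    rw [map_evq, hT', hΘ', hf, map_mul, map_mul, map_pow, hcP, hcF, hcX]
  have hd' : evq T' Θ' (derivative f) ^ 2 * evp T' E = P' * Q' := hinj <| by
    rw [map_mul, map_pow, map_evq, map_evp, hT', hΘ', hd, map_mul, hcP, hcQ]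
  have hG' : ∀ i, evp T' E * Y' i - evq T' Θ' (G i) = P' * X ^ 2 * H' i := fun i => hinj <| by
    rw [map_sub, map_mul, map_evq, map_evp, hT', hΘ', hcY, hG, map_mul, map_mul, map_pow, hcP, hcX,
      hcH]
  let ρ : B[X] →+* PowerSeries A' := coeToPowerSeries.ringHom.comp (mapRingHom φ)
  have hρ : ∀ p, ρ p = (p.map φ : A'[X]) := fun p => rfl
  have hρX : ρ X = PowerSeries.X := by rw [hρ, map_X, coe_X]
  have hρQ : IsUnit (ρ Q') := by
    have h1 : Q'.coeff 0 * ⟨q, hqS⟩ = 1 := by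
      apply B.subtype_injective
      rw [map_mul, ← coeff_map, hQ, map_one]
      exact hq
    rw [PowerSeries.isUnit_iff_constantCoeff, hρ, ← PowerSeries.coeff_zero_eq_constantCoeff_apply,
      coeff_coe, coeff_map]
    exact (IsUnit.of_mul_eq_one _ h1).map φ
  have hρP : ρ P' ≠ 0 := by
    rw [hρ, Ne, coe_eq_zero_iff]
    have : P'.Monic := monic_of_injective B.subtype_injective (hP' ▸ hP)
    exact (this.map φ).ne_zero
  have hd'' := congrArg ρ hd'
  have hf'' := congrArg ρ hf'
  have hG'' := fun i => congrArg ρ (hG' i)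
  simp only [map_mul, map_pow, map_sub, map_evq, map_evp, hρX] at hd'' hf'' hG''
  have hE : evp (fun i => ρ (T' i)) E ≠ 0 := fun h => by
    rw [h, mul_zero] at hd''
    exact mul_ne_zero hρP hρQ.ne_zero hd''.symm
  simp only [evq_eq_eval] at hd'' hf'' hG'' ⊢
  rw [← derivative_map] at hd''
  obtain ⟨θ, c, hθ, hc⟩ := exists_root_powerSeries (G := fun i => (G i).map _) hf'' hd'' hρQ hG''
  refine ⟨_, θ, c, hθ, hE, fun i => (hc i).1, fun i p hp => ?_⟩
  have : p = Y' i := hinj (hp.trans (hY i).symm)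
  rw [this]
  exact (hc i).2
end

section
variable {R : Type u} [CommRing R] [IsLocalRing R] [IsNoetherianRing R] {y : ℕ → R} {n : ℕ}

lemma RegPar.isPrime_Id (hy : RegPar y n) {i : ℕ} (hi : i ≤ n) : (Id y i).IsPrime :=
  isPrime_Id_of_Id_eq_maximalIdeal hy.span hy.dim.ge hi

lemma RegPar.not_mem_Id (hy : RegPar y n) {i j : ℕ} (hi : i ≤ j) (hj : j < n) : y j ∉ Id y i := by
  intro h
  have h1 := hy.regSeq j hj 1 (by rw [mul_one]; exact Id_mono y hi h)
  exact (hy.isPrime_Id hj.le).ne_top ((Ideal.eq_top_iff_one _).mpr h1)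

/-- Regular parameters obtained by adding high powers of the last one to the others. -/
noncomputable def shear (y : ℕ → R) (n : ℕ) (e : ℕ → ℕ) : ℕ → R :=
  fun i => if i < n then y i + y n ^ e i else y i

omit [IsLocalRing R] [IsNoetherianRing R] in
lemma shear_of_lt (y : ℕ → R) {n i : ℕ} (e : ℕ → ℕ) (h : i < n) : shear y n e i = y i + y n ^ e i :=
  if_pos h

omit [IsLocalRing R] [IsNoetherianRing R] in
lemma shear_self (y : ℕ → R) (n : ℕ) (e : ℕ → ℕ) : shear y n e n = y n := if_neg (lt_irrefl n)

omit [IsNoetherianRing R] in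
lemma RegPar.shear (hy : RegPar y (n + 1)) {e : ℕ → ℕ} (he : ∀ i, 2 ≤ e i) :
    RegPar (shear y n e) (n + 1) := by
  refine ⟨?_, hy.dim⟩
  rw [← hy.span]
  have hp : ∀ (I : Ideal R) i, y n ∈ I → y n ^ e i ∈ I := fun I i h =>
    Ideal.pow_mem_of_mem _ h _ (by have := he i; lia)
  refine le_antisymm (Id_le fun i hi => ?_) (Id_le fun i hi => ?_)
  · rcases Nat.lt_succ_iff_lt_or_eq.mp hi with h | rfl
    · rw [shear_of_lt y e h]
      exact add_mem (mem_Id (by lia)) (hp _ i (mem_Id (by lia)))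
    · rw [shear_self]
      exact mem_Id hi
  · have hn : y n ∈ Id (KoszulTor.shear y n e) (n + 1) := by
      rw [← shear_self y n e]
      exact mem_Id (by lia)
    rcases Nat.lt_succ_iff_lt_or_eq.mp hi with h | rfl
    · rw [← add_sub_cancel_right (y i) (y n ^ e i), ← shear_of_lt y e h]
      exact sub_mem (mem_Id (by lia)) (hp _ i hn)
    · exact hn

/-- A nonzero element avoids the ideal generated by all but one of suitable regular parameters. -/
theorem RegPar.exists_shear_notMem (hy : RegPar y (n + 1)) {a : R} (ha : a ≠ 0) :
    ∃ e : ℕ → ℕ, (∀ i, 2 ≤ e i) ∧ a ∉ Id (KoszulTor.shear y n e) n := by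
  suffices h : ∀ i ≤ n, ∃ e : ℕ → ℕ, (∀ i, 2 ≤ e i) ∧ a ∉ Id (KoszulTor.shear y n e) i from h n le_rfl
  intro i hi
  induction i with
  | zero => exact ⟨fun _ => 2, fun _ => le_rfl, by rwa [Id_zero]⟩
  | succ i ih =>
    obtain ⟨e, he, hae⟩ := ih (by lia)
    by_contra! hcon
    have hup : ∀ E, ∀ j < i, KoszulTor.shear y n (Function.update e i E) j = KoszulTor.shear y n e j :=
      fun E j hj => by
        rw [shear_of_lt y _ (by lia), shear_of_lt y _ (by lia), Function.update_of_ne hj.ne]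
    have hup' : ∀ E, KoszulTor.shear y n (Function.update e i E) i = y i + y n ^ E := fun E => by
      rw [shear_of_lt y _ (by lia), Function.update_self]
    have hE : ∀ E, 2 ≤ E → ∀ j, 2 ≤ Function.update e i E j := fun E h j => by
      rcases eq_or_ne j i with rfl | hj
      · rwa [Function.update_self]
      · rw [Function.update_of_ne hj]
        exact he j
    set P : ℕ → Ideal R := fun E => Id (KoszulTor.shear y n (Function.update e i E)) (i + 1) with hP
    have hle : ∀ E, Id (KoszulTor.shear y n e) i ≤ P E := fun E => by
      rw [← Id_congr (hup E)]
      exact Id_mono _ (by lia)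
    have hmem : ∀ E r, r ∈ P E ↔ ∃ t, r - (y i + y n ^ E) * t ∈ Id (KoszulTor.shear y n e) i :=
      fun E r => by rw [hP, mem_Id_succ, Id_congr (hup E), hup']
    have hprime : ∀ E, 2 ≤ E → (P E).IsPrime := fun E h => (hy.shear (hE E h)).isPrime_Id (by lia)
    have hyP : ∀ E, 2 ≤ E → y i ∉ P E := fun E h hyi => by
      have h1 : y i + y n ^ E ∈ P E := by
        have := mem_Id (w := KoszulTor.shear y n (Function.update e i E)) (Nat.lt_succ_self i)
        rwa [hup'] at this
      have h2 := (hprime E h).mem_of_pow_mem _ ((Ideal.add_mem_iff_right _ hyi).mp h1)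
      refine (hy.shear (hE E h)).not_mem_Id (i := i + 1) (j := n) hi (by lia) ?_
      rwa [shear_self]
    have hstep : ∀ b, (∀ E, 2 ≤ E → b ∈ P E) →
        ∃ c, b - y i * c ∈ Id (KoszulTor.shear y n e) i ∧ ∀ E, 2 ≤ E → c ∈ P E := fun b hb => by
      have h1 : b ∈ Id (KoszulTor.shear y n e) i ⊔ Ideal.span {y i} := by
        by_contra hb'
        obtain ⟨k, hk⟩ := exists_notMem_ideal_sup_pow hb'
        obtain ⟨t, ht⟩ := (hmem (k + 2) b).mp (hb _ (by lia))
        refine hk ?_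
        rw [show b = (b - (y i + y n ^ (k + 2)) * t + y i * t) + y n ^ (k + 2) * t by ring]
        refine Ideal.add_mem _ (Ideal.mem_sup_left (add_mem (Ideal.mem_sup_left ht)
          (Ideal.mem_sup_right (Ideal.mul_mem_right _ _ (Ideal.mem_span_singleton_self _)))))
          (Ideal.mem_sup_right (Ideal.mul_mem_right _ _ ?_))
        exact Ideal.pow_le_pow_right (by lia) (Ideal.pow_mem_pow (hy.mem (Nat.lt_succ_self n)) _)
      obtain ⟨r, hr, s, hs, rfl⟩ := Submodule.mem_sup.mp h1
      obtain ⟨c, rfl⟩ := Ideal.mem_span_singleton'.mp hs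
      refine ⟨c, by rwa [mul_comm, add_sub_cancel_right], fun E h => ?_⟩
      have h3 := (Ideal.add_mem_iff_right _ (hle E hr)).mp (hb E h)
      exact ((hprime E h).mem_or_mem h3).resolve_right (hyP E h)
    have hpow : ∀ k, ∃ c, a - y i ^ k * c ∈ Id (KoszulTor.shear y n e) i ∧ ∀ E, 2 ≤ E → c ∈ P E := by
      intro k
      induction k with
      | zero =>
        exact ⟨a, by simp, fun E h => hcon _ (hE E h)⟩
      | succ k ih =>
        obtain ⟨c, hc, hc'⟩ := ih
        obtain ⟨c', h1, h2⟩ := hstep c hc'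
        refine ⟨c', ?_, h2⟩
        rw [show a - y i ^ (k + 1) * c' = (a - y i ^ k * c) + y i ^ k * (c - y i * c') by ring]
        exact add_mem hc (Ideal.mul_mem_left _ _ h1)
    obtain ⟨k, hk⟩ := exists_notMem_ideal_sup_pow hae
    obtain ⟨c, hc, -⟩ := hpow k
    refine hk ?_
    rw [← sub_add_cancel a (y i ^ k * c)]
    exact Ideal.add_mem _ (Ideal.mem_sup_left hc) (Ideal.mem_sup_right (Ideal.mul_mem_right _ _
      (Ideal.pow_mem_pow (hy.mem (by lia)) _)))

open PowerSeries in
/-- An element outside the ideal of all but the last parameter has nonzero image in the power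
series ring over the residue field. -/
theorem RegPar.map_residue_ne_zero {A : Type*} [CommRing A] [IsLocalRing A] {x : ℕ → A}
    (hx : ∀ j < n, x j ∈ maximalIdeal A) (hy : RegPar y (n + 1)) (ι : R →+* A⟦X⟧)
    (hι : ∀ j < n + 1, ι (y j) = extX x n j) {a : R} (ha : a ∉ Id y n) :
    (ι a).map (residue A) ≠ 0 := by
  have h0 : ∀ r ∈ Id y n, (ι r).map (residue A) = 0 := fun r hr => by
    have : Id y n ≤ RingHom.ker ((PowerSeries.map (residue A)).comp ι) := Id_le fun j hj => by
      rw [RingHom.mem_ker, RingHom.comp_apply, hι j (by lia), extX_of_lt _ hj, PowerSeries.map_C,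
        (residue_eq_zero_iff _).mpr (hx j hj), map_zero]
    exact this hr
  have hn : (ι (y n)).map (residue A) = X := by
    rw [hι n (by lia), extX_self, PowerSeries.map_X]
  obtain ⟨k, hk⟩ := exists_notMem_ideal_sup_pow ha
  have key : ∀ k, (∃ r, a - y n ^ k * r ∈ Id y n) ∨ ∃ e r, IsUnit r ∧ a - y n ^ e * r ∈ Id y n := by
    intro k
    induction k with
    | zero => exact .inl ⟨a, by simp⟩
    | succ k ih =>
      rcases ih with ⟨r, hr⟩ | h
      · by_cases hu : IsUnit r
        · exact .inr ⟨k, r, hu, hr⟩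
        · have : r ∈ Id y (n + 1) := by rwa [hy.span]
          obtain ⟨t, ht⟩ := mem_Id_succ.mp this
          refine .inl ⟨t, ?_⟩
          rw [show a - y n ^ (k + 1) * t = (a - y n ^ k * r) + y n ^ k * (r - y n * t) by ring]
          exact add_mem hr (Ideal.mul_mem_left _ _ ht)
      · exact .inr h
  rcases key k with ⟨r, hr⟩ | ⟨e, r, hu, hr⟩
  · refine absurd ?_ hk
    rw [← sub_add_cancel a (y n ^ k * r)]
    exact Ideal.add_mem _ (Ideal.mem_sup_left hr) (Ideal.mem_sup_right (Ideal.mul_mem_right _ _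
      (Ideal.pow_mem_pow (hy.mem (by lia)) _)))
  · have h1 := h0 _ hr
    rw [map_sub, map_sub, sub_eq_zero] at h1
    rw [h1, map_mul, map_mul, map_pow, map_pow, hn]
    exact mul_ne_zero (pow_ne_zero _ X_ne_zero) ((hu.map ι).map (PowerSeries.map (residue A))).ne_zero
end

section
lemma RegPar.congr_sq {R : Type*} [CommRing R] [IsLocalRing R] [IsNoetherianRing R] {x x' : ℕ → R}
    {n : ℕ} (hx : RegPar x n) (h : ∀ j < n, x' j - x j ∈ maximalIdeal R ^ 2) : RegPar x' n := by
  have h2 : maximalIdeal R ^ 2 ≤ maximalIdeal R := Ideal.pow_le_self two_ne_zero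
  refine ⟨le_antisymm (Id_le fun j hj => ?_) ?_, hx.dim⟩
  · rw [← sub_add_cancel (x' j) (x j)]
    exact add_mem (h2 (h j hj)) (hx.mem hj)
  · refine Submodule.le_of_le_smul_of_le_jacobson_bot (IsNoetherian.noetherian _)
      (IsLocalRing.maximalIdeal_le_jacobson _) ?_
    nth_rw 1 [← hx.span]
    refine Id_le fun j hj => ?_
    rw [← sub_sub_cancel (x' j) (x j), smul_eq_mul, ← pow_two]
    exact Ideal.sub_mem _ (Ideal.mem_sup_left (mem_Id hj)) (Ideal.mem_sup_right (h j hj))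

lemma isJacobsonRing_int : IsJacobsonRing ℤ := by
  rw [isJacobsonRing_iff_prime_eq]
  intro P hP
  rcases eq_or_ne P ⊥ with rfl | hP0
  · refine le_antisymm (fun x hx => ?_) Ideal.le_jacobson
    have h := Int.isUnit_iff.mp (Ideal.mem_jacobson_bot.mp hx x)
    rw [Ideal.mem_bot]
    exact mul_self_eq_zero.mp (by have := mul_self_nonneg x; lia)
  · have := hP.isMaximal hP0
    exact Ideal.jacobson_eq_self_of_isMaximal

/-- A nontrivial finitely generated ring maps to a field of positive characteristic. -/
lemma exists_ringHom_field_charP {R : Type u} [CommRing R] [Nontrivial R] (S : Finset R) :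
    ∃ (F : Type u) (_ : Field F) (p : ℕ) (_ : Subring.closure (S : Set R) →+* F),
      p.Prime ∧ (p : F) = 0 := by
  obtain ⟨𝔫, h𝔫⟩ := Ideal.exists_maximal (Subring.closure (S : Set R))
  letI : Field (Subring.closure (S : Set R) ⧸ 𝔫) := Ideal.Quotient.field 𝔫
  have hsurj : Function.Surjective (MvPolynomial.aeval (R := ℤ) fun s : S =>
      (⟨s, Subring.subset_closure s.2⟩ : Subring.closure (S : Set R))) := by
    rintro ⟨r, hr⟩
    induction hr using Subring.closure_induction with
    | mem r hr => exact ⟨MvPolynomial.X ⟨r, hr⟩, MvPolynomial.aeval_X _ _⟩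
    | zero => exact ⟨0, map_zero _⟩
    | one => exact ⟨1, map_one _⟩
    | add a b _ _ ha hb =>
      obtain ⟨p, hp⟩ := ha
      obtain ⟨q, hq⟩ := hb
      exact ⟨p + q, by rw [map_add, hp, hq]; rfl⟩
    | neg a _ ha =>
      obtain ⟨p, hp⟩ := ha
      exact ⟨-p, by rw [map_neg, hp]; rfl⟩
    | mul a b _ _ ha hb =>
      obtain ⟨p, hp⟩ := ha
      obtain ⟨q, hq⟩ := hb
      exact ⟨p * q, by rw [map_mul, hp, hq]; rfl⟩
  have h1 : Algebra.FiniteType ℤ (Subring.closure (S : Set R)) :=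
    Algebra.FiniteType.of_surjective _ hsurj
  have h2 : Algebra.FiniteType ℤ (Subring.closure (S : Set R) ⧸ 𝔫) :=
    Algebra.FiniteType.of_surjective (Ideal.Quotient.mk 𝔫).toIntAlgHom
      Ideal.Quotient.mk_surjective
  have := isJacobsonRing_int
  have h3 : Module.Finite ℤ (Subring.closure (S : Set R) ⧸ 𝔫) :=
    finite_of_finite_type_of_isJacobsonRing _ _
  have h4 : Algebra.IsIntegral ℤ (Subring.closure (S : Set R) ⧸ 𝔫) := inferInstance
  refine ⟨_, inferInstance, ringChar (Subring.closure (S : Set R) ⧸ 𝔫), Ideal.Quotient.mk 𝔫, ?_,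
    CharP.cast_eq_zero _ _⟩
  refine (CharP.char_is_prime_or_zero (Subring.closure (S : Set R) ⧸ 𝔫) _).resolve_right fun h0 => Int.not_isField ?_
  have : CharP (Subring.closure (S : Set R) ⧸ 𝔫) 0 := h0 ▸ ringChar.charP _
  have : CharZero (Subring.closure (S : Set R) ⧸ 𝔫) := CharP.charP_to_charZero _
  exact isField_of_isIntegral_of_isField (R := ℤ) (S := Subring.closure (S : Set R) ⧸ 𝔫)
    (FaithfulSMul.algebraMap_injective _ _) (Field.toIsField _)

lemma charZero_of_prime_notMem {R : Type*} [CommRing R] [IsLocalRing R] [IsDomain R]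
    (h0 : ∀ p : ℕ, p.Prime → (p : R) ∉ maximalIdeal R) : CharZero R := by
  have : CharP R 0 := by
    rcases CharP.char_is_prime_or_zero R (ringChar R) with hp | hp
    · exact absurd (by rw [CharP.cast_eq_zero]; exact zero_mem _) (h0 _ hp)
    · exact hp ▸ ringChar.charP R
  exact CharP.charP_to_charZero R

open Polynomial Filter in
/-- Finitely many elements of a regular local ring of residue characteristic zero can be specialized
to a regular local ring of positive characteristic, preserving a system of regular parameters. -/
theorem RegPar.exists_specialization (n : ℕ) : ∀ (R : Type u) [CommRing R] [IsLocalRing R]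
    [IsNoetherianRing R] (y : ℕ → R), RegPar y n → (∀ p : ℕ, p.Prime → (p : R) ∉ maximalIdeal R) →
    ∀ S : Finset R, (∀ j < n, y j ∈ S) →
    ∃ (R' : Type u) (_ : CommRing R') (_ : IsLocalRing R') (_ : IsNoetherianRing R') (p : ℕ)
      (φ : Subring.closure (S : Set R) →+* R'), p.Prime ∧ (p : R') = 0 ∧
        RegPar (fun j => φ (lft _ (y j))) n := by
  induction n with
  | zero =>
    intro R _ _ _ y _ _ S _
    obtain ⟨F, _, p, φ, hp, hpF⟩ := exists_ringHom_field_charP S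
    exact ⟨F, inferInstance, inferInstance, inferInstance, p, φ, hp, hpF,
      ⟨by rw [Id_zero, maximalIdeal_eq_bot], by simp⟩⟩
  | succ n ih =>
    intro R _ _ _ y hy h0 S hyS
    have := hy.isDomain
    have := charZero_of_prime_notMem h0
    obtain ⟨σ, _, t, θ, f, E, G, hf, hd, hE, hG, hrel⟩ :=
      exists_specialization_data (Subtype.val : S → R)
    obtain ⟨e, he, hae⟩ := hy.exists_shear_notMem (mul_ne_zero (pow_ne_zero 2 hd) hE)
    obtain ⟨A, _, _, _, κ, x, hA⟩ := exists_isFormalPower (ResidueField R) n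
    have hz := hy.shear he
    obtain ⟨ι, hι⟩ := hA.powerSeries.exists_ringHom hz h0
    have ha := hz.map_residue_ne_zero (fun j hj => hA.par.mem hj) ι hι hae
    have := hA.par.isDomain
    have := hA.complete
    have hιn : ι (y n) = PowerSeries.X := by
      rw [← shear_self y n e, hι n (by lia), extX_self]
    have hιy : ∀ i < n, ι (y i) = PowerSeries.C (x i) - PowerSeries.X ^ e i := fun i hi => by
      rw [← extX_of_lt x hi, ← hι i (by lia), shear_of_lt y e hi, map_add, map_pow, hιn,
        add_sub_cancel_right]
    obtain ⟨T, Θ, P, F, Q, Y, H, hP, hf', hd', hQ, hG', hY⟩ :=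
      exists_polynomial_approximation (t := fun i => ι (t i)) (θ := ι θ) (c := fun i : S => ι i)
        (f := f) (E := E) (G := G)
        (by rw [← map_evq, hf, map_zero])
        (fun i => by rw [← map_evp, ← map_evq, ← map_mul, hG])
        (by rwa [← map_evp, ← map_evq, ← map_pow, ← map_mul])
    have hYn : Y ⟨y n, hyS n (by lia)⟩ = X := hY _ _ (by rw [coe_X]; exact hιn)
    have hYi : ∀ i (hi : i < n), Y ⟨y i, hyS i (by lia)⟩ = C (x i) - X ^ e i := fun i hi =>
      hY _ _ (by rw [coe_sub, coe_C, coe_pow, coe_X]; exact hιy i hi)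
    have hxS : ∀ᶠ S' : Finset A in atTop, ∀ j < n, x j ∈ S' := by
      classical
      filter_upwards [eventually_ge_atTop ((Finset.range n).image x)] with S' hS' j hj
      exact hS' (Finset.mem_image_of_mem x (Finset.mem_range.mpr hj))
    obtain ⟨S', hsol, hxS'⟩ := ((eventually_exists_solution hP hf' hd' hQ hG').and hxS).exists
    have hA0 : ∀ p : ℕ, p.Prime → (p : A) ∉ maximalIdeal A := fun p hp h => by
      have h1 : (p : ResidueField R) ≠ 0 := fun h2 =>
        h0 p hp ((residue_eq_zero_iff _).mp (by rwa [map_natCast]))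
      have h3 := (h1.isUnit).map κ
      rw [map_natCast] at h3
      exact h h3
    obtain ⟨A', _, _, _, p, φ, hp, hpA', hx'⟩ := ih A x hA.par hA0 S' hxS'
    have := hx'.isDomain
    obtain ⟨t', θ', c', h1, h2, h3, h4⟩ := hsol A' φ
    obtain ⟨ψ, hψ⟩ := exists_ringHom_closure (Subtype.val : S → R) c' (hrel _ t' θ' c' h1 h2 h3)
    have hle : Subring.closure (S : Set R) ≤ Subring.closure (Set.range (Subtype.val : S → R)) :=
      Subring.closure_mono fun r hr => ⟨⟨r, hr⟩, rfl⟩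
    refine ⟨PowerSeries A', inferInstance, inferInstance, inferInstance, p,
      ψ.comp (Subring.inclusion hle), hp, ?_, ?_⟩
    · rw [← map_natCast (PowerSeries.C : A' →+* PowerSeries A'), hpA', map_zero]
    · have hval : ∀ j (hj : j < n + 1), (ψ.comp (Subring.inclusion hle)) (lft _ (y j)) =
          c' ⟨y j, hyS j hj⟩ := fun j hj => by
        rw [← hψ, RingHom.comp_apply]
        congr 1
        apply Subtype.ext
        exact coe_lft (Subring.subset_closure (hyS j hj))
      have hX : ∀ k, 2 ≤ k → (PowerSeries.X : PowerSeries A') ^ k ∈ maximalIdeal (PowerSeries A') ^ 2 :=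
        fun k hk => Ideal.pow_le_pow_right hk (Ideal.pow_mem_pow X_mem_maximalIdeal k)
      have hX' : ∀ g : PowerSeries A', PowerSeries.X ^ 2 ∣ g → g ∈ maximalIdeal (PowerSeries A') ^ 2 :=
        fun g ⟨b, hb⟩ => hb ▸ Ideal.mul_mem_right _ _ (hX 2 le_rfl)
      refine hx'.powerSeries.congr_sq fun j hj => ?_
      rw [hval j hj]
      rcases Nat.lt_succ_iff_lt_or_eq.mp hj with hjn | rfl
      · have h5 := hX' _ (h4 ⟨y j, hyS j hj⟩ (C (lft _ (x j)) - X ^ e j) (by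
          rw [hYi j hjn, Polynomial.map_sub, Polynomial.map_pow, map_X, map_C,
            coe_lft (Subring.subset_closure (hxS' j hjn))]))
        rw [Polynomial.map_sub, Polynomial.map_pow, map_X, map_C, coe_sub, coe_pow, coe_X, coe_C,
          sub_sub_eq_add_sub, add_sub_right_comm] at h5
        rw [extX_of_lt _ hjn]
        exact (Ideal.add_mem_iff_left _ (hX _ (he j))).mp h5
      · have h5 := hX' _ (h4 ⟨y j, hyS j hj⟩ X (by rw [hYn, map_X]))
        rw [map_X, coe_X] at h5
        rwa [extX_self]
end

section
variable {R : Type u} [CommRing R] [IsLocalRing R] [IsNoetherianRing R] {y : ℕ → R} {n : ℕ}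

lemma exists_regPar (h : IsRegularLocal R) : ∃ (y : ℕ → R) (n : ℕ), RegPar y n := by
  obtain ⟨-, n, x, hx, hn⟩ := h
  refine ⟨fun j => if hj : j < n then x ⟨j, hj⟩ else 0, n, ?_, hn⟩
  rw [← range_fin_eq, ← hx]
  congr 2
  ext j
  simp

/-- In residue characteristic zero a ladder would survive specialization to positive
characteristic, where it is impossible. -/
theorem RegPar.exists_contr_of_forall_prime_notMem (hy : RegPar y n) {w : ℕ → R} {d : ℕ}
    (hw : RegSeq w d) (hwm : ∀ j < d, w j ∈ maximalIdeal R) {I : Ideal R}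
    (hI : ∀ P, AssI I P → P.height = d) (hJI : Id w d ≤ I) {u : R} (huI : u ∈ I)
    {𝔭 : Ideal R} (h𝔭 : 𝔭.IsPrime) (hu : ∀ r, r ∈ 𝔭 ↔ r * u ∈ Id w d) {a : ℕ → Fin n → R}
    (ha : Expr (fun j : Fin n => y j) w a d)
    (h0 : ∀ p : ℕ, p.Prime → (p : R) ∉ maximalIdeal R) :
    ∃ κ, In I (wp a d - contr (fun j : Fin n => y j) κ) := by
  refine (hy.contr_or_ladder hw hwm hI hJI huI h𝔭 hu ha).resolve_right ?_
  rintro ⟨w', δ, T, A, T₀, hw'w, hw', hw'm, hδ, hT, h1, h2, h3⟩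
  have hid := Id_congr hw'w
  have huJ : u ∉ Id w' d := fun h =>
    h𝔭.ne_top ((Ideal.eq_top_iff_one _).mpr ((hu 1).mpr (by rwa [one_mul, ← hid])))
  obtain ⟨L, hL⟩ := hy.exists_ladder hw' hw'm hδ hT (𝔭 := 𝔭)
    (fun r hr => by rw [hid]; exact (hu r).mp hr) huJ h1 h2 (by rw [hid]; exact h3)
  have hyS : ∀ᶠ S : Finset R in Filter.atTop, ∀ j < n, y j ∈ S := by
    classical
    filter_upwards [Filter.eventually_ge_atTop ((Finset.range n).image y)] with S hS j hj
    exact hS (Finset.mem_image_of_mem y (Finset.mem_range.mpr hj))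
  obtain ⟨S, ⟨L', hL'⟩, hS⟩ := (L.eventually_closure.and hyS).exists
  obtain ⟨R', _, _, _, p, φ, hp, hpR, hy'⟩ := RegPar.exists_specialization n R y hy h0 S hS
  have : Fact p.Prime := ⟨hp⟩
  refine L'.false φ hy' (fun j hj => ?_) hpR
  congr 1
  apply Subtype.ext
  rw [hL' j hj, hL]
  exact (coe_lft (Subring.subset_closure (hS j hj))).symm

theorem koszulTorMapZero_of_isRegularLocal (hreg : IsRegularLocal R) {I : Ideal R} {d : ℕ}
    (hht : HeightEq R I d) (hnot : ¬ ∃ y : Fin d → R, Ideal.span (Set.range y) = I)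
    (hS2 : SerreS (R ⧸ I) 2) {s : ℕ} {x : Fin s → R} (hx : Ideal.span (Set.range x) = I) :
    KoszulTorMapZero R x I d := by
  obtain ⟨y, n, hy⟩ := exists_regPar hreg
  obtain ⟨⟨P₀, hP₀, hIP₀, hdP₀⟩, hmin⟩ := hht
  have hle : ∀ P : Ideal R, P.IsPrime → I ≤ P → (d : ℕ∞) ≤ P.height := fun P hP hIP => by
    have := hmin P hP hIP
    rw [IsLocalization.AtPrime.ringKrullDim_eq_height P (Localization.AtPrime P)] at this
    exact_mod_cast this
  have hd : P₀.height = d := by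
    rw [IsLocalization.AtPrime.ringKrullDim_eq_height P₀ (Localization.AtPrime P₀)] at hdP₀
    exact_mod_cast hdP₀
  have hI : ∀ P, AssI I P → P.height = d := fun P hP =>
    hy.height_of_serreS hS2 ⟨P₀, hP₀, hIP₀, hd⟩ hle hP
  have hI1 : I ≠ ⊤ := fun h => hP₀.ne_top (top_le_iff.mp (h ▸ hIP₀))
  refine hy.koszulTorMapZero hx hI1 hle fun w hw hwI a ha => ?_
  have hwm : ∀ j < d, w j ∈ maximalIdeal R := fun j hj => le_maximalIdeal hI1 (hwI (mem_Id hj))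
  obtain ⟨u, huI, hu⟩ := SetLike.exists_of_lt
    (hwI.lt_of_ne fun h => hnot ⟨fun j : Fin d => w j, by rw [range_fin_eq, h]⟩)
  obtain ⟨𝔭, t, h𝔭, h𝔭u, -⟩ := exists_assI_mul hu
  have htu : t * u ∈ I := Ideal.mul_mem_left _ _ huI
  by_cases h0 : ∃ p : ℕ, p.Prime ∧ (p : R) ∈ maximalIdeal R
  · obtain ⟨p, hp, hpm⟩ := h0
    have : Fact p.Prime := ⟨hp⟩
    by_cases hp𝔭 : (p : R) ∈ 𝔭
    · exact hy.exists_contr_of_natCast_mem hw hwm hI hwI htu h𝔭 h𝔭u ha hp𝔭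
    · exact hy.exists_contr_of_natCast_notMem hw hwm hI hS2 hwI htu h𝔭 h𝔭u ha hpm hp𝔭
  · push Not at h0
    exact hy.exists_contr_of_forall_prime_notMem hw hwm hI hwI htu h𝔭 h𝔭u ha h0
end

end KoszulTor

/-- Let `(R,m,k)` be a regular local ring and let `I` be an
ideal of height `d` that is not generated by `d` elements, such that `R/I`
satisfies Serre's condition `S_2`.  Let `x₁,…,x_s` be a minimal set of
generators of `I`.  Then the natural map `K_d(x;R) ⊗_R k → Tor_d^R(R/I, k)` is
the zero map. -/
theorem statement1
    (R : Type u) [CommRing R] [IsLocalRing R] (hreg : IsRegularLocal R)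
    (I : Ideal R) (d : ℕ) (hht : HeightEq R I d)
    (hnot : ¬ ∃ y : Fin d → R, Ideal.span (Set.range y) = I)
    (hS2 : SerreS (R ⧸ I) 2)
    {s : ℕ} (x : Fin s → R) (hmin : MinimalGenerators R x I) :
    KoszulTorMapZero R x I d := by
  have := hreg.1
  exact KoszulTor.koszulTorMapZero_of_isRegularLocal hreg hht hnot hS2 hmin.1
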